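/- arXiv:1205.6056 — 5 statements merged into one kernel-verified Lean document; each statement's English description precedes it below -/
import Mathlib

section
/- For all integers n ≥ 1 and k ≥ 8, Γ_7(n,k) = (31/168)·[2^{4n} − 15·2^{3n} + 70·2^{2n} − 120·2^n + 64]·2^{3k} + (1/96)·[1395·2^{5n} − 45229·2^{4n} + 462210·2^{3n} − 1868680·2^{2n} + 3005760·2^n − 1555456]·2^{2k} + (1/48)·[8001·2^{6n} − 571023·2^{5n} + 12524806·2^{4n} − 110524920·2^{3n} + 418606144·2^{2n} − 652818432·2^n + 332775424]·2^k + (1/21)·[5355·2^{7n} − 904113·2^{6n} + 43302294·2^{5n} − 817168432·2^{4n} + 6743660640·2^{3n} − 96649567·2^8·2^{2n} + 4637778·2^{13}·2^n − 293263·2^{16}], where the rational expressions combine to an integer identity. -/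
open Finset

/-- The `2n × k` n-times persymmetric matrix over `F_2` associated to a parameter tuple
`alpha ∈ (F_2^{k+1})^n` : for `1 ≤ j ≤ n`, rows `2j-1` and `2j` are
`(alpha^(j)_1, ..., alpha^(j)_k)` and `(alpha^(j)_2, ..., alpha^(j)_{k+1})`. -/
def persymMatrix (n k : ℕ) (α : Fin n → Fin (k + 1) → ZMod 2) :
    Matrix (Fin (2 * n)) (Fin k) (ZMod 2) :=
  Matrix.of fun r c =>
    α ⟨r.val / 2, by have := r.isLt; omega⟩ ⟨r.val % 2 + c.val, by have := c.isLt; omega⟩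

/-- `Gamma n k i` is the number of parameter tuples `alpha ∈ (F_2^{k+1})^n` whose associated
n-times persymmetric `2n × k` matrix over `F_2` has rank `i`. -/
noncomputable def Gamma (n k i : ℕ) : ℕ :=
  Nat.card {α : Fin n → Fin (k + 1) → ZMod 2 // (persymMatrix n k α).rank = i}


/-! ### The finite-state recursion -/

/-- Weighted count of continuations of length `k` from the state `(d, m, flag)`. -/
def cc (x : ℚ) : ℕ → ℕ → ℕ → Bool → ℚ
  | 0, d, m, _ => if d + m = 7 then 1 else 0
  | k + 1, d, m, true => 2 ^ d * cc x k d m true + (2 ^ m - 2 ^ d) * cc x k (d + 1) m true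
      + (x - 2 ^ m) * cc x k (d + 1) m false
  | k + 1, d, m, false => 2 ^ (m + 1) * cc x k d (m + 1) true
      + (x - 2 ^ (m + 1)) * cc x k d (m + 1) false

theorem cc_big (x : ℚ) (k : ℕ) : ∀ (d m : ℕ) (f : Bool), 7 < d + m → cc x k d m f = 0 := by
  induction k with
  | zero => intro d m f h; simp only [cc]; rw [if_neg (by omega)]
  | succ k ih =>
    intro d m f h
    cases f
    · simp only [cc]
      rw [ih _ _ _ (by omega), ih _ _ _ (by omega)]; ring
    · simp only [cc]
      rw [ih _ _ _ (by omega), ih _ _ _ (by omega), ih _ _ _ (by omega)]; ring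

theorem cc_small (x : ℚ) (k : ℕ) : ∀ (d m : ℕ) (f : Bool), k + d + m < 7 → cc x k d m f = 0 := by
  induction k with
  | zero => intro d m f h; simp only [cc]; rw [if_neg (by omega)]
  | succ k ih =>
    intro d m f h
    cases f
    · simp only [cc]
      rw [ih _ _ _ (by omega), ih _ _ _ (by omega)]; ring
    · simp only [cc]
      rw [ih _ _ _ (by omega), ih _ _ _ (by omega), ih _ _ _ (by omega)]; ring

/-- Closed form of `cc` at a state: the value `A0` at time `c` and `A (2^j)` at time `c + 1 + j`. -/
def Sol (x : ℚ) (d m : ℕ) (f : Bool) (c : ℕ) (A0 : ℚ) (A : ℚ → ℚ) : Prop :=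
  cc x c d m f = A0 ∧ ∀ j : ℕ, cc x (j + 1 + c) d m f = A (2 ^ j)

theorem sol_t {x : ℚ} (d m c : ℕ) (hc : d + m + c + 1 = 7) {A0 B0 D : ℚ} {A B T : ℚ → ℚ}
    (hA : m = d ∨ Sol x (d + 1) m true c A0 A) (hB : Sol x (d + 1) m false c B0 B)
    (hD : (2 ^ m - 2 ^ d) * A0 + (x - 2 ^ m) * B0 = D)
    (h0 : 2 ^ d * D + (2 ^ m - 2 ^ d) * A 1 + (x - 2 ^ m) * B 1 = T 1)
    (hs : ∀ y, 2 ^ d * T y + (2 ^ m - 2 ^ d) * A (2 * y) + (x - 2 ^ m) * B (2 * y) = T (2 * y)) :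
    Sol x d m true (c + 1) D T := by
  have e0 : (2 ^ m - 2 ^ d) * cc x c (d + 1) m true = (2 ^ m - 2 ^ d) * A0 := by
    rcases hA with h | h
    · rw [h]; ring
    · rw [h.1]
  have e1 : ∀ j : ℕ, (2 ^ m - 2 ^ d) * cc x (j + 1 + c) (d + 1) m true
      = (2 ^ m - 2 ^ d) * A (2 ^ j) := by
    intro j
    rcases hA with h | h
    · rw [h]; ring
    · rw [h.2]
  have d0 : cc x (c + 1) d m true = D := by
    rw [cc, cc_small x c d m true (by omega), e0, hB.1, ← hD]; ring
  refine ⟨d0, ?_⟩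
  intro j
  induction j with
  | zero =>
    have h : cc x (0 + 1 + (c + 1)) d m true = cc x ((c + 1) + 1) d m true := by
      congr 1; omega
    have b := hB.2 0
    have a := e1 0
    rw [show 0 + 1 + c = c + 1 by omega] at a b
    rw [h, cc, d0, a, b, pow_zero, h0]
  | succ j ih =>
    have h : cc x (j + 1 + 1 + (c + 1)) d m true = cc x ((j + 1 + (c + 1)) + 1) d m true := by
      congr 1; omega
    have b := hB.2 (j + 1)
    have a := e1 (j + 1)
    rw [show j + 1 + 1 + c = j + 1 + (c + 1) by omega] at a b
    rw [h, cc, ih, a, b, pow_succ, mul_comm ((2 : ℚ) ^ j) 2, hs]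

theorem sol_f {x : ℚ} (d m c : ℕ) {A0 B0 D : ℚ} {A B T : ℚ → ℚ}
    (hA : Sol x d (m + 1) true c A0 A) (hB : Sol x d (m + 1) false c B0 B)
    (hD : 2 ^ (m + 1) * A0 + (x - 2 ^ (m + 1)) * B0 = D)
    (hs : ∀ y, 2 ^ (m + 1) * A y + (x - 2 ^ (m + 1)) * B y = T y) :
    Sol x d m false (c + 1) D T := by
  refine ⟨?_, ?_⟩
  · rw [cc, hA.1, hB.1, hD]
  · intro j
    have h : cc x (j + 1 + (c + 1)) d m false = cc x ((j + 1 + c) + 1) d m false := by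
      congr 1
    rw [h, cc, hA.2, hB.2, hs]

theorem sol7_t (x : ℚ) (d m : ℕ) (h : d + m = 7) :
    Sol x d m true 0 1 (fun y => 2 ^ d * y ^ d) := by
  have key : ∀ k : ℕ, cc x k d m true = (2 ^ k) ^ d := by
    intro k
    induction k with
    | zero => simp [cc, h]
    | succ k ih =>
      rw [cc, ih, cc_big x k (d + 1) m _ (by omega), cc_big x k (d + 1) m _ (by omega)]
      rw [pow_succ (2 : ℚ) k, mul_pow]; ring
  refine ⟨by simpa using key 0, fun j => ?_⟩
  rw [key]; simp only [add_zero]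
  rw [pow_succ, mul_pow]; ring

theorem sol7_f (x : ℚ) (d m : ℕ) (h : d + m = 7) :
    Sol x d m false 0 1 (fun _ => 0) := by
  refine ⟨by simp [cc, h], fun j => ?_⟩
  rw [add_zero, cc, cc_big x j d (m + 1) _ (by omega), cc_big x j d (m + 1) _ (by omega)]
  ring

theorem st_3_3 (x : ℚ) : Sol x 3 3 true 1
      ((1 * x + (-8)))
      (fun y => (8 * x + (-64)) * y ^ 3) :=
  sol_t 3 3 0 (by norm_num) (A0 := 0) (A := fun _ => 0) (Or.inl rfl) ((fun x => sol7_f x 4 3 rfl) x)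
    (by ring) (by ring) (fun y => by ring)

theorem sf_3_3 (x : ℚ) : Sol x 3 3 false 1
      ((1 * x))
      (fun y => (128) * y ^ 3) :=
  sol_f 3 3 0 ((fun x => sol7_t x 3 4 rfl) x) ((fun x => sol7_f x 3 4 rfl) x)
    (by ring) (fun y => by ring)

theorem sf_3_2 (x : ℚ) : Sol x 3 2 false 2
      ((1 * x ^ 2 + (-64)))
      (fun y => (192 * x + (-1536)) * y ^ 3) :=
  sol_f 3 2 1 (st_3_3 x) (sf_3_3 x)
    (by ring) (fun y => by ring)

theorem st_2_2 (x : ℚ) : Sol x 2 2 true 3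
      ((1 * x ^ 3 + (-4) * x ^ 2 + (-64) * x + 256))
      (fun y => (384 * x ^ 2 + (-4608) * x + 12288) * y ^ 3
        + (4 * x ^ 3 + (-208) * x ^ 2 + 2048 * x + (-5120)) * y ^ 2) :=
  sol_t 2 2 2 (by norm_num) (A0 := 0) (A := fun _ => 0) (Or.inl rfl) (sf_3_2 x)
    (by ring) (by ring) (fun y => by ring)

theorem st_2_3 (x : ℚ) : Sol x 2 3 true 2
      ((1 * x ^ 2 + (-4) * x + (-32)))
      (fun y => (320 * x + (-2560)) * y ^ 3
        + (4 * x ^ 2 + (-176) * x + 1152) * y ^ 2) :=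
  sol_t 2 3 1 (by norm_num) (Or.inr (st_3_3 x)) (sf_3_3 x)
    (by ring) (by ring) (fun y => by ring)

theorem st_2_4 (x : ℚ) : Sol x 2 4 true 1
      ((1 * x + (-4)))
      (fun y => (192) * y ^ 3
        + (4 * x + (-112)) * y ^ 2) :=
  sol_t 2 4 0 (by norm_num) (Or.inr ((fun x => sol7_t x 3 4 rfl) x)) ((fun x => sol7_f x 3 4 rfl) x)
    (by ring) (by ring) (fun y => by ring)

theorem sf_2_4 (x : ℚ) : Sol x 2 4 false 1
      ((1 * x))
      (fun y => (128) * y ^ 2) :=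
  sol_f 2 4 0 ((fun x => sol7_t x 2 5 rfl) x) ((fun x => sol7_f x 2 5 rfl) x)
    (by ring) (fun y => by ring)

theorem sf_2_3 (x : ℚ) : Sol x 2 3 false 2
      ((1 * x ^ 2 + (-64)))
      (fun y => (3072) * y ^ 3
        + (192 * x + (-3840)) * y ^ 2) :=
  sol_f 2 3 1 (st_2_4 x) (sf_2_4 x)
    (by ring) (fun y => by ring)

theorem sf_2_2 (x : ℚ) : Sol x 2 2 false 3
      ((1 * x ^ 3 + (-96) * x + 256))
      (fun y => (5632 * x + (-45056)) * y ^ 3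
        + (224 * x ^ 2 + (-6784) * x + 39936) * y ^ 2) :=
  sol_f 2 2 2 (st_2_3 x) (sf_2_3 x)
    (by ring) (fun y => by ring)

theorem sf_2_1 (x : ℚ) : Sol x 2 1 false 4
      ((1 * x ^ 4 + (-112) * x ^ 2 + 384 * x))
      (fun y => (7168 * x ^ 2 + (-86016) * x + 229376) * y ^ 3
        + (240 * x ^ 3 + (-8512) * x ^ 2 + 75264 * x + (-180224)) * y ^ 2) :=
  sol_f 2 1 3 (st_2_2 x) (sf_2_2 x)
    (by ring) (fun y => by ring)

theorem st_1_1 (x : ℚ) : Sol x 1 1 true 5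
      ((1 * x ^ 5 + (-2) * x ^ 4 + (-112) * x ^ 3 + 608 * x ^ 2 + (-768) * x))
      (fun y => ((28672/3) * x ^ 3 + (-401408/3) * x ^ 2 + (1605632/3) * x + (-1835008/3)) * y ^ 3
        + (480 * x ^ 4 + (-17984) * x ^ 3 + 184576 * x ^ 2 + (-661504) * x + 720896) * y ^ 2
        + (2 * x ^ 5 + (-244) * x ^ 4 + (19136/3) * x ^ 3 + (-172864/3) * x ^ 2 + (586240/3) * x + (-622592/3)) * y) :=
  sol_t 1 1 4 (by norm_num) (A0 := 0) (A := fun _ => 0) (Or.inl rfl) (sf_2_1 x)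
    (by ring) (by ring) (fun y => by ring)

theorem st_1_2 (x : ℚ) : Sol x 1 2 true 4
      ((1 * x ^ 4 + (-2) * x ^ 3 + (-104) * x ^ 2 + 512 * x + (-512)))
      (fun y => ((25600/3) * x ^ 2 + (-102400) * x + (819200/3)) * y ^ 3
        + (464 * x ^ 3 + (-16192) * x ^ 2 + 142336 * x + (-339968)) * y ^ 2
        + (2 * x ^ 4 + (-236) * x ^ 3 + (17264/3) * x ^ 2 + (-44544) * x + (302080/3)) * y) :=
  sol_t 1 2 3 (by norm_num) (Or.inr (st_2_2 x)) (sf_2_2 x)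
    (by ring) (by ring) (fun y => by ring)

theorem st_1_3 (x : ℚ) : Sol x 1 3 true 3
      ((1 * x ^ 3 + (-2) * x ^ 2 + (-88) * x + 320))
      (fun y => (6656 * x + (-53248)) * y ^ 3
        + (432 * x ^ 2 + (-12864) * x + 75264) * y ^ 2
        + (2 * x ^ 3 + (-220) * x ^ 2 + 4592 * x + (-23680)) * y) :=
  sol_t 1 3 2 (by norm_num) (Or.inr (st_2_3 x)) (sf_2_3 x)
    (by ring) (by ring) (fun y => by ring)

theorem st_1_4 (x : ℚ) : Sol x 1 4 true 2
      ((1 * x ^ 2 + (-2) * x + (-56)))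
      (fun y => (3584) * y ^ 3
        + (368 * x + (-7232)) * y ^ 2
        + (2 * x ^ 2 + (-188) * x + 2608) * y) :=
  sol_t 1 4 1 (by norm_num) (Or.inr (st_2_4 x)) (sf_2_4 x)
    (by ring) (by ring) (fun y => by ring)

theorem st_1_5 (x : ℚ) : Sol x 1 5 true 1
      ((1 * x + (-2)))
      (fun y => (240) * y ^ 2
        + (2 * x + (-124)) * y) :=
  sol_t 1 5 0 (by norm_num) (Or.inr ((fun x => sol7_t x 2 5 rfl) x)) ((fun x => sol7_f x 2 5 rfl) x)
    (by ring) (by ring) (fun y => by ring)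

theorem sf_1_5 (x : ℚ) : Sol x 1 5 false 1
      ((1 * x))
      (fun y => (128) * y) :=
  sol_f 1 5 0 ((fun x => sol7_t x 1 6 rfl) x) ((fun x => sol7_f x 1 6 rfl) x)
    (by ring) (fun y => by ring)

theorem sf_1_4 (x : ℚ) : Sol x 1 4 false 2
      ((1 * x ^ 2 + (-64)))
      (fun y => (7680) * y ^ 2
        + (192 * x + (-8064)) * y) :=
  sol_f 1 4 1 (st_1_5 x) (sf_1_5 x)
    (by ring) (fun y => by ring)

theorem sf_1_3 (x : ℚ) : Sol x 1 3 false 3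
      ((1 * x ^ 3 + (-96) * x + 128))
      (fun y => (57344) * y ^ 3
        + (13568 * x + (-238592)) * y ^ 2
        + (224 * x ^ 2 + (-14144) * x + 170752) * y) :=
  sol_f 1 3 2 (st_1_4 x) (sf_1_4 x)
    (by ring) (fun y => by ring)

theorem sf_1_2 (x : ℚ) : Sol x 1 2 false 4
      ((1 * x ^ 4 + (-112) * x ^ 2 + 192 * x + 1536))
      (fun y => (110592 * x + (-884736)) * y ^ 3
        + (17024 * x ^ 2 + (-450048) * x + 2510848) * y ^ 2
        + (240 * x ^ 3 + (-17696) * x ^ 2 + 320640 * x + (-1555456)) * y) :=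
  sol_f 1 2 3 (st_1_3 x) (sf_1_3 x)
    (by ring) (fun y => by ring)

theorem sf_1_1 (x : ℚ) : Sol x 1 1 false 5
      ((1 * x ^ 5 + (-120) * x ^ 3 + 224 * x ^ 2 + 2816 * x + (-8192)))
      (fun y => ((434176/3) * x ^ 2 + (-1736704) * x + (13893632/3)) * y ^ 3
        + (18880 * x ^ 3 + (-582912) * x ^ 2 + 4880384 * x + (-11403264)) * y ^ 2
        + (248 * x ^ 4 + (-19600) * x ^ 3 + (1243328/3) * x ^ 2 + (-3016192) * x + (19873792/3)) * y) :=
  sol_f 1 1 4 (st_1_2 x) (sf_1_2 x)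
    (by ring) (fun y => by ring)

theorem sf_1_0 (x : ℚ) : Sol x 1 0 false 6
      ((1 * x ^ 6 + (-124) * x ^ 4 + 240 * x ^ 3 + 3584 * x ^ 2 + (-15360) * x + 16384))
      (fun y => (163840 * x ^ 3 + (-2293760) * x ^ 2 + 9175040 * x + (-10485760)) * y ^ 3
        + (19840 * x ^ 4 + (-656640) * x ^ 3 + 6415360 * x ^ 2 + (-22487040) * x + 24248320) * y ^ 2
        + (252 * x ^ 5 + (-20584) * x ^ 4 + 466400 * x ^ 3 + (-3960320) * x ^ 2 + 13047808 * x + (-13664256)) * y) :=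
  sol_f 1 0 5 (st_1_1 x) (sf_1_1 x)
    (by ring) (fun y => by ring)

theorem st_0_0 (x : ℚ) : Sol x 0 0 true 7
      ((1 * x ^ 7 + (-1) * x ^ 6 + (-124) * x ^ 5 + 364 * x ^ 4 + 3344 * x ^ 3 + (-18944) * x ^ 2 + 31744 * x + (-16384)))
      (fun y => ((1310720/7) * x ^ 4 + (-19660800/7) * x ^ 3 + 13107200 * x ^ 2 + (-157286400/7) * x + (83886080/7)) * y ^ 3
        + ((79360/3) * x ^ 5 + (-2705920/3) * x ^ 4 + (28288000/3) * x ^ 3 + (-115609600/3) * x ^ 2 + (186941440/3) * x + (-96993280/3)) * y ^ 2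
        + (504 * x ^ 6 + (-41672) * x ^ 5 + 973968 * x ^ 4 + (-8853440) * x ^ 3 + 34016256 * x ^ 2 + (-53424128) * x + 27328512) * y
        + (1 * x ^ 7 + (-253) * x ^ 6 + (42296/3) * x ^ 5 + (-5975180/21) * x ^ 4 + (50900144/21) * x ^ 3 + (-27094016/3) * x ^ 2 + (293454848/21) * x + (-149012480/21))) :=
  sol_t 0 0 6 (by norm_num) (A0 := 0) (A := fun _ => 0) (Or.inl rfl) (sf_1_0 x)
    (by ring) (by ring) (fun y => by ring)

theorem st_0_1 (x : ℚ) : Sol x 0 1 true 6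
      ((1 * x ^ 6 + (-1) * x ^ 5 + (-122) * x ^ 4 + 352 * x ^ 3 + 2976 * x ^ 2 + (-14592) * x + 16384))
      (fun y => ((3702784/21) * x ^ 3 + (-7405568/3) * x ^ 2 + (29622272/3) * x + (-236978176/21)) * y ^ 3
        + ((77440/3) * x ^ 4 + (-2554624/3) * x ^ 3 + 8307712 * x ^ 2 + (-87302144/3) * x + (94109696/3)) * y ^ 2
        + (500 * x ^ 5 + (-40680) * x ^ 4 + (2760128/3) * x ^ 3 + (-23416192/3) * x ^ 2 + (77114368/3) * x + (-80740352/3)) * y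
        + (1 * x ^ 6 + (-251) * x ^ 5 + (41294/3) * x ^ 4 + (-5645312/21) * x ^ 3 + 2137312 * x ^ 2 + (-20478208/3) * x + (147865600/21))) :=
  sol_t 0 1 5 (by norm_num) (Or.inr (st_1_1 x)) (sf_1_1 x)
    (by ring) (by ring) (fun y => by ring)

theorem st_0_2 (x : ℚ) : Sol x 0 2 true 5
      ((1 * x ^ 5 + (-1) * x ^ 4 + (-118) * x ^ 3 + 328 * x ^ 2 + 2304 * x + (-7680)))
      (fun y => (155648 * x ^ 2 + (-1867776) * x + 4980736) * y ^ 3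
        + ((73664/3) * x ^ 3 + (-2266880/3) * x ^ 2 + (18952192/3) * x + (-44253184/3)) * y ^ 2
        + (492 * x ^ 4 + (-38728) * x ^ 3 + 817376 * x ^ 2 + (-5943296) * x + 13047808) * y
        + (1 * x ^ 5 + (-247) * x ^ 4 + (39322/3) * x ^ 3 + (-716728/3) * x ^ 2 + (4884224/3) * x + (-10399232/3))) :=
  sol_t 0 2 4 (by norm_num) (Or.inr (st_1_2 x)) (sf_1_2 x)
    (by ring) (by ring) (fun y => by ring)

theorem st_0_3 (x : ℚ) : Sol x 0 3 true 4
      ((1 * x ^ 4 + (-1) * x ^ 3 + (-110) * x ^ 2 + 280 * x + 1216))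
      (fun y => (118784 * x + (-950272)) * y ^ 3
        + ((66368/3) * x ^ 2 + (-582912) * x + (9742336/3)) * y ^ 2
        + (476 * x ^ 3 + (-34952) * x ^ 2 + 632096 * x + (-3063552)) * y
        + (1 * x ^ 4 + (-239) * x ^ 3 + (35506/3) * x ^ 2 + (-184888) * x + (2519744/3))) :=
  sol_t 0 3 3 (by norm_num) (Or.inr (st_1_3 x)) (sf_1_3 x)
    (by ring) (by ring) (fun y => by ring)

theorem st_0_4 (x : ℚ) : Sol x 0 4 true 3
      ((1 * x ^ 3 + (-1) * x ^ 2 + (-94) * x + 184))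
      (fun y => (61440) * y ^ 3
        + (17600 * x + (-308480)) * y ^ 2
        + (444 * x ^ 2 + (-27912) * x + 336288) * y
        + (1 * x ^ 3 + (-223) * x ^ 2 + 9462 * x + (-98520))) :=
  sol_t 0 4 2 (by norm_num) (Or.inr (st_1_4 x)) (sf_1_4 x)
    (by ring) (by ring) (fun y => by ring)

theorem st_0_5 (x : ℚ) : Sol x 0 5 true 2
      ((1 * x ^ 2 + (-1) * x + (-62)))
      (fun y => (9920) * y ^ 2
        + (380 * x + (-15880)) * y
        + (1 * x ^ 2 + (-191) * x + 5398)) :=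
  sol_t 0 5 1 (by norm_num) (Or.inr (st_1_5 x)) (sf_1_5 x)
    (by ring) (by ring) (fun y => by ring)

theorem st_0_6 (x : ℚ) : Sol x 0 6 true 1
      ((1 * x + (-1)))
      (fun y => (252) * y
        + (1 * x + (-127))) :=
  sol_t 0 6 0 (by norm_num) (Or.inr ((fun x => sol7_t x 1 6 rfl) x)) ((fun x => sol7_f x 1 6 rfl) x)
    (by ring) (by ring) (fun y => by ring)

theorem sf_0_6 (x : ℚ) : Sol x 0 6 false 1
      ((1 * x))
      (fun _ => (128)) :=
  sol_f 0 6 0 ((fun x => sol7_t x 0 7 rfl) x) ((fun x => sol7_f x 0 7 rfl) x)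
    (by ring) (fun y => by ring)

theorem sf_0_5 (x : ℚ) : Sol x 0 5 false 2
      ((1 * x ^ 2 + (-64)))
      (fun y => (16128) * y
        + (192 * x + (-16320))) :=
  sol_f 0 5 1 (st_0_6 x) (sf_0_6 x)
    (by ring) (fun y => by ring)

theorem sf_0_4 (x : ℚ) : Sol x 0 4 false 3
      ((1 * x ^ 3 + (-96) * x + 64))
      (fun y => (317440) * y ^ 2
        + (28288 * x + (-1024256)) * y
        + (224 * x ^ 2 + (-28576) * x + 694976)) :=
  sol_f 0 4 2 (st_0_5 x) (sf_0_5 x)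
    (by ring) (fun y => by ring)

theorem sf_0_3 (x : ℚ) : Sol x 0 3 false 4
      ((1 * x ^ 4 + (-112) * x ^ 2 + 96 * x + 1920))
      (fun y => (983040) * y ^ 3
        + (599040 * x + (-10014720)) * y ^ 2
        + (35392 * x ^ 2 + (-1923456) * x + 21768704) * y
        + (240 * x ^ 3 + (-35728) * x ^ 2 + 1303584 * x + (-12695936))) :=
  sol_f 0 3 3 (st_0_4 x) (sf_0_4 x)
    (by ring) (fun y => by ring)

theorem sf_0_2 (x : ℚ) : Sol x 0 2 false 5
      ((1 * x ^ 5 + (-120) * x ^ 3 + 112 * x ^ 2 + 3392 * x + (-5632)))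
      (fun y => (1933312 * x + (-15466496)) * y ^ 3
        + ((2328064/3) * x ^ 2 + (-19470336) * x + (318291968/3)) * y ^ 2
        + (39200 * x ^ 3 + (-2486208) * x ^ 2 + 42213120 * x + (-198658048)) * y
        + (248 * x ^ 4 + (-39560) * x ^ 3 + (5052272/3) * x ^ 2 + (-24603712) * x + (324860416/3))) :=
  sol_f 0 2 4 (st_0_3 x) (sf_0_3 x)
    (by ring) (fun y => by ring)

theorem sf_0_1 (x : ℚ) : Sol x 0 1 false 6
      ((1 * x ^ 6 + (-124) * x ^ 4 + 120 * x ^ 3 + 4256 * x ^ 2 + (-9984) * x + (-8192)))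
      (fun y => (2555904 * x ^ 2 + (-30670848) * x + 81788928) * y ^ 3
        + (874240 * x ^ 3 + (-25596928) * x ^ 2 + 209248256 * x + (-483393536)) * y ^ 2
        + (41168 * x ^ 4 + (-2797920) * x ^ 3 + 55427456 * x ^ 2 + (-391283712) * x + 846823424) * y
        + (252 * x ^ 5 + (-41540) * x ^ 4 + 1894760 * x ^ 3 + (-32295712) * x ^ 2 + 213213952 * x + (-447012864))) :=
  sol_f 0 1 5 (st_0_2 x) (sf_0_2 x)
    (by ring) (fun y => by ring)

theorem sf_0_0 (x : ℚ) : Sol x 0 0 false 7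
      ((1 * x ^ 7 + (-126) * x ^ 5 + 124 * x ^ 4 + 4720 * x ^ 3 + (-12544) * x ^ 2 + (-17408) * x + 49152))
      (fun y => ((61079552/21) * x ^ 3 + (-122159104/3) * x ^ 2 + (488636416/3) * x + (-3909091328/21)) * y ^ 3
        + ((2777600/3) * x ^ 4 + (-87145472/3) * x ^ 3 + 277057536 * x ^ 2 + (-2880274432/3) * x + (3088580608/3)) * y ^ 2
        + (42168 * x ^ 5 + (-2961616) * x ^ 4 + (188590144/3) * x ^ 3 + (-1553248256/3) * x ^ 2 + (5042401280/3) * x + (-5242421248/3)) * y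
        + (254 * x ^ 6 + (-42546) * x ^ 5 + (6016108/3) * x ^ 4 + (-769080496/21) * x ^ 3 + 282080000 * x ^ 2 + (-2661278720/3) * x + (19070271488/21))) :=
  sol_f 0 0 6 (st_0_1 x) (sf_0_1 x)
    (by ring) (fun y => by ring)


/-! ### Sequences of vectors and the spans of consecutive pairs -/

open Module in
theorem finrank_split {n : ℕ}
    (V : Submodule (ZMod 2) ((Fin n → ZMod 2) × (Fin n → ZMod 2))) :
    finrank (ZMod 2) V = finrank (ZMod 2) (V.comap (LinearMap.inr (ZMod 2) _ _))
      + finrank (ZMod 2) (V.map (LinearMap.fst (ZMod 2) _ _)) := by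
  set f := (LinearMap.fst (ZMod 2) (Fin n → ZMod 2) (Fin n → ZMod 2)).domRestrict V with hf
  have h := LinearMap.finrank_range_add_finrank_ker f
  have hr : LinearMap.range f = V.map (LinearMap.fst (ZMod 2) _ _) := by
    rw [hf]; ext v; simp
  let e : LinearMap.ker f ≃ₗ[ZMod 2] (V.comap (LinearMap.inr (ZMod 2) (Fin n → ZMod 2) (Fin n → ZMod 2))) :=
    { toFun := fun p => ⟨p.1.1.2, by
        have h1 : p.1.1.1 = 0 := p.2
        have h2 := p.1.2
        have h3 : p.1.1 = (0, p.1.1.2) := Prod.ext h1 rfl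
        rw [h3] at h2
        exact h2⟩
      invFun := fun q => ⟨⟨(0, q.1), q.2⟩, rfl⟩
      map_add' := fun _ _ => rfl
      map_smul' := fun _ _ => rfl
      left_inv := fun p => by
        have h1 : p.1.1.1 = 0 := p.2
        apply Subtype.ext; apply Subtype.ext
        exact Prod.ext h1.symm rfl
      right_inv := fun q => rfl }
  rw [← h, hr, e.finrank_eq, add_comm]

open Module in
theorem finrank_sup_new {M : Type*} [AddCommGroup M] [Module (ZMod 2) M] [Module.Finite (ZMod 2) M]
    (V : Submodule (ZMod 2) M) (v : M) (hv : v ∉ V) :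
    finrank (ZMod 2) (V ⊔ Submodule.span (ZMod 2) {v} : Submodule (ZMod 2) M)
      = finrank (ZMod 2) V + 1 := by
  have h := Submodule.finrank_sup_add_finrank_inf_eq V (Submodule.span (ZMod 2) {v})
  have h0 : v ≠ 0 := fun h => hv (h ▸ V.zero_mem)
  rw [(Submodule.disjoint_span_singleton_of_notMem hv).eq_bot, finrank_bot,
    finrank_span_singleton h0] at h
  simpa using h

open Classical in
theorem card_sub {n : ℕ} (A : Submodule (ZMod 2) (Fin n → ZMod 2)) :
    ((univ.filter fun b => b ∈ A).card : ℚ) = 2 ^ (Module.finrank (ZMod 2) A) := by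
  have h := Module.card_eq_pow_finrank (K := ZMod 2) (V := A)
  rw [ZMod.card] at h
  rw [← Fintype.card_subtype]
  exact_mod_cast h

open Classical in
/-- Number of continuations of length `k` from `(V, a)` whose final span has dimension 7. -/
noncomputable def WW (n : ℕ) : ℕ → Submodule (ZMod 2) ((Fin n → ZMod 2) × (Fin n → ZMod 2)) →
    (Fin n → ZMod 2) → ℚ
  | 0, V, _ => if Module.finrank (ZMod 2) V = 7 then 1 else 0
  | k + 1, V, a => ∑ b, WW n k (V ⊔ Submodule.span (ZMod 2) {(a, b)}) b

theorem inv_step {n : ℕ} (V : Submodule (ZMod 2) ((Fin n → ZMod 2) × (Fin n → ZMod 2)))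
    (a b : Fin n → ZMod 2)
    (h : V.map (LinearMap.snd (ZMod 2) _ _)
      ≤ V.map (LinearMap.fst (ZMod 2) _ _) ⊔ Submodule.span (ZMod 2) {a}) :
    (V ⊔ Submodule.span (ZMod 2) {(a, b)}).map (LinearMap.snd (ZMod 2) _ _)
      ≤ (V ⊔ Submodule.span (ZMod 2) {(a, b)}).map (LinearMap.fst (ZMod 2) _ _)
        ⊔ Submodule.span (ZMod 2) {b} := by
  simp only [Submodule.map_sup, Submodule.map_span, Set.image_singleton, LinearMap.snd_apply,
    LinearMap.fst_apply]
  exact sup_le (h.trans le_sup_left) le_sup_right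

open Classical in
theorem WW_eq (n k : ℕ) : ∀ (V : Submodule (ZMod 2) ((Fin n → ZMod 2) × (Fin n → ZMod 2)))
    (a : Fin n → ZMod 2),
    V.map (LinearMap.snd (ZMod 2) _ _)
      ≤ V.map (LinearMap.fst (ZMod 2) _ _) ⊔ Submodule.span (ZMod 2) {a} →
    WW n k V a = cc (2 ^ n) k (Module.finrank (ZMod 2) (V.comap (LinearMap.inr (ZMod 2) _ _)))
      (Module.finrank (ZMod 2) (V.map (LinearMap.fst (ZMod 2) _ _)))
      (decide (a ∈ V.map (LinearMap.fst (ZMod 2) _ _))) := by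
  induction k with
  | zero =>
    intro V a _
    rw [WW, cc, finrank_split V]
  | succ k ih =>
    intro V a hinv
    rw [WW]
    have ih' := fun b => ih _ b (inv_step V a b hinv)
    have hmap : ∀ b, (V ⊔ Submodule.span (ZMod 2) {(a, b)}).map (LinearMap.fst (ZMod 2) _ _)
        = V.map (LinearMap.fst (ZMod 2) _ _) ⊔ Submodule.span (ZMod 2) {a} := by
      intro b
      simp only [Submodule.map_sup, Submodule.map_span, Set.image_singleton, LinearMap.fst_apply]
    have hsp := fun b => finrank_split (V ⊔ Submodule.span (ZMod 2) {(a, b)})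
    have hs0 := finrank_split V
    have hfr : ∀ b, Module.finrank (ZMod 2)
        ((V ⊔ Submodule.span (ZMod 2) {(a, b)}).map (LinearMap.fst (ZMod 2) _ _))
        = Module.finrank (ZMod 2) (V.map (LinearMap.fst (ZMod 2) (Fin n → ZMod 2) (Fin n → ZMod 2))
          ⊔ Submodule.span (ZMod 2) {a} : Submodule (ZMod 2) _) := by
      intro b
      rw [hmap b]
    simp only [hfr] at ih' hsp
    simp only [hmap] at ih'
    clear hfr hmap
    set A := V.map (LinearMap.fst (ZMod 2) (Fin n → ZMod 2) (Fin n → ZMod 2)) with hA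
    set m := Module.finrank (ZMod 2) A with hm
    set d := Module.finrank (ZMod 2) (V.comap (LinearMap.inr (ZMod 2) _ _)) with hd
    have htot : (univ : Finset (Fin n → ZMod 2)).card = 2 ^ n := by
      simp [ZMod.card]
    by_cases haA : a ∈ A
    · have hAa : A ⊔ Submodule.span (ZMod 2) {a} = A := by
        rw [sup_eq_left, Submodule.span_singleton_le_iff_mem]; exact haA
      rw [hAa] at hinv
      have hAf : Module.finrank (ZMod 2) (A ⊔ Submodule.span (ZMod 2) {a} : Submodule (ZMod 2) _)
          = m := by rw [hAa]
      simp only [hAf] at ih' hsp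
      simp only [hAa] at ih'
      have hVA : ∀ b, (a, b) ∈ V → b ∈ A := fun b hb => hinv ⟨(a, b), hb, rfl⟩
      have hval : ∀ b, WW n k (V ⊔ Submodule.span (ZMod 2) {(a, b)}) b
          = if b ∈ A then (if (a, b) ∈ V then cc (2 ^ n) k d m true
              else cc (2 ^ n) k (d + 1) m true) else cc (2 ^ n) k (d + 1) m false := by
        intro b
        rw [ih' b]
        by_cases hb : (a, b) ∈ V
        · have hV : V ⊔ Submodule.span (ZMod 2) {(a, b)} = V := by
            rw [sup_eq_left, Submodule.span_singleton_le_iff_mem]; exact hb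
          rw [hV, if_pos (hVA b hb), if_pos hb, ← hd, decide_eq_true (hVA b hb)]
        · have h1 := finrank_sup_new V (a, b) hb
          have h2 := hsp b
          have h3 : Module.finrank (ZMod 2) ((V ⊔ Submodule.span (ZMod 2) {(a, b)}).comap
              (LinearMap.inr (ZMod 2) _ _)) = d + 1 := by omega
          rw [h3, if_neg hb]
          by_cases hbA : b ∈ A
          · rw [if_pos hbA, decide_eq_true hbA]
          · rw [if_neg hbA, decide_eq_false hbA]
      rw [Finset.sum_congr rfl fun b _ => hval b, Finset.sum_ite, Finset.sum_ite]
      simp only [Finset.sum_const, nsmul_eq_mul, Finset.filter_filter]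
      have c1 : ((univ.filter fun b => b ∈ A ∧ (a, b) ∈ V).card : ℚ) = 2 ^ d := by
        rw [hd, ← card_sub]
        obtain ⟨⟨a', c⟩, hc, hca⟩ := haA
        have hca' : a' = a := hca
        subst hca'
        congr 1
        refine Finset.card_bij (fun b _ => b - c) ?_ ?_ ?_
        · intro b hb
          simp only [Finset.mem_filter, Finset.mem_univ, true_and] at hb ⊢
          have := V.sub_mem hb.2 hc
          simpa using this
        · intro b _ b' _ h
          exact sub_left_injective h
        · intro b hb
          simp only [Finset.mem_filter, Finset.mem_univ, true_and] at hb
          have hb' : ((0 : Fin n → ZMod 2), b) ∈ V := hb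
          have h4 : (a', b + c) ∈ V := by
            have := V.add_mem hb' hc
            simpa using this
          refine ⟨b + c, ?_, by simp⟩
          simp only [Finset.mem_filter, Finset.mem_univ, true_and]
          exact ⟨hVA _ h4, h4⟩
      have c2 : ((univ.filter fun b => b ∈ A ∧ (a, b) ∈ V).card : ℚ)
          + ((univ.filter fun b => b ∈ A ∧ ¬ (a, b) ∈ V).card : ℚ) = 2 ^ m := by
        rw [hm, ← card_sub, ← Nat.cast_add, ← Finset.filter_filter, ← Finset.filter_filter,
          Finset.card_filter_add_card_filter_not]
      have c3 : ((univ.filter fun b => b ∈ A).card : ℚ)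
          + ((univ.filter fun b => ¬ b ∈ A).card : ℚ) = 2 ^ n := by
        rw [← Nat.cast_add, Finset.card_filter_add_card_filter_not, htot]; norm_num
      rw [card_sub, ← hm] at c3
      rw [decide_eq_true haA, cc]
      rw [c1] at c2 ⊢
      rw [← eq_sub_iff_add_eq'] at c2 c3
      rw [c2, c3]
    · have hnV : ∀ b, (a, b) ∉ V := fun b hb => haA ⟨(a, b), hb, rfl⟩
      have hm1 := finrank_sup_new A a haA
      set B := A ⊔ Submodule.span (ZMod 2) {a} with hB
      have hval : ∀ b, WW n k (V ⊔ Submodule.span (ZMod 2) {(a, b)}) b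
          = if b ∈ B then cc (2 ^ n) k d (m + 1) true else cc (2 ^ n) k d (m + 1) false := by
        intro b
        rw [ih' b]
        have h1 := finrank_sup_new V (a, b) (hnV b)
        have h2 := hsp b
        have h3 : Module.finrank (ZMod 2) ((V ⊔ Submodule.span (ZMod 2) {(a, b)}).comap
            (LinearMap.inr (ZMod 2) _ _)) = d := by omega
        rw [h3, hm1]
        by_cases hbA : b ∈ B
        · rw [if_pos hbA, decide_eq_true hbA]
        · rw [if_neg hbA, decide_eq_false hbA]
      rw [Finset.sum_congr rfl fun b _ => hval b, Finset.sum_ite]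
      simp only [Finset.sum_const, nsmul_eq_mul]
      have c3 : ((univ.filter fun b => b ∈ B).card : ℚ)
          + ((univ.filter fun b => ¬ b ∈ B).card : ℚ) = 2 ^ n := by
        rw [← Nat.cast_add, Finset.card_filter_add_card_filter_not, htot]; norm_num
      rw [card_sub, hm1] at c3 ⊢
      rw [← eq_sub_iff_add_eq'] at c3
      rw [decide_eq_false haA, cc, c3]

/-- Span of the pairs of consecutive vectors of a sequence. -/
def pairSpan {n k : ℕ} (s : Fin (k + 1) → Fin n → ZMod 2) :
    Submodule (ZMod 2) ((Fin n → ZMod 2) × (Fin n → ZMod 2)) :=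
  Submodule.span (ZMod 2) (Set.range fun i : Fin k => (s i.castSucc, s i.succ))

theorem pairSpan_cons {n k : ℕ} (a : Fin n → ZMod 2) (s : Fin (k + 1) → Fin n → ZMod 2) :
    pairSpan (Fin.cons a s : Fin (k + 1 + 1) → Fin n → ZMod 2)
      = Submodule.span (ZMod 2) {(a, s 0)} ⊔ pairSpan s := by
  unfold pairSpan
  rw [Fin.range_fin_succ, Submodule.span_insert]
  rfl

open Classical in
theorem WW_sum (n k : ℕ) : ∀ (V : Submodule (ZMod 2) ((Fin n → ZMod 2) × (Fin n → ZMod 2)))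
    (a : Fin n → ZMod 2),
    WW n k V a = ∑ s : Fin k → Fin n → ZMod 2,
      if Module.finrank (ZMod 2)
        (V ⊔ pairSpan (Fin.cons a s : Fin (k + 1) → Fin n → ZMod 2) : Submodule (ZMod 2) _) = 7
      then 1 else 0 := by
  induction k with
  | zero =>
    intro V a
    have : ∀ s : Fin 0 → Fin n → ZMod 2,
        pairSpan (Fin.cons a s : Fin (0 + 1) → Fin n → ZMod 2) = ⊥ := by
      intro s; unfold pairSpan; simp
    rw [WW, Fintype.sum_unique, this, sup_bot_eq]
  | succ k ih =>
    intro V a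
    rw [WW, ← (Fin.consEquiv fun _ : Fin (k + 1) => (Fin n → ZMod 2)).sum_comp,
      Fintype.sum_prod_type]
    refine Finset.sum_congr rfl fun b _ => ?_
    rw [ih]
    refine Finset.sum_congr rfl fun s _ => ?_
    have : (Fin.consEquiv fun _ : Fin (k + 1) => (Fin n → ZMod 2)) (b, s)
      = (Fin.cons b s : Fin (k + 1) → Fin n → ZMod 2) := rfl
    rw [this, pairSpan_cons, Fin.cons_zero, sup_assoc]

/-- Interleaving of two vectors. -/
def interl (n : ℕ) : ((Fin n → ZMod 2) × (Fin n → ZMod 2)) →ₗ[ZMod 2] (Fin (2 * n) → ZMod 2) where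
  toFun p := fun r => if r.val % 2 = 0 then p.1 ⟨r.val / 2, by have := r.isLt; omega⟩
    else p.2 ⟨r.val / 2, by have := r.isLt; omega⟩
  map_add' p q := by
    ext r; dsimp only [Pi.add_apply, Prod.fst_add, Prod.snd_add]; split_ifs <;> rfl
  map_smul' c p := by
    ext r; dsimp only [Pi.smul_apply, Prod.smul_fst, Prod.smul_snd, RingHom.id_apply]
    split_ifs <;> rfl

theorem interl_inj (n : ℕ) : Function.Injective (interl n) := by
  intro p q h
  refine Prod.ext ?_ ?_
  · ext i
    have := congrFun h ⟨2 * i.val, by have := i.isLt; omega⟩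
    simpa [interl] using this
  · ext i
    have := congrFun h ⟨2 * i.val + 1, by have := i.isLt; omega⟩
    have e : (2 * i.val + 1) / 2 = i.val := by omega
    simpa [interl, e] using this

theorem rank_persym (n k : ℕ) (α : Fin n → Fin (k + 1) → ZMod 2) :
    (persymMatrix n k α).rank = Module.finrank (ZMod 2) (pairSpan fun t j => α j t) := by
  rw [Matrix.rank_eq_finrank_span_cols]
  have h : Set.range (persymMatrix n k α).col
      = Set.image (interl n) (Set.range fun i : Fin k =>
        ((fun j => α j i.castSucc), (fun j => α j i.succ))) := by
    rw [← Set.range_comp]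
    congr 1
    ext c r
    simp only [persymMatrix, Matrix.col_apply, Matrix.of_apply, Function.comp, interl,
      LinearMap.coe_mk, AddHom.coe_mk]
    split_ifs with hr
    · congr 1
      apply Fin.ext
      simp [hr]
    · congr 1
      apply Fin.ext
      simp; omega
  rw [h, ← Submodule.map_span]
  exact (Submodule.equivMapOfInjective _ (interl_inj n) _).finrank_eq.symm

theorem Gamma_eq (n k : ℕ) : (Gamma n k 7 : ℚ)
    = cc (2 ^ n) k 0 0 true + (2 ^ n - 1) * cc (2 ^ n) k 0 0 false := by
  classical
  have h1 : (Gamma n k 7 : ℚ) = ∑ s : Fin (k + 1) → Fin n → ZMod 2,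
      if Module.finrank (ZMod 2) (pairSpan s) = 7 then (1 : ℚ) else 0 := by
    unfold Gamma
    rw [Nat.card_eq_fintype_card, Fintype.card_subtype, Finset.card_filter, Nat.cast_sum,
      ← (Equiv.piComm fun (_ : Fin n) (_ : Fin (k + 1)) => ZMod 2).sum_comp]
    refine Finset.sum_congr rfl fun α _ => ?_
    rw [rank_persym]
    push_cast
    rfl
  have h2 : (Gamma n k 7 : ℚ) = ∑ a, WW n k ⊥ a := by
    rw [h1, ← (Fin.consEquiv fun _ : Fin (k + 1) => (Fin n → ZMod 2)).sum_comp,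
      Fintype.sum_prod_type]
    refine Finset.sum_congr rfl fun a _ => ?_
    rw [WW_sum]
    refine Finset.sum_congr rfl fun s _ => ?_
    rw [bot_sup_eq]
    rfl
  rw [h2]
  have h3 : ∀ a : Fin n → ZMod 2, WW n k ⊥ a
      = if a = 0 then cc (2 ^ n) k 0 0 true else cc (2 ^ n) k 0 0 false := by
    intro a
    rw [WW_eq n k ⊥ a (by simp)]
    have e : (⊥ : Submodule (ZMod 2) ((Fin n → ZMod 2) × (Fin n → ZMod 2))).comap
        (LinearMap.inr (ZMod 2) _ _) = ⊥ := by
      rw [Submodule.comap_bot, LinearMap.ker_eq_bot]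
      exact LinearMap.inr_injective
    rw [e, Submodule.map_bot, finrank_bot]
    by_cases ha : a = 0
    · simp [ha]
    · simp [ha]
  rw [Finset.sum_congr rfl fun a _ => h3 a, Finset.sum_ite]
  simp only [Finset.sum_const, nsmul_eq_mul]
  have c1 : ((univ.filter fun a : Fin n → ZMod 2 => a = 0).card : ℚ) = 1 := by
    have h : (univ.filter fun a : Fin n → ZMod 2 => a = 0) = {0} := by
      ext a; simp
    rw [h, Finset.card_singleton, Nat.cast_one]
  have c3 : ((univ.filter fun a : Fin n → ZMod 2 => a = 0).card : ℚ)
      + ((univ.filter fun a : Fin n → ZMod 2 => ¬ a = 0).card : ℚ) = 2 ^ n := by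
    rw [← Nat.cast_add, Finset.card_filter_add_card_filter_not]
    simp [ZMod.card]
  rw [c1] at c3 ⊢
  rw [← eq_sub_iff_add_eq'] at c3
  rw [c3, one_mul]

theorem gamma_seven (n k : ℕ) (hn : 1 ≤ n) (hk : 8 ≤ k) :
    (Gamma n k 7 : ℚ) =
      (31 / 168) * (2 ^ (4 * n) - 15 * 2 ^ (3 * n) + 70 * 2 ^ (2 * n) - 120 * 2 ^ n + 64)
          * 2 ^ (3 * k)
        + (1 / 96) * (1395 * 2 ^ (5 * n) - 45229 * 2 ^ (4 * n) + 462210 * 2 ^ (3 * n)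
            - 1868680 * 2 ^ (2 * n) + 3005760 * 2 ^ n - 1555456) * 2 ^ (2 * k)
        + (1 / 48) * (8001 * 2 ^ (6 * n) - 571023 * 2 ^ (5 * n) + 12524806 * 2 ^ (4 * n)
            - 110524920 * 2 ^ (3 * n) + 418606144 * 2 ^ (2 * n) - 652818432 * 2 ^ n
            + 332775424) * 2 ^ k
        + (1 / 21) * (5355 * 2 ^ (7 * n) - 904113 * 2 ^ (6 * n) + 43302294 * 2 ^ (5 * n)
            - 817168432 * 2 ^ (4 * n) + 6743660640 * 2 ^ (3 * n)
            - 96649567 * 2 ^ 8 * 2 ^ (2 * n) + 4637778 * 2 ^ 13 * 2 ^ n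
            - 293263 * 2 ^ 16) := by
  obtain ⟨j, rfl⟩ : ∃ j, k = j + 1 + 7 := ⟨k - 8, by omega⟩
  have ht := (st_0_0 (2 ^ n)).2 j
  have hf := (sf_0_0 (2 ^ n)).2 j
  rw [Gamma_eq, ht, hf]
  have e : ∀ a b : ℕ, (2 : ℚ) ^ (a * b) = (2 ^ b) ^ a := fun a b => by rw [mul_comm, pow_mul]
  simp only [e, pow_add (2 : ℚ) (j + 1) 7, pow_add (2 : ℚ) j 1]
  generalize (2 : ℚ) ^ n = x
  generalize (2 : ℚ) ^ j = y
  ring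
end

section
/- For n = 4 and every integer k ≥ 8, the number of parameter tuples whose associated 4-times persymmetric 8×k matrix over 𝔽₂ has rank 7 is Γ_7(4,k) = 3720·2^{3k} − 416640·2^{2k} + 13332480·2^k − 121896960. -/
open Finset

namespace PS

set_option linter.unusedSectionVars false

theorem exists_moebius {L : Type*} [PartialOrder L] [Fintype L] [DecidableEq L]
    [DecidableRel ((· ≤ ·) : L → L → Prop)] [DecidableRel ((· < ·) : L → L → Prop)] (h : L → ℤ) :
    ∃ c : L → ℤ, ∀ P, ∑ R ∈ univ.filter (fun R => P ≤ R), c R = h P := by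
  let c : L → ℤ := (wellFounded_gt (α := L)).fix
    (fun P ih => h P - ∑ R ∈ (univ.filter (fun R => P < R)).attach, ih R.1 (by
      exact (Finset.mem_filter.1 R.2).2))
  have hc : ∀ P, c P = h P - ∑ R ∈ univ.filter (fun R => P < R), c R := by
    intro P
    rw [← Finset.sum_attach]
    exact WellFounded.fix_eq _ _ P
  refine ⟨c, fun P => ?_⟩
  have : univ.filter (fun R => P ≤ R) = insert P (univ.filter (fun R => P < R)) := by
    ext R; simp [le_iff_lt_or_eq, or_comm, eq_comm]
  rw [this, Finset.sum_insert (by simp), hc P]; ring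

variable {X : Type} [AddCommGroup X] [Module (ZMod 2) X] [Fintype X]

open Classical in
/-- number of walks ending at a point -/
noncomputable def W (R : Submodule (ZMod 2) (X × X)) : ℕ → X → ℕ
  | 0, _ => 1
  | k + 1, y => ∑ x : X, if (x, y) ∈ R then W R k x else 0

open Classical in
theorem walks_sum (R : Submodule (ZMod 2) (X × X)) (k : ℕ) (g : X → ℕ) :
    ∑ w : Fin (k + 1) → X, (if ∀ c : Fin k, (w c.castSucc, w c.succ) ∈ R then g (w (Fin.last k)) else 0)
      = ∑ y, W R k y * g y := by
  induction k generalizing g with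
  | zero =>
    simp only [W, one_mul]
    rw [← (Equiv.funUnique (Fin 1) X).symm.sum_comp]
    simp
  | succ k ih =>
    rw [← (Fin.snocEquiv (fun _ : Fin (k + 2) => X)).sum_comp, Fintype.sum_prod_type, ]
    simp only [W]
    refine Finset.sum_congr rfl fun y _ => ?_
    have := ih (fun x => if (x, y) ∈ R then g y else 0)
    rw [Finset.sum_mul]
    trans (∑ x, W R k x * (if (x, y) ∈ R then g y else 0))
    · rw [← this]
      refine Finset.sum_congr rfl fun w _ => ?_
      simp only [Fin.snocEquiv, Equiv.coe_fn_mk, Fin.forall_fin_succ', Fin.succ_last, Fin.snoc_last,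
        Fin.snoc_castSucc, Fin.succ_castSucc, ite_and]
    · refine Finset.sum_congr rfl fun x _ => ?_
      split_ifs <;> simp

/-- image of a subspace under the relation -/
def im (R : Submodule (ZMod 2) (X × X)) (E : Submodule (ZMod 2) X) : Submodule (ZMod 2) X :=
  (R ⊓ E.comap (LinearMap.fst (ZMod 2) X X)).map (LinearMap.snd (ZMod 2) X X)

theorem mem_im (R : Submodule (ZMod 2) (X × X)) (E : Submodule (ZMod 2) X) (y : X) :
    y ∈ im R E ↔ ∃ x ∈ E, (x, y) ∈ R := by
  simp only [im, Submodule.mem_map, Submodule.mem_inf, Submodule.mem_comap, LinearMap.fst_apply,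
    LinearMap.snd_apply, Prod.exists]
  constructor
  · rintro ⟨a, b, ⟨h1, h2⟩, rfl⟩; exact ⟨a, h2, h1⟩
  · rintro ⟨a, h1, h2⟩; exact ⟨a, y, ⟨h2, h1⟩, rfl⟩

/-- the points related to zero -/
def ker (R : Submodule (ZMod 2) (X × X)) : Submodule (ZMod 2) X :=
  R.comap (LinearMap.inl (ZMod 2) X X)

theorem mem_ker (R : Submodule (ZMod 2) (X × X)) (x : X) : x ∈ ker R ↔ (x, 0) ∈ R := Iff.rfl

def E (R : Submodule (ZMod 2) (X × X)) : ℕ → Submodule (ZMod 2) X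
  | 0 => ⊤
  | k + 1 => im R (E R k)

noncomputable def M (R : Submodule (ZMod 2) (X × X)) : ℕ → ℕ
  | 0 => 1
  | k + 1 => M R k * Nat.card ↥(E R k ⊓ ker R)

open Classical in
theorem W_eq (R : Submodule (ZMod 2) (X × X)) (k : ℕ) (y : X) :
    W R k y = if y ∈ E R k then M R k else 0 := by
  induction k generalizing y with
  | zero => simp [W, E, M]
  | succ k ih =>
    have hE : E R (k + 1) = im R (E R k) := rfl
    rw [hE]
    simp only [W, ih, M]
    by_cases hy : y ∈ im R (E R k)
    · rw [if_pos hy]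
      obtain ⟨x0, h0, h1⟩ := (mem_im _ _ _).1 hy
      rw [← Equiv.sum_comp (Equiv.addRight x0)]
      have : ∀ x, (if ((Equiv.addRight x0) x, y) ∈ R then
          if (Equiv.addRight x0) x ∈ E R k then M R k else 0 else 0) =
          if x ∈ E R k ⊓ ker R then M R k else 0 := by
        intro x
        have e1 : x + x0 ∈ E R k ↔ x ∈ E R k := Submodule.add_mem_iff_left _ h0
        have e2 : (x + x0, y) ∈ R ↔ (x, 0) ∈ R := by
          have : (x + x0, y) = (x, 0) + (x0, y) := by simp
          rw [this]; exact Submodule.add_mem_iff_left _ h1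
        simp only [Equiv.coe_addRight, e1, e2, Submodule.mem_inf, mem_ker]
        by_cases h : x ∈ E R k <;> by_cases h' : (x, (0 : X)) ∈ R <;> simp [h, h']
      simp only [this]
      rw [← Finset.sum_filter, Finset.sum_const, smul_eq_mul, mul_comm, Nat.card_eq_fintype_card,
        Fintype.card_subtype]
    · rw [if_neg hy]
      refine Finset.sum_eq_zero fun x _ => ?_
      split_ifs with h1 h2
      · exact absurd ((mem_im _ _ _).2 ⟨x, h2, h1⟩) hy
      · rfl
      · rfl

/-- number of walks -/
noncomputable def N (R : Submodule (ZMod 2) (X × X)) (k : ℕ) : ℕ :=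
  Nat.card {w : Fin (k + 1) → X // ∀ c : Fin k, (w c.castSucc, w c.succ) ∈ R}

theorem N_eq (R : Submodule (ZMod 2) (X × X)) (k : ℕ) :
    N R k = M R k * Nat.card ↥(E R k) := by
  classical
  have := walks_sum R k (fun _ => 1)
  rw [N, Nat.card_eq_fintype_card, Fintype.card_subtype, Finset.card_filter, this]
  simp only [W_eq, mul_one]
  rw [← Finset.sum_filter, Finset.sum_const, smul_eq_mul, mul_comm, Nat.card_eq_fintype_card,
        Fintype.card_subtype]

theorem im_mono (R : Submodule (ZMod 2) (X × X)) {A B : Submodule (ZMod 2) X} (h : A ≤ B) :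
    im R A ≤ im R B := by
  intro y hy
  rw [mem_im] at *
  obtain ⟨x, h1, h2⟩ := hy
  exact ⟨x, h h1, h2⟩

theorem E_succ_le (R : Submodule (ZMod 2) (X × X)) (k : ℕ) : E R (k + 1) ≤ E R k := by
  induction k with
  | zero => simp [E]
  | succ k ih => exact im_mono R ih

theorem E_stab (R : Submodule (ZMod 2) (X × X)) (j : ℕ) (h : E R (j + 1) = E R j) (i : ℕ) :
    E R (j + i) = E R j := by
  induction i with
  | zero => rfl
  | succ i ih => 
    have : E R (j + (i + 1)) = im R (E R (j + i)) := rfl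
    rw [this, ih]; exact h

theorem E_four (R : Submodule (ZMod 2) (X × X)) (hX : Module.finrank (ZMod 2) X = 4) :
    E R 5 = E R 4 := by
  have key : ∀ j ≤ 4, E R (j + 1) = E R j ∨ Module.finrank (ZMod 2) (E R (j+1)) < Module.finrank (ZMod 2) (E R j) := by
    intro j _
    rcases (E_succ_le R j).eq_or_lt with h | h
    · exact Or.inl h
    · exact Or.inr (Submodule.finrank_lt_finrank_of_lt h)
  have h0 : Module.finrank (ZMod 2) (E R 0) ≤ 4 := by rw [← hX]; exact Submodule.finrank_le _
  have st : ∀ j ≤ 4, E R (j + 1) = E R j → E R 5 = E R 4 := by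
    intro j hj h
    have a := E_stab R j h (5 - j)
    have b := E_stab R j h (4 - j)
    rw [show j + (5 - j) = 5 by omega] at a
    rw [show j + (4 - j) = 4 by omega] at b
    rw [a, b]
  rcases key 0 (by omega) with h | h
  · exact st 0 (by omega) h
  rcases key 1 (by omega) with h1 | h1
  · exact st 1 (by omega) h1
  rcases key 2 (by omega) with h2 | h2
  · exact st 2 (by omega) h2
  rcases key 3 (by omega) with h3 | h3
  · exact st 3 (by omega) h3
  rcases key 4 (by omega) with h4 | h4
  · exact st 4 (by omega) h4
  simp only [Nat.reduceAdd] at *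
  omega

/-- growth exponent -/
noncomputable def r (R : Submodule (ZMod 2) (X × X)) : ℕ :=
  Module.finrank (ZMod 2) ↥(E R 4 ⊓ ker R)

theorem card_sub (A : Submodule (ZMod 2) X) : Nat.card A = 2 ^ Module.finrank (ZMod 2) A := by
  rw [Module.natCard_eq_pow_finrank (K := ZMod 2)]; simp

theorem N_growth (R : Submodule (ZMod 2) (X × X)) (hX : Module.finrank (ZMod 2) X = 4) (j : ℕ) :
    N R (4 + j) = N R 4 * (2 ^ r R) ^ j := by
  induction j with
  | zero => simp
  | succ j ih =>
    rw [pow_succ, ← mul_assoc, ← ih, N_eq, N_eq]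
    have e1 := E_stab R 4 (E_four R hX) j
    have e2 := E_stab R 4 (E_four R hX) (j + 1)
    rw [e1, e2, ← add_assoc, M, e1, card_sub (E R 4 ⊓ ker R), r]; ring

theorem finrank_R (R : Submodule (ZMod 2) (X × X)) :
    Module.finrank (ZMod 2) R =
      Module.finrank (ZMod 2) (ker R) + Module.finrank (ZMod 2) (im R ⊤) := by
  let φ : R →ₗ[ZMod 2] X := (LinearMap.snd (ZMod 2) X X).comp R.subtype
  have h := LinearMap.finrank_range_add_finrank_ker φ
  have h1 : LinearMap.range φ = im R ⊤ := by
    ext y; simp [mem_im, φ]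
  have h2 : Module.finrank (ZMod 2) (LinearMap.ker φ) = Module.finrank (ZMod 2) (ker R) := by
    symm
    refine LinearEquiv.finrank_eq (LinearEquiv.ofBijective
      (LinearMap.codRestrict (LinearMap.ker φ)
        (LinearMap.codRestrict R ((LinearMap.inl (ZMod 2) X X).comp (ker R).subtype)
          (fun x => x.2)) (fun x => by rw [LinearMap.mem_ker]; rfl)) ⟨?_, ?_⟩)
    · intro a b hab
      have := congrArg (fun z => (z.1.1 : X × X).1) hab
      exact Subtype.ext this
    · rintro ⟨⟨⟨a, b⟩, hab⟩, h⟩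
      have hb : b = 0 := h
      subst hb
      exact ⟨⟨a, hab⟩, rfl⟩
  rw [h1, h2] at h
  omega

theorem ker_prod (H : Submodule (ZMod 2) X) : ker (H.prod H) = H := by
  ext x; simp [mem_ker]

theorem im_prod (H A : Submodule (ZMod 2) X) (h : H ≤ A) : im (H.prod H) A = H := by
  ext y
  rw [mem_im]
  constructor
  · rintro ⟨x, _, h2⟩; exact h2.2
  · intro hy; exact ⟨y, h hy, hy, hy⟩

theorem finrank_prod_self (H : Submodule (ZMod 2) X) :
    Module.finrank (ZMod 2) (H.prod H) = 2 * Module.finrank (ZMod 2) H := by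
  rw [finrank_R, ker_prod, im_prod _ _ le_top]; ring

theorem E_le_range (R : Submodule (ZMod 2) (X × X)) : E R 4 ≤ im R ⊤ := im_mono R le_top

theorem r_le_three (R : Submodule (ZMod 2) (X × X)) (hX : Module.finrank (ZMod 2) X = 4)
    (hR : R ≠ ⊤) : r R ≤ 3 := by
  by_contra h
  push Not at h
  have h1 := Submodule.finrank_mono (R := ZMod 2) (inf_le_left : E R 4 ⊓ ker R ≤ E R 4)
  have h2 := Submodule.finrank_mono (R := ZMod 2) (inf_le_right : E R 4 ⊓ ker R ≤ ker R)
  have h3 := Submodule.finrank_mono (R := ZMod 2) (E_le_range R)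
  have h4 := finrank_R R
  have h5 : Module.finrank (ZMod 2) (X × X) = 8 := by simp [hX]
  have h6 := Submodule.finrank_lt hR
  unfold r at h
  omega

theorem r_three (R : Submodule (ZMod 2) (X × X)) (hX : Module.finrank (ZMod 2) X = 4)
    (hd : Module.finrank (ZMod 2) R ≤ 6) (hr : r R = 3) :
    ∃ H : Submodule (ZMod 2) X, Module.finrank (ZMod 2) H = 3 ∧ R = H.prod H := by
  have h1 := Submodule.finrank_mono (R := ZMod 2) (inf_le_left : E R 4 ⊓ ker R ≤ E R 4)
  have h2 := Submodule.finrank_mono (R := ZMod 2) (inf_le_right : E R 4 ⊓ ker R ≤ ker R)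
  have h3 := Submodule.finrank_mono (R := ZMod 2) (E_le_range R)
  have h4 := finrank_R R
  unfold r at hr
  have e1 : E R 4 ⊓ ker R = E R 4 := Submodule.eq_of_le_of_finrank_eq inf_le_left (by omega)
  have e2 : E R 4 ⊓ ker R = ker R := Submodule.eq_of_le_of_finrank_eq inf_le_right (by omega)
  have e3 : E R 4 = ker R := by rw [← e1, e2]
  refine ⟨E R 4, by omega, ?_⟩
  symm
  have hp : Module.finrank (ZMod 2) ((E R 4).prod (E R 4)) = 6 := by
    rw [finrank_prod_self]; omega
  refine Submodule.eq_of_le_of_finrank_eq ?_ (by omega)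
  rintro ⟨x, y⟩ ⟨hx, hy⟩
  replace hx : x ∈ E R 4 := hx
  replace hy : y ∈ E R 4 := hy
  have hy' := hy
  rw [← E_four R hX] at hy'
  obtain ⟨z, hz, hzy⟩ := (mem_im R (E R 4) y).1 hy'
  rw [e3, mem_ker] at hz hx
  have := R.add_mem hx (R.sub_mem hzy hz)
  simpa using this

theorem prod_vals (H : Submodule (ZMod 2) X) (hH : Module.finrank (ZMod 2) H = 3) :
    r (H.prod H) = 3 ∧ N (H.prod H) 4 = 2 ^ 15 := by
  have e1 : E (H.prod H) 1 = H := im_prod _ _ le_top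
  have e2 : E (H.prod H) 2 = H := by
    change im _ (E _ 1) = H; rw [e1]; exact im_prod _ _ le_rfl
  have e3 : E (H.prod H) 3 = H := by
    change im _ (E _ 2) = H; rw [e2]; exact im_prod _ _ le_rfl
  have e4 : E (H.prod H) 4 = H := by
    change im _ (E _ 3) = H; rw [e3]; exact im_prod _ _ le_rfl
  have e0 : E (H.prod H) 0 = ⊤ := rfl
  constructor
  · rw [r, e4, ker_prod, inf_idem, hH]
  · rw [N_eq, M, M, M, M, M, e4, e3, e2, e1, e0, ker_prod, top_inf_eq, inf_idem, card_sub, hH]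
    norm_num

theorem seven_vals (R : Submodule (ZMod 2) (X × X)) (hX : Module.finrank (ZMod 2) X = 4)
    (hR : Module.finrank (ZMod 2) R = 7) : r R = 3 ∧ N R 4 = 2 ^ 16 := by
  have h4 := finrank_R R
  have h1 := Submodule.finrank_le (ker R)
  have h2 := Submodule.finrank_le (im R ⊤)
  have e0 : E R 0 = ⊤ := rfl
  by_cases hk : Module.finrank (ZMod 2) (ker R) = 3
  · have hi : im R ⊤ = ⊤ := Submodule.eq_top_of_finrank_eq (by omega)
    have e1 : E R 1 = ⊤ := hi
    have e4 : ∀ j, E R j = ⊤ := fun j => by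
      have := E_stab R 0 (e1.trans e0.symm) j
      rwa [zero_add] at this
    constructor
    · rw [r, e4, top_inf_eq, hk]
    · rw [N_eq, M, M, M, M, M, e4, e4, e4, e4, e4, top_inf_eq, card_sub, card_sub, hk, finrank_top, hX]
      norm_num
  · have hkt : ker R = ⊤ := Submodule.eq_top_of_finrank_eq (by omega)
    have hi : ∀ A, im R A = im R ⊤ := by
      intro A
      refine le_antisymm (im_mono R le_top) ?_
      intro y hy
      rw [mem_im] at *
      obtain ⟨x, _, hx⟩ := hy
      refine ⟨0, A.zero_mem, ?_⟩
      have hx0 : x ∈ ker R := by rw [hkt]; trivial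
      have := R.sub_mem hx hx0
      simpa using this
    have e : ∀ j, E R (j + 1) = im R ⊤ := fun j => hi _
    have h3 : Module.finrank (ZMod 2) (im R ⊤) = 3 := by
      rw [hkt, finrank_top] at h4; omega
    constructor
    · rw [r, e, hkt, inf_top_eq, h3]
    · have eAll : E R 1 = im R ⊤ ∧ E R 2 = im R ⊤ ∧ E R 3 = im R ⊤ ∧ E R 4 = im R ⊤ :=
        ⟨e 0, e 1, e 2, e 3⟩
      rw [N_eq, M, M, M, M, M, eAll.1, eAll.2.1, eAll.2.2.1, eAll.2.2.2, e0, hkt, inf_top_eq, inf_top_eq, card_sub,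
        card_sub, h3, finrank_top, hX]
      norm_num

theorem zmod_two_eq {a b : ZMod 2} (h : a = 0 ↔ b = 0) : a = b := by
  revert a b; decide

theorem card_hyper {V : Type} [AddCommGroup V] [Module (ZMod 2) V] [Finite V]
    (P : Submodule (ZMod 2) V) (d : ℕ)
    (hd : Module.finrank (ZMod 2) V = Module.finrank (ZMod 2) P + d) :
    Nat.card {R : Submodule (ZMod 2) V // P ≤ R ∧
      Module.finrank (ZMod 2) R + 1 = Module.finrank (ZMod 2) V} = 2 ^ d - 1 := by
  classical
  have hA : Module.finrank (ZMod 2) P.dualAnnihilator = d := by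
    have := Subspace.finrank_add_finrank_dualAnnihilator_eq P
    omega
  have hfin : Finite (Module.Dual (ZMod 2) V) := Module.finite_of_finite (ZMod 2)
  have : Fintype P.dualAnnihilator := Fintype.ofFinite _
  have hc : Nat.card {f : P.dualAnnihilator // f ≠ 0} = 2 ^ d - 1 := by
    rw [Nat.card_eq_fintype_card, Fintype.card_subtype_compl, Fintype.card_subtype_eq,
      ← Nat.card_eq_fintype_card, Module.natCard_eq_pow_finrank (K := ZMod 2), hA]
    simp
  rw [← hc]
  symm
  refine Nat.card_congr (Equiv.ofBijective (fun f => ⟨LinearMap.ker f.1.1, ?_, ?_⟩) ⟨?_, ?_⟩)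
  · intro x hx
    exact (Submodule.mem_dualAnnihilator _).1 f.1.2 x hx
  · refine Module.Dual.finrank_ker_add_one_of_ne_zero ?_
    intro h; exact f.2 (Subtype.ext h)
  · intro f g hfg
    have h : LinearMap.ker f.1.1 = LinearMap.ker g.1.1 := congrArg Subtype.val hfg
    refine Subtype.ext (Subtype.ext (LinearMap.ext fun x => zmod_two_eq ?_))
    rw [← LinearMap.mem_ker, h, LinearMap.mem_ker]
  · rintro ⟨R, hPR, hR⟩
    have h1 := Subspace.finrank_add_finrank_dualAnnihilator_eq R
    have h2 : R.dualAnnihilator ≠ ⊥ := by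
      intro h; rw [h, finrank_bot] at h1; omega
    obtain ⟨f, hf, hf0⟩ := Submodule.exists_mem_ne_zero_of_ne_bot h2
    refine ⟨⟨⟨f, Submodule.dualAnnihilator_anti hPR hf⟩, fun h => hf0 (congrArg Subtype.val h)⟩, ?_⟩
    refine Subtype.ext ?_
    symm
    refine Submodule.eq_of_le_of_finrank_eq
      (fun x hx => (Submodule.mem_dualAnnihilator _).1 hf x hx) ?_
    have := Module.Dual.finrank_ker_add_one_of_ne_zero hf0
    simp only
    omega

/-- span of the columns -/
def colSpan {k : ℕ} (w : Fin (k + 1) → X) : Submodule (ZMod 2) (X × X) :=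
  Submodule.span (ZMod 2) (Set.range fun c : Fin k => (w c.castSucc, w c.succ))

theorem colSpan_le {k : ℕ} (w : Fin (k + 1) → X) (R : Submodule (ZMod 2) (X × X)) :
    colSpan w ≤ R ↔ ∀ c : Fin k, (w c.castSucc, w c.succ) ∈ R := by
  rw [colSpan, Submodule.span_le, Set.range_subset_iff]; rfl

/-- interleaving -/
def inter : ((Fin 4 → ZMod 2) × (Fin 4 → ZMod 2)) →ₗ[ZMod 2] (Fin (2 * 4) → ZMod 2) where
  toFun p r := if r.val % 2 = 0 then p.1 ⟨r.val / 2, by have := r.isLt; omega⟩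
    else p.2 ⟨r.val / 2, by have := r.isLt; omega⟩
  map_add' p q := by ext r; simp only [Prod.fst_add, Prod.snd_add, Pi.add_apply]; split_ifs <;> rfl
  map_smul' a p := by
    ext r; simp only [Prod.smul_fst, Prod.smul_snd, Pi.smul_apply, RingHom.id_apply]
    split_ifs <;> rfl

theorem inter_inj : Function.Injective inter := by
  intro p q h
  have h' : ∀ r, inter p r = inter q r := fun r => by rw [h]
  refine Prod.ext (funext fun i => ?_) (funext fun i => ?_)
  · have := h' ⟨2 * i.val, by omega⟩
    simpa [inter] using this
  · have := h' ⟨2 * i.val + 1, by omega⟩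
    simpa [inter, Nat.mul_add_div] using this

theorem rank_eq (k : ℕ) (α : Fin 4 → Fin (k + 1) → ZMod 2) :
    (persymMatrix 4 k α).rank = Module.finrank (ZMod 2) (colSpan (fun i j => α j i)) := by
  have h : Submodule.span (ZMod 2) (Set.range (persymMatrix 4 k α).col) =
      (colSpan (fun i j => α j i)).map inter := by
    rw [colSpan, Submodule.map_span, ← Set.range_comp]
    congr 2
    funext c r
    simp only [Matrix.col, Matrix.transpose_apply, persymMatrix, Matrix.of_apply, inter,
      Function.comp, LinearMap.coe_mk, AddHom.coe_mk]
    split_ifs with h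
    · congr 1; ext; simp [h]
    · congr 1; ext; simp; omega
  rw [Matrix.rank_eq_finrank_span_cols, h]
  exact (LinearEquiv.finrank_eq (Submodule.equivMapOfInjective inter inter_inj _)).symm

theorem Gamma_eq (k : ℕ) : Gamma 4 k 7 =
    Nat.card {w : Fin (k + 1) → (Fin 4 → ZMod 2) // Module.finrank (ZMod 2) (colSpan w) = 7} := by
  rw [Gamma]
  let e : (Fin 4 → Fin (k + 1) → ZMod 2) ≃ (Fin (k + 1) → Fin 4 → ZMod 2) :=
    Equiv.piComm (fun _ _ => ZMod 2)
  refine Nat.card_congr (e.subtypeEquiv fun α => ?_)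
  rw [rank_eq]; rfl

theorem Gamma_zero (k : ℕ) (hk : k < 7) : Gamma 4 k 7 = 0 := by
  rw [Gamma]
  have : IsEmpty {α : Fin 4 → Fin (k + 1) → ZMod 2 // (persymMatrix 4 k α).rank = 7} := by
    refine ⟨fun α => ?_⟩
    have := Matrix.rank_le_width (persymMatrix 4 k α.1)
    have := α.2
    omega
  simp only [Nat.card_of_isEmpty]

theorem coeffs (hX : Module.finrank (ZMod 2) X = 4) :
    ∃ C0 C1 C2 : ℤ, ∀ j : ℕ,
      (Nat.card {w : Fin (4 + j + 1) → X // Module.finrank (ZMod 2) (colSpan w) = 7} : ℤ) =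
        C0 + C1 * 2 ^ j + C2 * 4 ^ j + 465 * 2 ^ 15 * 8 ^ j := by
  classical
  have : Fintype (Submodule (ZMod 2) (X × X)) := Fintype.ofFinite _
  have : Fintype (Submodule (ZMod 2) X) := Fintype.ofFinite _
  have hXX : Module.finrank (ZMod 2) (X × X) = 8 := by simp [hX]
  obtain ⟨c, hc⟩ := exists_moebius
    (fun P : Submodule (ZMod 2) (X × X) => if Module.finrank (ZMod 2) P = 7 then (1 : ℤ) else 0)
  -- the counting function as a combination of walk counts
  have hsum : ∀ k, (Nat.card {w : Fin (k + 1) → X // Module.finrank (ZMod 2) (colSpan w) = 7} : ℤ) =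
      ∑ R, c R * N R k := by
    intro k
    rw [Nat.card_eq_fintype_card, Fintype.card_subtype, Finset.card_filter]
    push_cast
    calc _ = ∑ w : Fin (k + 1) → X, ∑ R, if colSpan w ≤ R then c R else 0 := by
          refine Finset.sum_congr rfl fun w _ => ?_
          rw [← hc (colSpan w), Finset.sum_filter]
      _ = ∑ R, ∑ w : Fin (k + 1) → X, if colSpan w ≤ R then c R else 0 := Finset.sum_comm
      _ = _ := by
          refine Finset.sum_congr rfl fun R _ => ?_
          rw [N, Nat.card_eq_fintype_card, Fintype.card_subtype, ← Finset.sum_filter,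
            Finset.sum_const, nsmul_eq_mul, mul_comm]
          simp only [colSpan_le]
  -- dimension facts
  have htop : c ⊤ = 0 := by
    have h := hc ⊤
    have e : univ.filter (fun R : Submodule (ZMod 2) (X × X) => ⊤ ≤ R) = {⊤} := by
      ext R; simp
    rw [e, Finset.sum_singleton, finrank_top, hXX] at h
    simpa using h
  have hfull : ∀ R : Submodule (ZMod 2) (X × X), Module.finrank (ZMod 2) R = 8 → R = ⊤ :=
    fun R h => Submodule.eq_top_of_finrank_eq (by omega)
  have hle : ∀ R : Submodule (ZMod 2) (X × X), Module.finrank (ZMod 2) R ≤ 8 :=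
    fun R => hXX ▸ Submodule.finrank_le R
  have hseven : ∀ R : Submodule (ZMod 2) (X × X), Module.finrank (ZMod 2) R = 7 → c R = 1 := by
    intro P hP
    have h := hc P
    rw [if_pos hP, Finset.sum_eq_single P] at h
    · exact h
    · intro R hR hne
      have hPR : P < R := lt_of_le_of_ne (Finset.mem_filter.1 hR).2 (Ne.symm hne)
      have h1 := Submodule.finrank_lt_finrank_of_lt hPR
      have h2 := hle R
      rw [hfull R (by omega), htop]
    · intro h; simp at h
  have hcard : ∀ P : Submodule (ZMod 2) (X × X), ∀ d, 8 = Module.finrank (ZMod 2) P + d →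
      (univ.filter (fun R : Submodule (ZMod 2) (X × X) =>
        P ≤ R ∧ Module.finrank (ZMod 2) R = 7)).card = 2 ^ d - 1 := by
    intro P d h
    have := card_hyper P d (by omega)
    rw [Nat.card_eq_fintype_card, Fintype.card_subtype] at this
    rw [← this, hXX]
    congr 1
    ext R; simp
  have hsix : ∀ R : Submodule (ZMod 2) (X × X), Module.finrank (ZMod 2) R = 6 → c R = -3 := by
    intro P hP
    have h := hc P
    have e : ∑ R ∈ univ.filter (fun R => P ≤ R), c R =
        ∑ R ∈ univ.filter (fun R => P ≤ R), ((if R = P then c P else 0) +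
          (if Module.finrank (ZMod 2) R = 7 then 1 else 0)) := by
      refine Finset.sum_congr rfl fun R hR => ?_
      have hPR := (Finset.mem_filter.1 hR).2
      by_cases hRP : R = P
      · subst hRP; simp [hP]
      · have h1 := Submodule.finrank_lt_finrank_of_lt (lt_of_le_of_ne hPR (Ne.symm hRP))
        have h2 := hle R
        by_cases h7 : Module.finrank (ZMod 2) R = 7
        · simp [hRP, h7, hseven R h7]
        · rw [hfull R (by omega), htop, if_neg, if_neg]
          · simp
          · rw [finrank_top, hXX]; norm_num
          · rintro rfl; rw [finrank_top] at hP; omega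
    have hc7 := hcard P 2 (by omega)
    rw [e, Finset.sum_add_distrib, ← Finset.sum_filter (p := fun R => R = P),
      ← Finset.sum_filter, Finset.filter_filter, Finset.filter_filter, Finset.sum_const, Finset.sum_const, hc7,
      if_neg (by omega)] at h
    have e2 : univ.filter (fun R : Submodule (ZMod 2) (X × X) => P ≤ R ∧ R = P) = {P} := by
      ext R; simp; rintro rfl; exact le_rfl
    rw [e2, Finset.card_singleton] at h
    norm_num at h
    linarith
  -- the coefficients
  let C : ℕ → ℤ := fun i => ∑ R, if r R = i then c R * N R 4 else 0
  have hC : ∀ j, ∑ R, c R * N R (4 + j) = ∑ i ∈ range 4, C i * (2 ^ i) ^ j := by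
    intro j
    simp only [C, Finset.sum_mul]
    rw [Finset.sum_comm]
    refine Finset.sum_congr rfl fun R _ => ?_
    by_cases hR : R = ⊤
    · subst hR; simp [htop]
    · have hr := r_le_three R hX hR
      rw [Finset.sum_eq_single (r R)]
      · rw [if_pos rfl, N_growth R hX]; push_cast; ring
      · intro b _ hb; rw [if_neg (Ne.symm hb), zero_mul]
      · intro h; simp at h; omega
  have hS : ((univ.filter (fun H : Submodule (ZMod 2) X => Module.finrank (ZMod 2) H = 3)).image
      (fun H => H.prod H)).card = 15 := by
    rw [Finset.card_image_of_injective]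
    · have := card_hyper (⊥ : Submodule (ZMod 2) X) 4 (by simp [hX])
      rw [Nat.card_eq_fintype_card, Fintype.card_subtype] at this
      rw [show 15 = 2 ^ 4 - 1 by norm_num, ← this, hX]
      congr 1
      ext R; simp
    · intro A B h
      have := congrArg ker h
      simpa only [ker_prod] using this
  have hC3 : C 3 = 465 * 2 ^ 15 := by
    have e : C 3 = ∑ R : Submodule (ZMod 2) (X × X), ((if Module.finrank (ZMod 2) R = 7 then (2 ^ 16 : ℤ) else 0) +
        if R ∈ ((univ.filter (fun H : Submodule (ZMod 2) X => Module.finrank (ZMod 2) H = 3)).image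
      (fun H => H.prod H)) then (-3 * 2 ^ 15 : ℤ) else 0) := by
      refine Finset.sum_congr rfl fun R _ => ?_
      by_cases hm : R ∈ ((univ.filter
        (fun H : Submodule (ZMod 2) X => Module.finrank (ZMod 2) H = 3)).image (fun H => H.prod H))
      · rw [if_pos hm]
        obtain ⟨H, hH, rfl⟩ := Finset.mem_image.1 hm
        have hH3 := (Finset.mem_filter.1 hH).2
        have h6 := finrank_prod_self H
        rw [hH3] at h6
        obtain ⟨h1, h2⟩ := prod_vals H hH3
        rw [if_pos h1, h2, hsix _ h6, if_neg (by omega)]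
        norm_num
      · rw [if_neg hm]
        by_cases h7 : Module.finrank (ZMod 2) R = 7
        · obtain ⟨h1, h2⟩ := seven_vals R hX h7
          rw [if_pos h1, h2, hseven R h7, if_pos h7]; norm_num
        · rw [if_neg h7]
          split_ifs with h3
          · by_cases hR : R = ⊤
            · rw [hR, htop]; simp
            · exfalso
              have h8 := Submodule.finrank_lt hR
              obtain ⟨H, hH, hHR⟩ := r_three R hX (by omega) h3
              exact hm (Finset.mem_image.2 ⟨H, by simpa using hH, hHR.symm⟩)
          · rfl
    have h255 := hcard ⊥ 8 (by simp)
    simp only [bot_le, true_and] at h255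
    rw [e, Finset.sum_add_distrib, ← Finset.sum_filter, ← Finset.sum_filter, Finset.sum_const,
      Finset.sum_const, h255, Finset.filter_mem_eq_inter, Finset.univ_inter, hS]
    norm_num
  refine ⟨C 0, C 1, C 2, fun j => ?_⟩
  rw [hsum, hC, ← hC3]
  simp only [Finset.sum_range_succ, Finset.sum_range_zero]
  norm_num

end PS

theorem gamma_seven_n_four (k : ℕ) (hk : 8 ≤ k) :
    (Gamma 4 k 7 : ℤ) =
      3720 * 2 ^ (3 * k) - 416640 * 2 ^ (2 * k) + 13332480 * 2 ^ k - 121896960 := by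
  obtain ⟨C0, C1, C2, h⟩ := PS.coeffs (X := Fin 4 → ZMod 2) (by simp)
  simp only [← PS.Gamma_eq] at h
  have h0 := h 0
  have h1 := h 1
  have h2 := h 2
  rw [PS.Gamma_zero _ (by norm_num)] at h0 h1 h2
  norm_num at h0 h1 h2
  obtain ⟨j, rfl⟩ : ∃ j, k = 4 + j := ⟨k - 4, by omega⟩
  rw [h j]
  have e3 : (2 : ℤ) ^ (3 * (4 + j)) = 4096 * 8 ^ j := by
    rw [pow_mul, pow_add]; norm_num
  have e2 : (2 : ℤ) ^ (2 * (4 + j)) = 256 * 4 ^ j := by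
    rw [pow_mul, pow_add]; norm_num
  have e1 : (2 : ℤ) ^ (4 + j) = 16 * 2 ^ j := by
    rw [pow_add]; norm_num
  rw [e1, e2, e3]
  have a2 : C2 = -106659840 := by linarith
  have a1 : C1 = 213319680 := by linarith
  have a0 : C0 = -121896960 := by linarith
  rw [a0, a1, a2]
  ring
end

section
/- For n = 5 and every integer k ≥ 8, the number of parameter tuples whose associated 5-times persymmetric 10×k matrix over 𝔽₂ has rank 7 is Γ_7(5,k) = 115320·[2^{3k} + 1148·2^{2k} − 2^7·917·2^k + 311·2^{13}]. -/
open Finset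

/-- Number of ways to reach rank `7` in exactly `m` more steps, from a state `(d, e, flag)`. -/
def G : ℕ → ℕ → ℕ → Bool → ℚ
  | 0, d, e, true => if d + e = 7 then 1 else 0
  | 0, d, e, false => if d + e = 8 then 1 else 0
  | m + 1, d, e, true => 2 ^ e * G m d e true + (2 ^ d - 2 ^ e) * G m d (e + 1) true
      + (2 ^ 5 - 2 ^ d) * G m (d + 1) (e + 1) false
  | m + 1, d, e, false => 2 ^ d * G m d e true + (2 ^ 5 - 2 ^ d) * G m (d + 1) e false

lemma G_t (m d e : ℕ) : G (m + 1) d e true =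
    2 ^ e * G m d e true + (2 ^ d - 2 ^ e) * G m d (e + 1) true
      + (2 ^ 5 - 2 ^ d) * G m (d + 1) (e + 1) false := by rw [G]

lemma G_f (m d e : ℕ) : G (m + 1) d e false =
    2 ^ d * G m d e true + (2 ^ 5 - 2 ^ d) * G m (d + 1) e false := by rw [G]

/-- Rank lower bound attached to a state: the rank exceeds `7`. -/
def rkS (d e : ℕ) (b : Bool) : Prop := if b = true then 8 ≤ d + e else 9 ≤ d + e

lemma G_zero (m d e : ℕ) (b : Bool) (h : rkS d e b) : G m d e b = 0 := by
  induction m generalizing d e b with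
  | zero =>
    cases b <;> simp [rkS] at h <;> simp [G] <;> omega
  | succ m ih =>
    cases b <;> simp [rkS] at h
    · rw [G_f, ih _ _ _ (by simp [rkS]; omega), ih _ _ _ (by simp [rkS]; omega)]; ring
    · rw [G_t, ih _ _ _ (by simp [rkS]; omega), ih _ _ _ (by simp [rkS]; omega),
        ih _ _ _ (by simp [rkS]; omega)]; ring

lemma G_5_2_t (m : ℕ) : G (m + 1) 5 2 true = (4) * ((2:ℚ)^m)^2 := by
  induction m with
  | zero => norm_num [G]
  | succ m ih =>
    rw [show m + 1 + 1 = (m + 1) + 1 by ring, G_t, ih]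
    have h0 := G_zero (m + 1) 5 3 true (by norm_num [rkS])
    try simp only [Nat.reduceAdd] at *
    rw [h0]
    ring

lemma G_4_4_f (m : ℕ) : G (m + 1) 4 4 false = 0 := by
  rw [show m + 1 = (m + 0) + 1 by ring, G_f]
  have h0 := G_zero (m + 0) 4 4 true (by norm_num [rkS])
  have h1 := G_zero (m + 0) 5 4 false (by norm_num [rkS])
  try simp only [Nat.reduceAdd, Nat.add_zero] at *
  rw [h0, h1]
  ring

lemma G_4_3_t (m : ℕ) : G (m + 1) 4 3 true = (8) * ((2:ℚ)^m)^3 := by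
  induction m with
  | zero => norm_num [G]
  | succ m ih =>
    rw [show m + 1 + 1 = (m + 1) + 1 by ring, G_t, ih]
    have h0 := G_zero (m + 1) 4 4 true (by norm_num [rkS])
    have h1 := G_zero (m + 1) 5 4 false (by norm_num [rkS])
    try simp only [Nat.reduceAdd] at *
    rw [h0, h1]
    ring

lemma G_5_3_f (m : ℕ) : G (m + 1) 5 3 false = 0 := by
  rw [show m + 1 = (m + 0) + 1 by ring, G_f]
  have h0 := G_zero (m + 0) 5 3 true (by norm_num [rkS])
  try simp only [Nat.reduceAdd, Nat.add_zero] at *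
  rw [h0]
  ring

lemma G_4_2_t (m : ℕ) : G (m + 2) 4 2 true = (16) * ((2:ℚ)^m)^2 + (192) * ((2:ℚ)^m)^3 := by
  induction m with
  | zero => norm_num [G]
  | succ m ih =>
    rw [show m + 1 + 2 = (m + 2) + 1 by ring, G_t, ih]
    have h0 := G_4_3_t (m + 1)
    rw [show m + 1 + 1 = m + 2 by ring] at h0
    have h1 := G_5_3_f (m + 1)
    rw [show m + 1 + 1 = m + 2 by ring] at h1
    try simp only [Nat.reduceAdd] at *
    rw [h0, h1]
    ring

lemma G_5_2_f (m : ℕ) : G (m + 2) 5 2 false = (128) * ((2:ℚ)^m)^2 := by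
  rw [show m + 2 = (m + 1) + 1 by ring, G_f]
  have h0 := G_5_2_t m
  try simp only [Nat.reduceAdd, Nat.add_zero] at *
  rw [h0]
  ring

lemma G_3_3_t (m : ℕ) : G (m + 2) 3 3 true = (192) * ((2:ℚ)^m)^3 := by
  induction m with
  | zero => norm_num [G]
  | succ m ih =>
    rw [show m + 1 + 2 = (m + 2) + 1 by ring, G_t, ih]
    have h0 := G_4_4_f (m + 1)
    rw [show m + 1 + 1 = m + 2 by ring] at h0
    try simp only [Nat.reduceAdd] at *
    rw [h0]
    ring

lemma G_5_1_t (m : ℕ) : G (m + 2) 5 1 true = (-60) * ((2:ℚ)^m)^1 + (240) * ((2:ℚ)^m)^2 := by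
  induction m with
  | zero => norm_num [G]
  | succ m ih =>
    rw [show m + 1 + 2 = (m + 2) + 1 by ring, G_t, ih]
    have h0 := G_5_2_t (m + 1)
    rw [show m + 1 + 1 = m + 2 by ring] at h0
    try simp only [Nat.reduceAdd] at *
    rw [h0]
    ring

lemma G_4_3_f (m : ℕ) : G (m + 2) 4 3 false = (128) * ((2:ℚ)^m)^3 := by
  rw [show m + 2 = (m + 1) + 1 by ring, G_f]
  have h0 := G_4_3_t m
  have h1 := G_5_3_f m
  try simp only [Nat.reduceAdd, Nat.add_zero] at *
  rw [h0, h1]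
  ring

lemma G_5_0_t (m : ℕ) : G (m + 3) 5 0 true = (310) * ((2:ℚ)^m)^0 + (-3720) * ((2:ℚ)^m)^1 + (9920) * ((2:ℚ)^m)^2 := by
  induction m with
  | zero => norm_num [G]
  | succ m ih =>
    rw [show m + 1 + 3 = (m + 3) + 1 by ring, G_t, ih]
    have h0 := G_5_1_t (m + 1)
    rw [show m + 1 + 2 = m + 3 by ring] at h0
    try simp only [Nat.reduceAdd] at *
    rw [h0]
    ring

lemma G_3_2_t (m : ℕ) : G (m + 3) 3 2 true = (-384) * ((2:ℚ)^m)^2 + (7680) * ((2:ℚ)^m)^3 := by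
  induction m with
  | zero => norm_num [G]
  | succ m ih =>
    rw [show m + 1 + 3 = (m + 3) + 1 by ring, G_t, ih]
    have h0 := G_3_3_t (m + 1)
    rw [show m + 1 + 2 = m + 3 by ring] at h0
    have h1 := G_4_3_f (m + 1)
    rw [show m + 1 + 2 = m + 3 by ring] at h1
    try simp only [Nat.reduceAdd] at *
    rw [h0, h1]
    ring

lemma G_4_2_f (m : ℕ) : G (m + 3) 4 2 false = (2304) * ((2:ℚ)^m)^2 + (3072) * ((2:ℚ)^m)^3 := by
  rw [show m + 3 = (m + 2) + 1 by ring, G_f]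
  have h0 := G_4_2_t m
  have h1 := G_5_2_f m
  try simp only [Nat.reduceAdd, Nat.add_zero] at *
  rw [h0, h1]
  ring

lemma G_4_1_t (m : ℕ) : G (m + 3) 4 1 true = (-1360) * ((2:ℚ)^m)^1 + (4544) * ((2:ℚ)^m)^2 + (3584) * ((2:ℚ)^m)^3 := by
  induction m with
  | zero => norm_num [G]
  | succ m ih =>
    rw [show m + 1 + 3 = (m + 3) + 1 by ring, G_t, ih]
    have h0 := G_4_2_t (m + 1)
    rw [show m + 1 + 2 = m + 3 by ring] at h0
    have h1 := G_5_2_f (m + 1)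
    rw [show m + 1 + 2 = m + 3 by ring] at h1
    try simp only [Nat.reduceAdd] at *
    rw [h0, h1]
    ring

lemma G_3_3_f (m : ℕ) : G (m + 3) 3 3 false = (4608) * ((2:ℚ)^m)^3 := by
  rw [show m + 3 = (m + 2) + 1 by ring, G_f]
  have h0 := G_3_3_t m
  have h1 := G_4_3_f m
  try simp only [Nat.reduceAdd, Nat.add_zero] at *
  rw [h0, h1]
  ring

lemma G_5_1_f (m : ℕ) : G (m + 3) 5 1 false = (-1920) * ((2:ℚ)^m)^1 + (7680) * ((2:ℚ)^m)^2 := by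
  rw [show m + 3 = (m + 2) + 1 by ring, G_f]
  have h0 := G_5_1_t m
  try simp only [Nat.reduceAdd, Nat.add_zero] at *
  rw [h0]
  ring

lemma G_4_0_t (m : ℕ) : G (m + 4) 4 0 true = (8680) * ((2:ℚ)^m)^0 + (-102240) * ((2:ℚ)^m)^1 + (254720) * ((2:ℚ)^m)^2 + (61440) * ((2:ℚ)^m)^3 := by
  induction m with
  | zero => norm_num [G]
  | succ m ih =>
    rw [show m + 1 + 4 = (m + 4) + 1 by ring, G_t, ih]
    have h0 := G_4_1_t (m + 1)
    rw [show m + 1 + 3 = m + 4 by ring] at h0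
    have h1 := G_5_1_f (m + 1)
    rw [show m + 1 + 3 = m + 4 by ring] at h1
    try simp only [Nat.reduceAdd] at *
    rw [h0, h1]
    ring

lemma G_5_0_f (m : ℕ) : G (m + 4) 5 0 false = (9920) * ((2:ℚ)^m)^0 + (-119040) * ((2:ℚ)^m)^1 + (317440) * ((2:ℚ)^m)^2 := by
  rw [show m + 4 = (m + 3) + 1 by ring, G_f]
  have h0 := G_5_0_t m
  try simp only [Nat.reduceAdd, Nat.add_zero] at *
  rw [h0]
  ring

lemma G_2_2_t (m : ℕ) : G (m + 4) 2 2 true = (-21504) * ((2:ℚ)^m)^2 + (258048) * ((2:ℚ)^m)^3 := by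
  induction m with
  | zero => norm_num [G]
  | succ m ih =>
    rw [show m + 1 + 4 = (m + 4) + 1 by ring, G_t, ih]
    have h0 := G_3_3_f (m + 1)
    rw [show m + 1 + 3 = m + 4 by ring] at h0
    try simp only [Nat.reduceAdd] at *
    rw [h0]
    ring

lemma G_3_1_t (m : ℕ) : G (m + 4) 3 1 true = (-36480) * ((2:ℚ)^m)^1 + (105984) * ((2:ℚ)^m)^2 + (159744) * ((2:ℚ)^m)^3 := by
  induction m with
  | zero => norm_num [G]
  | succ m ih =>
    rw [show m + 1 + 4 = (m + 4) + 1 by ring, G_t, ih]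
    have h0 := G_3_2_t (m + 1)
    rw [show m + 1 + 3 = m + 4 by ring] at h0
    have h1 := G_4_2_f (m + 1)
    rw [show m + 1 + 3 = m + 4 by ring] at h1
    try simp only [Nat.reduceAdd] at *
    rw [h0, h1]
    ring

lemma G_3_2_f (m : ℕ) : G (m + 4) 3 2 false = (52224) * ((2:ℚ)^m)^2 + (135168) * ((2:ℚ)^m)^3 := by
  rw [show m + 4 = (m + 3) + 1 by ring, G_f]
  have h0 := G_3_2_t m
  have h1 := G_4_2_f m
  try simp only [Nat.reduceAdd, Nat.add_zero] at *
  rw [h0, h1]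
  ring

lemma G_4_1_f (m : ℕ) : G (m + 4) 4 1 false = (-52480) * ((2:ℚ)^m)^1 + (195584) * ((2:ℚ)^m)^2 + (57344) * ((2:ℚ)^m)^3 := by
  rw [show m + 4 = (m + 3) + 1 by ring, G_f]
  have h0 := G_4_1_t m
  have h1 := G_5_1_f m
  try simp only [Nat.reduceAdd, Nat.add_zero] at *
  rw [h0, h1]
  ring

lemma G_4_0_f (m : ℕ) : G (m + 5) 4 0 false = (297600) * ((2:ℚ)^m)^0 + (-3540480) * ((2:ℚ)^m)^1 + (9154560) * ((2:ℚ)^m)^2 + (983040) * ((2:ℚ)^m)^3 := by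
  rw [show m + 5 = (m + 4) + 1 by ring, G_f]
  have h0 := G_4_0_t m
  have h1 := G_5_0_f m
  try simp only [Nat.reduceAdd, Nat.add_zero] at *
  rw [h0, h1]
  ring

lemma G_2_2_f (m : ℕ) : G (m + 5) 2 2 false = (1376256) * ((2:ℚ)^m)^2 + (4816896) * ((2:ℚ)^m)^3 := by
  rw [show m + 5 = (m + 4) + 1 by ring, G_f]
  have h0 := G_2_2_t m
  have h1 := G_3_2_f m
  try simp only [Nat.reduceAdd, Nat.add_zero] at *
  rw [h0, h1]
  ring

lemma G_2_1_t (m : ℕ) : G (m + 5) 2 1 true = (-1068032) * ((2:ℚ)^m)^1 + (2838528) * ((2:ℚ)^m)^2 + (5734400) * ((2:ℚ)^m)^3 := by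
  induction m with
  | zero => norm_num [G]
  | succ m ih =>
    rw [show m + 1 + 5 = (m + 5) + 1 by ring, G_t, ih]
    have h0 := G_2_2_t (m + 1)
    rw [show m + 1 + 4 = m + 5 by ring] at h0
    have h1 := G_3_2_f (m + 1)
    rw [show m + 1 + 4 = m + 5 by ring] at h1
    try simp only [Nat.reduceAdd] at *
    rw [h0, h1]
    ring

lemma G_3_1_f (m : ℕ) : G (m + 5) 3 1 false = (-1551360) * ((2:ℚ)^m)^1 + (5541888) * ((2:ℚ)^m)^2 + (2654208) * ((2:ℚ)^m)^3 := by
  rw [show m + 5 = (m + 4) + 1 by ring, G_f]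
  have h0 := G_3_1_t m
  have h1 := G_4_1_f m
  try simp only [Nat.reduceAdd, Nat.add_zero] at *
  rw [h0, h1]
  ring

lemma G_3_0_t (m : ℕ) : G (m + 5) 3 0 true = (259904) * ((2:ℚ)^m)^0 + (-3029760) * ((2:ℚ)^m)^1 + (7247872) * ((2:ℚ)^m)^2 + (2850816) * ((2:ℚ)^m)^3 := by
  induction m with
  | zero => norm_num [G]
  | succ m ih =>
    rw [show m + 1 + 5 = (m + 5) + 1 by ring, G_t, ih]
    have h0 := G_3_1_t (m + 1)
    rw [show m + 1 + 4 = m + 5 by ring] at h0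
    have h1 := G_4_1_f (m + 1)
    rw [show m + 1 + 4 = m + 5 by ring] at h1
    try simp only [Nat.reduceAdd] at *
    rw [h0, h1]
    ring

lemma G_2_1_f (m : ℕ) : G (m + 6) 2 1 false = (-47710208) * ((2:ℚ)^m)^1 + (166526976) * ((2:ℚ)^m)^2 + (97255424) * ((2:ℚ)^m)^3 := by
  rw [show m + 6 = (m + 5) + 1 by ring, G_f]
  have h0 := G_2_1_t m
  have h1 := G_3_1_f m
  try simp only [Nat.reduceAdd, Nat.add_zero] at *
  rw [h0, h1]
  ring

lemma G_1_1_t (m : ℕ) : G (m + 6) 1 1 true = (-32686080) * ((2:ℚ)^m)^1 + (82575360) * ((2:ℚ)^m)^2 + (192675840) * ((2:ℚ)^m)^3 := by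
  induction m with
  | zero => norm_num [G]
  | succ m ih =>
    rw [show m + 1 + 6 = (m + 6) + 1 by ring, G_t, ih]
    have h0 := G_2_2_f (m + 1)
    rw [show m + 1 + 5 = m + 6 by ring] at h0
    try simp only [Nat.reduceAdd] at *
    rw [h0]
    ring

lemma G_3_0_f (m : ℕ) : G (m + 6) 3 0 false = (9221632) * ((2:ℚ)^m)^0 + (-109209600) * ((2:ℚ)^m)^1 + (277692416) * ((2:ℚ)^m)^2 + (46399488) * ((2:ℚ)^m)^3 := by
  rw [show m + 6 = (m + 5) + 1 by ring, G_f]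
  have h0 := G_3_0_t m
  have h1 := G_4_0_f m
  try simp only [Nat.reduceAdd, Nat.add_zero] at *
  rw [h0, h1]
  ring

lemma G_2_0_t (m : ℕ) : G (m + 6) 2 0 true = (8046080) * ((2:ℚ)^m)^0 + (-93284352) * ((2:ℚ)^m)^1 + (218251264) * ((2:ℚ)^m)^2 + (104595456) * ((2:ℚ)^m)^3 := by
  induction m with
  | zero => norm_num [G]
  | succ m ih =>
    rw [show m + 1 + 6 = (m + 6) + 1 by ring, G_t, ih]
    have h0 := G_2_1_t (m + 1)
    rw [show m + 1 + 5 = m + 6 by ring] at h0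
    have h1 := G_3_1_f (m + 1)
    rw [show m + 1 + 5 = m + 6 by ring] at h1
    try simp only [Nat.reduceAdd] at *
    rw [h0, h1]
    ring

lemma G_1_0_t (m : ℕ) : G (m + 7) 1 0 true = (253255680) * ((2:ℚ)^m)^0 + (-2927984640) * ((2:ℚ)^m)^1 + (6771179520) * ((2:ℚ)^m)^2 + (3554672640) * ((2:ℚ)^m)^3 := by
  induction m with
  | zero => norm_num [G]
  | succ m ih =>
    rw [show m + 1 + 7 = (m + 7) + 1 by ring, G_t, ih]
    have h0 := G_1_1_t (m + 1)
    rw [show m + 1 + 6 = m + 7 by ring] at h0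
    have h1 := G_2_1_f (m + 1)
    rw [show m + 1 + 6 = m + 7 by ring] at h1
    try simp only [Nat.reduceAdd] at *
    rw [h0, h1]
    ring

lemma G_1_1_f (m : ℕ) : G (m + 7) 1 1 false = (-1496678400) * ((2:ℚ)^m)^1 + (5160960000) * ((2:ℚ)^m)^2 + (3303014400) * ((2:ℚ)^m)^3 := by
  rw [show m + 7 = (m + 6) + 1 by ring, G_f]
  have h0 := G_1_1_t m
  have h1 := G_2_1_f m
  try simp only [Nat.reduceAdd, Nat.add_zero] at *
  rw [h0, h1]
  ring

lemma G_2_0_f (m : ℕ) : G (m + 7) 2 0 false = (290390016) * ((2:ℚ)^m)^0 + (-3431006208) * ((2:ℚ)^m)^1 + (8648392704) * ((2:ℚ)^m)^2 + (1717567488) * ((2:ℚ)^m)^3 := by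
  rw [show m + 7 = (m + 6) + 1 by ring, G_f]
  have h0 := G_2_0_t m
  have h1 := G_3_0_f m
  try simp only [Nat.reduceAdd, Nat.add_zero] at *
  rw [h0, h1]
  ring

lemma G_0_0_t (m : ℕ) : G (m + 8) 0 0 true = (8037580800) * ((2:ℚ)^m)^0 + (-92794060800) * ((2:ℚ)^m)^1 + (213319680000) * ((2:ℚ)^m)^2 + (117021081600) * ((2:ℚ)^m)^3 := by
  induction m with
  | zero => norm_num [G]
  | succ m ih =>
    rw [show m + 1 + 8 = (m + 8) + 1 by ring, G_t, ih]
    have h0 := G_1_1_f (m + 1)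
    rw [show m + 1 + 7 = m + 8 by ring] at h0
    try simp only [Nat.reduceAdd] at *
    rw [h0]
    ring

lemma G_1_0_f (m : ℕ) : G (m + 8) 1 0 false = (9218211840) * ((2:ℚ)^m)^0 + (-108786155520) * ((2:ℚ)^m)^1 + (272994140160) * ((2:ℚ)^m)^2 + (58636369920) * ((2:ℚ)^m)^3 := by
  rw [show m + 8 = (m + 7) + 1 by ring, G_f]
  have h0 := G_1_0_t m
  have h1 := G_2_0_f m
  try simp only [Nat.reduceAdd, Nat.add_zero] at *
  rw [h0, h1]
  ring

lemma G_total (k : ℕ) (hk : 8 ≤ k) : G k 0 0 true + 31 * G k 1 0 false =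
    115320 * (2 ^ (3 * k) + 1148 * 2 ^ (2 * k) - 2 ^ 7 * 917 * 2 ^ k + 311 * 2 ^ 13) := by
  obtain ⟨m, rfl⟩ := Nat.exists_eq_add_of_le' hk
  rw [G_0_0_t, G_1_0_f]
  ring

/-- The ambient space of columns. -/
abbrev VV := Fin 5 → ZMod 2

/-- The first projection of a subspace of pairs. -/
abbrev pr1 (E : Submodule (ZMod 2) (VV × VV)) : Submodule (ZMod 2) VV :=
  E.map (LinearMap.fst (ZMod 2) VV VV)

/-- The second projection of a subspace of pairs. -/
abbrev pr2 (E : Submodule (ZMod 2) (VV × VV)) : Submodule (ZMod 2) VV :=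
  E.map (LinearMap.snd (ZMod 2) VV VV)

/-- Invariant of the state: `E` is the span of the columns so far, `v` is the current vector. -/
structure PInv (E : Submodule (ZMod 2) (VV × VV)) (v : VV) (d e : ℕ) (b : Bool) : Prop where
  snd_le : pr2 E ≤ pr1 E ⊔ Submodule.span (ZMod 2) {v}
  dim : Module.finrank (ZMod 2) (pr1 E ⊔ Submodule.span (ZMod 2) {v} : Submodule (ZMod 2) VV) = d
  flag : v ∈ pr1 E ↔ b = true
  rank : Module.finrank (ZMod 2) E + (if b = true then 0 else 1) = d + e

lemma pr1_sup (E : Submodule (ZMod 2) (VV × VV)) (v w : VV) :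
    pr1 (E ⊔ Submodule.span (ZMod 2) {(v, w)}) = pr1 E ⊔ Submodule.span (ZMod 2) {v} := by
  simp [pr1, Submodule.map_sup, Submodule.map_span]

lemma pr2_sup (E : Submodule (ZMod 2) (VV × VV)) (v w : VV) :
    pr2 (E ⊔ Submodule.span (ZMod 2) {(v, w)}) = pr2 E ⊔ Submodule.span (ZMod 2) {w} := by
  simp [pr2, Submodule.map_sup, Submodule.map_span]

lemma sup_span_of_mem {M : Type*} [AddCommGroup M] [Module (ZMod 2) M]
    (D : Submodule (ZMod 2) M) (w : M) (h : w ∈ D) :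
    D ⊔ Submodule.span (ZMod 2) {w} = D := by
  simpa using h

/-- New vector, independent of everything: the flag becomes `false`. -/
lemma PInv.step_new {E : Submodule (ZMod 2) (VV × VV)} {v w : VV} {d e : ℕ} {b : Bool}
    (h : PInv E v d e b) (hw : w ∉ pr1 E ⊔ Submodule.span (ZMod 2) {v}) :
    PInv (E ⊔ Submodule.span (ZMod 2) {(v, w)}) w (d + 1) (if b = true then e + 1 else e)
      false where
  snd_le := by
    rw [pr1_sup, pr2_sup]
    exact sup_le_sup_right h.snd_le _
  dim := by rw [pr1_sup, Submodule.finrank_sup_span_singleton hw, h.dim]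
  flag := by rw [pr1_sup]; simpa using hw
  rank := by
    have hE : (v, w) ∉ E := fun hm => hw (h.snd_le ⟨_, hm, rfl⟩)
    have := h.rank
    rw [Submodule.finrank_sup_span_singleton hE]
    cases b <;> simp_all <;> omega

/-- The rank goes up but the new vector lies in the span: the flag becomes `true`. -/
lemma PInv.step_old {E : Submodule (ZMod 2) (VV × VV)} {v w : VV} {d e : ℕ} {b : Bool}
    (h : PInv E v d e b) (hw : w ∈ pr1 E ⊔ Submodule.span (ZMod 2) {v}) (hE : (v, w) ∉ E) :
    PInv (E ⊔ Submodule.span (ZMod 2) {(v, w)}) w d (if b = true then e + 1 else e)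
      true where
  snd_le := by
    rw [pr1_sup, pr2_sup]
    exact sup_le_sup_right h.snd_le _
  dim := by rw [pr1_sup, sup_span_of_mem _ _ hw, h.dim]
  flag := by rw [pr1_sup]; simpa using hw
  rank := by
    have := h.rank
    rw [Submodule.finrank_sup_span_singleton hE]
    cases b <;> simp_all <;> omega

/-- The rank does not go up. -/
lemma PInv.step_stay {E : Submodule (ZMod 2) (VV × VV)} {v w : VV} {d e : ℕ}
    (h : PInv E v d e true) (hE : (v, w) ∈ E) :
    PInv (E ⊔ Submodule.span (ZMod 2) {(v, w)}) w d e true := by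
  have hv : v ∈ pr1 E := h.flag.2 rfl
  have h1 := h.snd_le
  have h2 := h.dim
  rw [sup_span_of_mem _ _ hv] at h1 h2
  have hw : w ∈ pr1 E := h1 ⟨_, hE, rfl⟩
  rw [sup_span_of_mem _ _ hE]
  refine ⟨?_, ?_, ?_, h.rank⟩
  · rw [sup_span_of_mem _ _ hw]; exact h1
  · rw [sup_span_of_mem _ _ hw]; exact h2
  · simpa using hw

lemma card_sub_s9 (D : Submodule (ZMod 2) VV) :
    Nat.card D = 2 ^ Module.finrank (ZMod 2) D := by
  rw [Module.natCard_eq_pow_finrank (K := ZMod 2)]; simp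

/-- Number of `w` such that the rank does not go up. -/
lemma card_stay {E : Submodule (ZMod 2) (VV × VV)} {v : VV} {d e : ℕ}
    (h : PInv E v d e true) : Nat.card {w : VV // (v, w) ∈ E} = 2 ^ e := by
  have hv : v ∈ pr1 E := h.flag.2 rfl
  obtain ⟨⟨v', u⟩, hu, rfl⟩ := hv
  simp only [LinearMap.fst_apply] at *
  have h2 := h.dim
  rw [sup_span_of_mem _ _ (h.flag.2 rfl)] at h2
  have h3 := h.rank
  let f : E →ₗ[ZMod 2] VV := (LinearMap.fst (ZMod 2) VV VV).domRestrict E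
  have h4 := LinearMap.finrank_range_add_finrank_ker f
  have h5 : LinearMap.range f = pr1 E := by
    simp [f, LinearMap.range_domRestrict]
  rw [h5, h2] at h4
  have h6 : Module.finrank (ZMod 2) (LinearMap.ker f) = e := by simp at h3; omega
  have h7 : Nat.card (LinearMap.ker f) = 2 ^ e := by
    rw [Module.natCard_eq_pow_finrank (K := ZMod 2), h6]; simp
  rw [← h7]
  refine Nat.card_congr ⟨fun w => ⟨⟨(v', w.1) - (v', u), E.sub_mem w.2 hu⟩, ?_⟩,
    fun x => ⟨x.1.1.2 + u, ?_⟩, ?_, ?_⟩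
  · simp [f]
  · have hx := x.2
    have hx1 := x.1.2
    simp only [f, LinearMap.mem_ker, LinearMap.domRestrict_apply, LinearMap.fst_apply] at hx
    have := E.add_mem hx1 hu
    have e1 : (x.1.1 + (v', u)) = (v', x.1.1.2 + u) := by
      ext1 <;> simp [hx]
    rwa [e1] at this
  · intro w; simp
  · intro x
    have hx := x.2
    simp only [f, LinearMap.mem_ker, LinearMap.domRestrict_apply, LinearMap.fst_apply] at hx
    ext1; ext1; ext1 <;> simp [hx]

open Classical in
lemma sum_split {P Q : VV → Prop} (hPQ : ∀ w, P w → Q w) (F : VV → ℚ) (a b c : ℚ)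
    (p q : ℕ) (hp : Nat.card {w // P w} = p) (hq : Nat.card {w // Q w} = q)
    (ha : ∀ w, P w → F w = a) (hb : ∀ w, Q w → ¬ P w → F w = b)
    (hc : ∀ w, ¬ Q w → F w = c) :
    ∑ w, F w = p * a + (q - p) * b + (2 ^ 5 - q) * c := by
  have h : ∀ w, F w = c + (b - c) * (if Q w then 1 else 0) + (a - b) * (if P w then 1 else 0) := by
    intro w
    by_cases h1 : P w
    · simp [h1, hPQ w h1, ha w h1]
    · by_cases h2 : Q w
      · simp [h1, h2, hb w h2 h1]
      · simp [h1, h2, hc w h2]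
  simp_rw [h, Finset.sum_add_distrib, ← Finset.mul_sum, Finset.sum_boole]
  rw [Nat.card_eq_fintype_card, Fintype.card_subtype] at hp hq
  rw [hp, hq]
  simp
  ring

/-- The span of the consecutive pairs of `v, w 0, …, w (m-1)`. -/
abbrev colSpan (m : ℕ) (v : VV) (w : Fin m → VV) : Submodule (ZMod 2) (VV × VV) :=
  Submodule.span (ZMod 2) (Set.range fun c : Fin m =>
    ((Fin.cons v w : Fin (m + 1) → VV) c.castSucc, (Fin.cons v w : Fin (m + 1) → VV) c.succ))

lemma colSpan_cons (m : ℕ) (v x : VV) (w : Fin m → VV) :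
    colSpan (m + 1) v (Fin.cons x w : Fin (m + 1) → VV) =
      Submodule.span (ZMod 2) {(v, x)} ⊔ colSpan m x w := by
  rw [colSpan, colSpan, ← Submodule.span_union]
  congr 1
  ext y
  simp only [Set.mem_range, Set.mem_union, Set.mem_singleton_iff, Fin.exists_fin_succ]
  simp [eq_comm, Fin.castSucc_succ]

/-- The dimension of a subspace of pairs. -/
noncomputable def fr (E : Submodule (ZMod 2) (VV × VV)) : ℕ := Module.finrank (ZMod 2) E

lemma sum_fin_cons (m : ℕ) (F : (Fin (m + 1) → VV) → ℚ) :
    ∑ w, F w = ∑ x : VV, ∑ w : Fin m → VV, F (Fin.cons x w : Fin (m + 1) → VV) := by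
  rw [← (Fin.consEquiv (fun _ : Fin (m + 1) => VV)).sum_comp, Fintype.sum_prod_type]
  rfl

open Classical in
lemma count_eq (m : ℕ) : ∀ (E : Submodule (ZMod 2) (VV × VV)) (v : VV) (d e : ℕ) (b : Bool),
    PInv E v d e b →
    ∑ w : Fin m → VV, (if fr (E ⊔ colSpan m v w) = 7 then (1 : ℚ) else 0) = G m d e b := by
  induction m with
  | zero =>
    intro E v d e b h
    have hr := h.rank
    have h0 : ∀ w : Fin 0 → VV, fr (E ⊔ colSpan 0 v w) = Module.finrank (ZMod 2) E := by
      intro w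
      have : E ⊔ colSpan 0 v w = E := by simp [colSpan]
      rw [this, fr]
    simp_rw [h0]
    cases b
    · simp at hr
      simp [G, ← hr]
    · simp at hr
      simp [G, ← hr]
  | succ m ih =>
    intro E v d e b h
    rw [sum_fin_cons]
    simp_rw [colSpan_cons, ← sup_assoc]
    have hq : Nat.card {w // w ∈ pr1 E ⊔ Submodule.span (ZMod 2) {v}} = 2 ^ d := by
      rw [← h.dim]; exact card_sub_s9 _
    cases b
    · have hn : ∀ w, (v, w) ∉ E := fun w hw => by
        have := h.flag.1 ⟨_, hw, rfl⟩
        simp at this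
      rw [sum_split (P := fun _ => False) (fun _ h => h.elim) _ 0 (G m d e true)
        (G m (d + 1) e false) 0 (2 ^ d) (by simp) hq (fun _ h => h.elim)
        (fun w hw _ => ih _ _ _ _ _ (h.step_old hw (hn w)))
        (fun w hw => ih _ _ _ _ _ (h.step_new hw)), G_f]
      push_cast
      ring
    · rw [sum_split (P := fun w => (v, w) ∈ E) (fun w hw => h.snd_le ⟨_, hw, rfl⟩) _
        (G m d e true) (G m d (e + 1) true)
        (G m (d + 1) (e + 1) false) (2 ^ e) (2 ^ d) (card_stay h) hq
        (fun w hw => ih _ _ _ _ _ (h.step_stay hw))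
        (fun w hw hE => ih _ _ _ _ _ (h.step_old hw hE))
        (fun w hw => ih _ _ _ _ _ (h.step_new hw)), G_t]
      push_cast
      ring

/-- Interleaving two vectors. -/
def inter : (VV × VV) →ₗ[ZMod 2] (Fin (2 * 5) → ZMod 2) where
  toFun x := fun r => if r.val % 2 = 0 then x.1 ⟨r.val / 2, by have := r.isLt; omega⟩
    else x.2 ⟨r.val / 2, by have := r.isLt; omega⟩
  map_add' x y := by ext r; dsimp; split_ifs <;> rfl
  map_smul' c x := by ext r; dsimp; split_ifs <;> rfl

lemma inter_inj : Function.Injective inter := by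
  intro x y h
  have h' : ∀ r, inter x r = inter y r := fun r => by rw [h]
  ext i
  · have := h' ⟨2 * i.val, by omega⟩
    simpa [inter] using this
  · have := h' ⟨2 * i.val + 1, by omega⟩
    have e1 : (2 * i.val + 1) % 2 = 1 := by omega
    have e2 : (2 * i.val + 1) / 2 = i.val := by omega
    simpa [inter, e1, e2] using this

lemma rank_persym_s9 (k : ℕ) (v : VV) (w : Fin k → VV) :
    (persymMatrix 5 k (fun j c => (Fin.cons v w : Fin (k + 1) → VV) c j)).rank =
      fr (colSpan k v w) := by
  rw [fr, Matrix.rank_eq_finrank_span_cols,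
    (Submodule.equivMapOfInjective inter inter_inj (colSpan k v w)).finrank_eq,
    colSpan, Submodule.map_span, ← Set.range_comp]
  refine congrArg (fun f : Fin k → Fin (2 * 5) → ZMod 2 =>
    Module.finrank (ZMod 2) (Submodule.span (ZMod 2) (Set.range f))) ?_
  funext c r
  simp only [persymMatrix, Matrix.col_apply, Matrix.of_apply, Function.comp_apply, inter,
    LinearMap.coe_mk, AddHom.coe_mk]
  split_ifs with h
  · have : (⟨r.val % 2 + c.val, by have := c.isLt; omega⟩ : Fin (k + 1)) = c.castSucc := by
      ext; simp [h]
    rw [this]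
  · have : (⟨r.val % 2 + c.val, by have := c.isLt; omega⟩ : Fin (k + 1)) = c.succ := by
      ext; simp; omega
    rw [this]

lemma pinv_zero : PInv ⊥ 0 0 0 true := by
  refine ⟨?_, ?_, ?_, ?_⟩ <;> simp [pr1, pr2]

lemma pinv_ne (v : VV) (hv : v ≠ 0) : PInv ⊥ v 1 0 false := by
  refine ⟨?_, ?_, ?_, ?_⟩
  · simp [pr1, pr2]
  · rw [pr1, Submodule.map_bot, bot_sup_eq, finrank_span_singleton hv]
  · simpa [pr1] using hv
  · simp

open Classical in
lemma Gamma_eq_G (k : ℕ) : (Gamma 5 k 7 : ℚ) = G k 0 0 true + 31 * G k 1 0 false := by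
  have h1 : Gamma 5 k 7 = Nat.card {u : Fin (k + 1) → VV //
      (persymMatrix 5 k (fun j c => u c j)).rank = 7} :=
    Nat.card_congr ((Equiv.piComm fun (_ : Fin 5) (_ : Fin (k + 1)) => ZMod 2).subtypeEquiv
      fun _ => Iff.rfl)
  rw [h1, Nat.card_eq_fintype_card, Fintype.card_subtype, ← Finset.sum_boole, sum_fin_cons]
  simp_rw [rank_persym_s9]
  have h2 : ∀ v : VV, ∑ w : Fin k → VV,
      (if fr (colSpan k v w) = 7 then (1 : ℚ) else 0) =
      if v = 0 then G k 0 0 true else G k 1 0 false := by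
    intro v
    split_ifs with hv
    · subst hv
      rw [← count_eq k _ _ _ _ _ pinv_zero]
      simp_rw [bot_sup_eq]
    · rw [← count_eq k _ _ _ _ _ (pinv_ne v hv)]
      simp_rw [bot_sup_eq]
  rw [sum_split (P := fun v => v = 0) (Q := fun v => v = 0) (fun _ h => h) _ (G k 0 0 true) 0
    (G k 1 0 false) 1 1 (by simp) (by simp) (fun w hw => by rw [h2, if_pos hw])
    (fun w hw hw' => absurd hw hw') (fun w hw => by rw [h2, if_neg hw])]
  push_cast
  ring

theorem gamma_seven_n_five (k : ℕ) (hk : 8 ≤ k) :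
    (Gamma 5 k 7 : ℤ) =
      115320 * (2 ^ (3 * k) + 1148 * 2 ^ (2 * k) - 2 ^ 7 * 917 * 2 ^ k + 311 * 2 ^ 13) := by
  have h := Gamma_eq_G k
  rw [G_total k hk] at h
  exact_mod_cast h
end

section
/- For k = 8 and every integer n ≥ 1, Γ_7(n,8) = 255·2^{7n} − 381·2^{6n} − 31122·2^{5n} + 105648·2^{4n} + 758880·2^{3n} − 4617984·2^{2n} + 7913472·2^n − 4128768 (an identity of integers). -/
open Finset

namespace Pers

open Polynomial Module

/-- Polynomials of degree `< m` over `F_2`. -/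
noncomputable abbrev D (m : ℕ) : Submodule (ZMod 2) (ZMod 2)[X] := degreeLT (ZMod 2) m

/-- Multiplication by `X`. -/
noncomputable def mX : (ZMod 2)[X] →ₗ[ZMod 2] (ZMod 2)[X] := LinearMap.mulLeft (ZMod 2) X

lemma mX_apply (p : (ZMod 2)[X]) : mX p = X * p := rfl

lemma mX_inj : Function.Injective mX := by
  intro p q h
  rw [mX_apply, mX_apply] at h
  exact mul_left_cancel₀ X_ne_zero h

/-- `S W = {w ∈ W : X w ∈ W}`. -/
noncomputable def S (W : Submodule (ZMod 2) (ZMod 2)[X]) : Submodule (ZMod 2) (ZMod 2)[X] :=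
  W ⊓ W.comap mX

lemma mem_S {W : Submodule (ZMod 2) (ZMod 2)[X]} {p : (ZMod 2)[X]} :
    p ∈ S W ↔ p ∈ W ∧ X * p ∈ W := by
  simp [S, mX_apply]

lemma S_le (W : Submodule (ZMod 2) (ZMod 2)[X]) : S W ≤ W := inf_le_left

lemma fin_of_le {m : ℕ} {W : Submodule (ZMod 2) (ZMod 2)[X]} (h : W ≤ D m) :
    FiniteDimensional (ZMod 2) W := Submodule.finiteDimensional_of_le h

lemma finrank_D (m : ℕ) : finrank (ZMod 2) (D m) = m := by
  rw [(degreeLTEquiv (ZMod 2) m).finrank_eq]; simp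

lemma finrank_map_mX (W : Submodule (ZMod 2) (ZMod 2)[X]) :
    finrank (ZMod 2) (W.map mX) = finrank (ZMod 2) W :=
  (Submodule.equivMapOfInjective mX mX_inj W).finrank_eq.symm

lemma finrank_sup_S {m : ℕ} {W : Submodule (ZMod 2) (ZMod 2)[X]} (h : W ≤ D m) :
    finrank (ZMod 2) (W ⊔ W.map mX : Submodule (ZMod 2) (ZMod 2)[X]) + finrank (ZMod 2) (S W)
      = 2 * finrank (ZMod 2) W := by
  have := fin_of_le h
  have h1 := Submodule.finrank_sup_add_finrank_inf_eq W (W.map mX)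
  have h2 : W ⊓ W.map mX = (S W).map mX := by
    ext p
    simp only [Submodule.mem_inf, Submodule.mem_map, mem_S, mX_apply]
    constructor
    · rintro ⟨h1, q, hq, rfl⟩
      exact ⟨q, ⟨hq, h1⟩, rfl⟩
    · rintro ⟨q, ⟨hq, h1⟩, rfl⟩
      exact ⟨h1, q, hq, rfl⟩
  rw [h2, finrank_map_mX, finrank_map_mX] at h1
  omega

lemma sup_le_D {m : ℕ} {W : Submodule (ZMod 2) (ZMod 2)[X]} (h : W ≤ D m) :
    W ⊔ W.map mX ≤ D (m + 1) := by
  refine sup_le (h.trans (degreeLT_mono (Nat.le_succ m))) ?_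
  rintro p ⟨q, hq, rfl⟩
  have := h hq
  rw [mem_degreeLT] at this ⊢
  rw [mX_apply, mul_comm, degree_mul, degree_X]
  rcases eq_or_ne q 0 with rfl | h0
  · simp
  · rw [degree_eq_natDegree h0] at this ⊢
    norm_cast at this ⊢
    omega

lemma S_lt {m : ℕ} {W : Submodule (ZMod 2) (ZMod 2)[X]} (h : W ≤ D m)
    (h0 : 0 < finrank (ZMod 2) W) : finrank (ZMod 2) (S W) < finrank (ZMod 2) W := by
  have := fin_of_le h
  by_contra hc
  have hS : S W = W := Submodule.eq_of_le_of_finrank_eq (S_le W)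
    (le_antisymm (Submodule.finrank_mono (S_le W)) (not_lt.1 hc))
  have hW : W ≠ ⊥ := by
    rintro rfl
    simp at h0
  obtain ⟨p, hp, hp0⟩ := Submodule.exists_mem_ne_zero_of_ne_bot hW
  have key : ∀ i : ℕ, X ^ i * p ∈ W := by
    intro i
    induction i with
    | zero => simpa using hp
    | succ i ih =>
      rw [← hS, mem_S] at ih
      rw [pow_succ', mul_assoc]; exact ih.2
  have := h (key m)
  rw [mem_degreeLT, degree_mul, degree_X_pow, degree_eq_natDegree hp0] at this
  norm_cast at this
  omega

lemma chain_LI {f : (ZMod 2)[X]} (hf : f ≠ 0) (d : ℕ) :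
    LinearIndependent (ZMod 2) (fun i : Fin d => X ^ (i : ℕ) * f) := by
  have h1 : LinearIndependent (ZMod 2) (fun i : ℕ => (X : (ZMod 2)[X]) ^ i) := by
    have := (basisMonomials (ZMod 2)).linearIndependent
    simpa [X_pow_eq_monomial] using this
  have h2 : LinearIndependent (ZMod 2) (fun i : Fin d => (X : (ZMod 2)[X]) ^ (i : ℕ)) :=
    h1.comp _ Fin.val_injective
  have h3 := h2.map' (LinearMap.mulRight (ZMod 2) f) (by
    rw [LinearMap.ker_eq_bot]
    intro a b hab
    exact mul_right_cancel₀ hf hab)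
  exact h3

lemma exists_chain {m : ℕ} (d : ℕ) : ∀ {W : Submodule (ZMod 2) (ZMod 2)[X]}, W ≤ D m →
    finrank (ZMod 2) W = d + 1 → finrank (ZMod 2) (S W) = d →
    ∃ f : (ZMod 2)[X], f ≠ 0 ∧ ∀ i, i ≤ d → X ^ i * f ∈ W := by
  induction d with
  | zero =>
    intro W h h1 h2
    have hW : W ≠ ⊥ := by
      rintro rfl
      simp at h1
    obtain ⟨p, hp, hp0⟩ := Submodule.exists_mem_ne_zero_of_ne_bot hW
    refine ⟨p, hp0, fun i hi => ?_⟩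
    obtain rfl : i = 0 := by omega
    simpa using hp
  | succ d ih =>
    intro W h h1 h2
    have hS := (S_le W).trans h
    have := fin_of_le h
    have h3 := finrank_sup_S hS
    have h4 : S W ⊔ (S W).map mX ≤ W := by
      refine sup_le (S_le W) ?_
      rintro p ⟨q, hq, rfl⟩
      exact (mem_S.1 hq).2
    have h5 := Submodule.finrank_mono h4
    have h6 := S_lt hS (by omega)
    obtain ⟨f, hf, hc⟩ := ih hS h2 (by omega)
    refine ⟨f, hf, fun i hi => ?_⟩
    rcases Nat.lt_or_ge i (d + 1) with h7 | h7
    · exact S_le W (hc i (by omega))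
    · obtain rfl : i = d + 1 := by omega
      rw [pow_succ', mul_assoc]
      exact (mem_S.1 (hc d le_rfl)).2

lemma span_chain {m d : ℕ} {W : Submodule (ZMod 2) (ZMod 2)[X]} (h : W ≤ D m)
    (hW : finrank (ZMod 2) W = d) {f : (ZMod 2)[X]} (hf : f ≠ 0)
    (hc : ∀ i, i < d → X ^ i * f ∈ W) :
    Submodule.span (ZMod 2) (Set.range (fun i : Fin d => X ^ (i : ℕ) * f)) = W := by
  have := fin_of_le h
  apply Submodule.eq_of_le_of_finrank_eq
  · rw [Submodule.span_le]
    rintro _ ⟨i, rfl⟩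
    exact hc i i.2
  · rw [finrank_span_eq_card (chain_LI hf d), hW]; simp

lemma finrank_S_of_chain {m d : ℕ} {W : Submodule (ZMod 2) (ZMod 2)[X]} (h : W ≤ D m)
    (hW : finrank (ZMod 2) W = d + 1) {f : (ZMod 2)[X]} (hf : f ≠ 0)
    (hc : ∀ i, i ≤ d → X ^ i * f ∈ W) : finrank (ZMod 2) (S W) = d := by
  have h1 := S_lt h (by omega)
  have := fin_of_le ((S_le W).trans h)
  have h2 : Submodule.span (ZMod 2) (Set.range (fun i : Fin d => X ^ (i : ℕ) * f)) ≤ S W := by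
    rw [Submodule.span_le]
    rintro _ ⟨i, rfl⟩
    refine mem_S.2 ⟨hc i (by omega), ?_⟩
    have := hc (i + 1) (by omega)
    rwa [pow_succ', mul_assoc] at this
  have h3 := Submodule.finrank_mono h2
  rw [finrank_span_eq_card (chain_LI hf d), Fintype.card_fin] at h3
  omega

lemma chain_dvd {m d : ℕ} {W : Submodule (ZMod 2) (ZMod 2)[X]} (h : W ≤ D m)
    (hW : finrank (ZMod 2) W = d) {f g : (ZMod 2)[X]} (hf : f ≠ 0)
    (hc : ∀ i, i < d → X ^ i * f ∈ W) (hg : g ∈ W) : f ∣ g := by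
  rw [← span_chain h hW hf hc] at hg
  induction hg using Submodule.span_induction with
  | mem x hx => obtain ⟨i, rfl⟩ := hx; exact dvd_mul_left _ _
  | zero => exact dvd_zero _
  | add x y _ _ hx hy => exact dvd_add hx hy
  | smul a x _ hx => exact hx.trans (by rw [smul_eq_C_mul]; exact dvd_mul_left _ _)

lemma eq_of_dvd_dvd {f g : (ZMod 2)[X]} (h1 : f ∣ g) (h2 : g ∣ f) : f = g := by
  obtain ⟨u, rfl⟩ := associated_of_dvd_dvd h1 h2
  obtain ⟨r, hr, hu⟩ := Polynomial.isUnit_iff.1 u.isUnit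
  have : r = 1 := by
    have h0 := hr.ne_zero
    exact (by decide : ∀ r : ZMod 2, r ≠ 0 → r = 1) r h0
  rw [← hu, this]; simp

lemma chain_unique {m d : ℕ} {W : Submodule (ZMod 2) (ZMod 2)[X]} (h : W ≤ D m)
    (hW : finrank (ZMod 2) W = d + 1) {f g : (ZMod 2)[X]} (hf : f ≠ 0) (hg : g ≠ 0)
    (hcf : ∀ i, i ≤ d → X ^ i * f ∈ W) (hcg : ∀ i, i ≤ d → X ^ i * g ∈ W) : f = g := by
  refine eq_of_dvd_dvd (chain_dvd h hW hf (fun i hi => hcf i (by omega)) ?_)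
    (chain_dvd h hW hg (fun i hi => hcg i (by omega)) ?_)
  · simpa using hcg 0 (by omega)
  · simpa using hcf 0 (by omega)

section counting

open Classical

noncomputable instance instFintypeD (m : ℕ) : Fintype (D m) :=
  have : Finite (D m) := Module.finite_of_finite (ZMod 2)
  Fintype.ofFinite _

lemma card_mem {m : ℕ} {W : Submodule (ZMod 2) (ZMod 2)[X]} (h : W ≤ D m) :
    #{p : D m | (p : (ZMod 2)[X]) ∈ W} = 2 ^ finrank (ZMod 2) W := by
  have := fin_of_le h
  have : Finite W := Module.finite_of_finite (ZMod 2)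
  have := Fintype.ofFinite W
  have h1 := Module.card_eq_pow_finrank (K := ZMod 2) (V := W)
  rw [ZMod.card] at h1
  rw [← h1, ← Fintype.card_subtype]
  exact Fintype.card_congr
    { toFun := fun p => ⟨p.1.1, p.2⟩
      invFun := fun p => ⟨⟨p.1, h p.2⟩, p.2⟩
      left_inv := fun p => rfl
      right_inv := fun p => rfl }

lemma card_D (m : ℕ) : Fintype.card (D m) = 2 ^ m := by
  rw [Module.card_eq_pow_finrank (K := ZMod 2), ZMod.card, finrank_D]

/-- linearly independent `d`-tuples of polynomials of degree `< 8` -/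
noncomputable def LI (d : ℕ) : Finset (Fin d → D 8) :=
  univ.filter fun w => LinearIndependent (ZMod 2) (fun i => (w i : (ZMod 2)[X]))

/-- span of a tuple -/
noncomputable def sp {d : ℕ} (w : Fin d → D 8) : Submodule (ZMod 2) (ZMod 2)[X] :=
  Submodule.span (ZMod 2) (Set.range fun i => (w i : (ZMod 2)[X]))

lemma sp_le {d : ℕ} (w : Fin d → D 8) : sp w ≤ D 8 := by
  rw [sp, Submodule.span_le]
  rintro _ ⟨i, rfl⟩
  exact (w i).2

lemma sp_le_iff {d : ℕ} (w : Fin d → D 8) (U : Submodule (ZMod 2) (ZMod 2)[X]) :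
    sp w ≤ U ↔ ∀ i, (w i : (ZMod 2)[X]) ∈ U := by
  rw [sp, Submodule.span_le]
  constructor
  · intro h i
    exact h ⟨i, rfl⟩
  · rintro h _ ⟨i, rfl⟩
    exact h i

lemma finrank_sp {d : ℕ} {w : Fin d → D 8} (hw : w ∈ LI d) : finrank (ZMod 2) (sp w) = d := by
  simp only [LI, mem_filter, mem_univ, true_and] at hw
  rw [sp, finrank_span_eq_card hw, Fintype.card_fin]

/-- the number of bases -/
def gl (d r : ℕ) : ℕ := ∏ i ∈ range d, (2 ^ r - 2 ^ i)

lemma cntLI (d : ℕ) {U : Submodule (ZMod 2) (ZMod 2)[X]} (h : U ≤ D 8) :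
    #{w ∈ LI d | sp w ≤ U} = gl d (finrank (ZMod 2) U) := by
  have := fin_of_le h
  have : Finite U := Module.finite_of_finite (ZMod 2)
  by_cases hd : d ≤ finrank (ZMod 2) U
  · have h1 := card_linearIndependent (K := ZMod 2) (V := U) hd
    rw [ZMod.card, Fin.prod_univ_eq_prod_range (fun i => 2 ^ finrank (ZMod 2) U - 2 ^ i) d] at h1
    rw [gl, ← h1, LI, filter_filter, ← Fintype.card_subtype, ← Nat.card_eq_fintype_card]
    refine Nat.card_congr
      { toFun := fun w => ⟨fun i => ⟨(w.1 i).1, (sp_le_iff _ _).1 w.2.2 i⟩, ?_⟩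
        invFun := fun w => ⟨fun i => ⟨(w.1 i).1, h (w.1 i).2⟩, ?_, ?_⟩
        left_inv := fun p => rfl
        right_inv := fun p => rfl }
    · exact LinearIndependent.of_comp U.subtype w.2.1
    · exact w.2.map' U.subtype (Submodule.ker_subtype U)
    · rw [sp_le_iff]
      exact fun i => (w.1 i).2
  · rw [gl, Finset.prod_eq_zero (i := finrank (ZMod 2) U) (by simpa using hd) (by simp),
      Finset.card_eq_zero, Finset.filter_eq_empty_iff]
    intro w hw hle
    have h1 := finrank_sp hw
    have h2 := Submodule.finrank_mono hle
    omega

lemma card_LI (d : ℕ) : #(LI d) = gl d 8 := by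
  have := cntLI d (le_refl (D 8))
  rw [finrank_D] at this
  rw [← this, Finset.filter_true_of_mem]
  intro w _
  exact sp_le w

lemma cntLI' (d : ℕ) {U : Submodule (ZMod 2) (ZMod 2)[X]} (h : U ≤ D 8)
    (hU : finrank (ZMod 2) U = d) : #{w ∈ LI d | U ≤ sp w} = gl d d := by
  have h1 := cntLI d h
  rw [hU] at h1
  rw [← h1]
  congr 1
  apply Finset.filter_congr
  intro w hw
  have h2 := finrank_sp hw
  have := fin_of_le h
  have := fin_of_le (sp_le w)
  constructor
  · intro h3
    exact (Submodule.eq_of_le_of_finrank_eq h3 (by omega)).ge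
  · intro h3
    exact (Submodule.eq_of_le_of_finrank_eq h3 (by omega)).ge

/-- number of independent tuples with given `finrank (S (sp w))` -/
noncomputable def N (d s : ℕ) : ℕ := #{w ∈ LI d | finrank (ZMod 2) (S (sp w)) = s}

lemma mul_mem_D {d e : ℕ} {f : (ZMod 2)[X]} (i : ℕ) (hf : f ∈ D d) (h : d + i ≤ e) :
    X ^ i * f ∈ D e := by
  rw [mem_degreeLT] at hf ⊢
  rcases eq_or_ne f 0 with rfl | h0
  · simp
  · rw [degree_mul, degree_X_pow]
    rw [degree_eq_natDegree h0] at hf ⊢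
    norm_cast at hf ⊢
    omega

lemma mem_D_of_mul {d e : ℕ} {f : (ZMod 2)[X]} (i : ℕ) (hf : X ^ i * f ∈ D e) (h : e ≤ d + i) :
    f ∈ D d := by
  rw [mem_degreeLT] at hf ⊢
  rcases eq_or_ne f 0 with rfl | h0
  · simp
  · rw [degree_mul, degree_X_pow] at hf
    rw [degree_eq_natDegree h0] at hf ⊢
    norm_cast at hf ⊢
    omega

lemma N_top (d : ℕ) (hd : d ≤ 7) : N (d + 1) d = (2 ^ (8 - d) - 1) * gl (d + 1) (d + 1) := by
  have key := Finset.sum_card_bipartiteAbove_eq_sum_card_bipartiteBelow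
    (s := univ.filter fun f : D (8 - d) => f ≠ 0) (t := LI (d + 1))
    (fun (f : D (8 - d)) (w : Fin (d + 1) → D 8) => ∀ i, i ≤ d → X ^ i * (f : (ZMod 2)[X]) ∈ sp w)
  rw [Finset.sum_congr rfl (g := fun _ => gl (d + 1) (d + 1))] at key
  · rw [Finset.sum_const, Finset.filter_ne', Finset.card_erase_of_mem (Finset.mem_univ _),
      Finset.card_univ, card_D, smul_eq_mul] at key
    rw [key, N, Finset.card_filter]
    apply Finset.sum_congr rfl
    intro w hw
    have hr := finrank_sp hw
    rw [Finset.bipartiteBelow]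
    split_ifs with hs
    · obtain ⟨f, hf, hc⟩ := exists_chain d (sp_le w) hr hs
      symm
      rw [Finset.card_eq_one]
      have hfD : f ∈ D (8 - d) :=
        mem_D_of_mul d (sp_le w (hc d le_rfl)) (by omega)
      refine ⟨⟨f, hfD⟩, ?_⟩
      ext g
      simp only [mem_filter, mem_erase, mem_univ, and_true, mem_singleton]
      constructor
      · rintro ⟨hg, hgc⟩
        apply Subtype.ext
        exact chain_unique (sp_le w) hr (by simpa using hg) hf hgc hc
      · rintro rfl
        exact ⟨by simpa [Subtype.ext_iff] using hf, hc⟩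
    · symm
      rw [Finset.card_eq_zero, Finset.filter_eq_empty_iff]
      intro g hg hc
      simp only [mem_erase, mem_univ, and_true] at hg
      exact hs (finrank_S_of_chain (sp_le w) hr (by simpa using hg) hc)
  · intro f hf
    simp only [mem_filter, mem_univ, true_and] at hf
    have hf' : (f : (ZMod 2)[X]) ≠ 0 := by simpa using hf
    set U := Submodule.span (ZMod 2)
      (Set.range (fun i : Fin (d + 1) => X ^ (i : ℕ) * (f : (ZMod 2)[X]))) with hU
    have hUD : U ≤ D 8 := by
      rw [hU, Submodule.span_le]
      rintro _ ⟨i, rfl⟩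
      exact mul_mem_D i f.2 (by omega)
    rw [← cntLI' (d + 1) hUD (by rw [hU, finrank_span_eq_card (chain_LI hf' _), Fintype.card_fin])]
    rw [Finset.bipartiteAbove]
    congr 1
    apply Finset.filter_congr
    intro w _
    rw [hU, Submodule.span_le]
    constructor
    · rintro h _ ⟨i, rfl⟩
      exact h i (by omega)
    · intro h i hi
      exact h ⟨⟨i, by omega⟩, rfl⟩

lemma N_zero (d s : ℕ) (hd : 0 < d) (h : d ≤ s) : N d s = 0 := by
  rw [N, Finset.card_eq_zero, Finset.filter_eq_empty_iff]
  intro w hw hs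
  have h1 := finrank_sp hw
  have h2 := S_lt (sp_le w) (by omega)
  omega

lemma N_sum (d : ℕ) (hd : 0 < d) : ∑ s ∈ range d, N d s = gl d 8 := by
  rw [← card_LI, Finset.card_eq_sum_card_fiberwise (t := range d)
    (f := fun w => finrank (ZMod 2) (S (sp w)))]
  · rfl
  · intro w hw
    have h1 := finrank_sp hw
    have h2 := S_lt (sp_le w) (by omega)
    simp only [coe_range, Set.mem_Iio]
    omega

/-- span of `g` and `X g` -/
noncomputable def pr (g : (ZMod 2)[X]) : Submodule (ZMod 2) (ZMod 2)[X] :=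
  Submodule.span (ZMod 2) {g, X * g}

lemma finrank_pair {g : (ZMod 2)[X]} (hg : g ≠ 0) :
    finrank (ZMod 2) (pr g) = 2 := by
  have h1 := finrank_span_eq_card (chain_LI hg 2)
  rw [Fintype.card_fin] at h1
  have h2 : ({g, X * g} : Set (ZMod 2)[X]) = Set.range (fun i : Fin 2 => X ^ (i : ℕ) * g) := by
    ext p
    simp only [Set.mem_insert_iff, Set.mem_singleton_iff, Set.mem_range, Fin.exists_fin_two]
    simp [eq_comm]
  rw [pr, h2, h1]

lemma N_three : 4 * N 3 1 + 12 * N 3 2 = 127 * 252 * gl 3 3 := by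
  have key := Finset.sum_card_bipartiteAbove_eq_sum_card_bipartiteBelow
    (s := univ.filter fun gh : D 7 × D 8 => gh.1 ≠ 0 ∧
      (gh.2 : (ZMod 2)[X]) ∉ pr gh.1)
    (t := LI 3)
    (fun (gh : D 7 × D 8) (w : Fin 3 → D 8) =>
      ((gh.1 : (ZMod 2)[X]) ∈ sp w ∧ X * (gh.1 : (ZMod 2)[X]) ∈ sp w) ∧
        (gh.2 : (ZMod 2)[X]) ∈ sp w)
  rw [Finset.sum_congr rfl (g := fun _ => gl 3 3)] at key
  · rw [Finset.sum_const, smul_eq_mul] at key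
    have hcard : #(univ.filter fun gh : D 7 × D 8 => gh.1 ≠ 0 ∧
      (gh.2 : (ZMod 2)[X]) ∉ pr gh.1)
        = 127 * 252 := by
      rw [Finset.card_filter, Fintype.sum_prod_type]
      rw [Finset.sum_congr rfl (g := fun g : D 7 => if g ≠ 0 then 252 else 0)]
      · rw [← Finset.sum_filter, Finset.sum_const, Finset.filter_ne',
          Finset.card_erase_of_mem (Finset.mem_univ _), Finset.card_univ, card_D]
        norm_num
      · intro g _
        by_cases hg : g = 0
        · simp [hg]
        · have hg' : (g : (ZMod 2)[X]) ≠ 0 := by simpa using hg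
          have hU : pr g ≤ D 8 := by
            rw [pr, Submodule.span_le]
            rintro p (rfl | rfl)
            · exact degreeLT_mono (by norm_num) g.2
            · simpa using mul_mem_D (e := 8) 1 g.2 (by norm_num)
          have h1 := card_mem hU
          rw [finrank_pair hg'] at h1
          have h2 := Finset.card_filter_add_card_filter_not (s := (univ : Finset (D 8)))
            (fun p : D 8 => (p : (ZMod 2)[X]) ∈
              pr g)
          rw [Finset.card_univ, card_D, h1] at h2
          simp only [ne_eq, hg, not_false_eq_true, true_and, if_true]
          rw [← Finset.card_filter]
          omega
    rw [hcard] at key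
    rw [key]
    have hN : ∀ s, N 3 s = ∑ w ∈ LI 3, if finrank (ZMod 2) (S (sp w)) = s then 1 else 0 := by
      intro s
      rw [N, Finset.card_filter]
    rw [hN, hN, Finset.mul_sum, Finset.mul_sum, ← Finset.sum_add_distrib]
    apply Finset.sum_congr rfl
    intro w hw
    have hr := finrank_sp hw
    have hlt := S_lt (sp_le w) (by omega)
    rw [hr] at hlt
    rw [Finset.bipartiteBelow, Finset.filter_filter, Finset.card_filter, Fintype.sum_prod_type]
    rw [Finset.sum_congr rfl (g := fun g : D 7 =>
      if (g : (ZMod 2)[X]) ∈ S (sp w) ∧ g ≠ 0 then 4 else 0)]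
    · rw [← Finset.sum_filter, Finset.sum_const, ← Finset.filter_filter, Finset.filter_ne',
        Finset.card_erase_of_mem (by simp), card_mem, smul_eq_mul]
      · interval_cases finrank (ZMod 2) (S (sp w)) <;> simp
      · intro p hp
        exact mem_D_of_mul 1 (by simpa using sp_le w (mem_S.1 hp).2) (by norm_num)
    · intro g _
      by_cases hg : g = 0
      · simp [hg]
      by_cases hgS : (g : (ZMod 2)[X]) ∈ S (sp w)
      · have hg' : (g : (ZMod 2)[X]) ≠ 0 := by simpa using hg
        have hgS' := mem_S.1 hgS
        have hle : pr g ≤ sp w := by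
          rw [pr, Submodule.span_le]
          rintro p (rfl | rfl)
          · exact hgS'.1
          · exact hgS'.2
        have h1 := card_mem (hle.trans (sp_le w))
        rw [finrank_pair hg'] at h1
        have h2 := card_mem (sp_le w)
        rw [hr] at h2
        have h3 := Finset.card_sdiff_of_subset (s := univ.filter fun p : D 8 => (p : (ZMod 2)[X]) ∈
              pr g)
              (t := univ.filter fun p : D 8 => (p : (ZMod 2)[X]) ∈ sp w) (by
                intro p hp
                simp only [mem_filter, mem_univ, true_and] at hp ⊢
                exact hle hp)
        rw [h1, h2] at h3
        simp only [hg, hgS, ne_eq, not_false_eq_true, and_true, true_and, if_true, hgS'.1, hgS'.2]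
        rw [← Finset.card_filter]
        rw [show (4 : ℕ) = 2 ^ 3 - 2 ^ 2 by norm_num, ← h3]
        congr 1
        ext p
        simp only [mem_filter, mem_univ, true_and, mem_sdiff]
        tauto
      · have : ¬ ((g : (ZMod 2)[X]) ∈ sp w ∧ X * (g : (ZMod 2)[X]) ∈ sp w) :=
          fun h => hgS (mem_S.2 h)
        simp [hgS, this]
  · rintro ⟨g, h⟩ hgh
    simp only [mem_filter, mem_univ, true_and] at hgh
    obtain ⟨hg, hh⟩ := hgh
    have hg' : (g : (ZMod 2)[X]) ≠ 0 := by simpa using hg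
    have hle2 : pr g ≤ D 8 := by
      rw [pr, Submodule.span_le]
      rintro p (rfl | rfl)
      · exact degreeLT_mono (by norm_num) g.2
      · simpa using mul_mem_D (e := 8) 1 g.2 (by norm_num)
    have hfin := fin_of_le hle2
    have hUD : pr g ⊔ Submodule.span (ZMod 2) {(h : (ZMod 2)[X])} ≤ D 8 := by
      refine sup_le hle2 ?_
      rw [Submodule.span_le]
      rintro p rfl
      exact h.2
    have hrank : finrank (ZMod 2)
        (pr g ⊔ Submodule.span (ZMod 2) {(h : (ZMod 2)[X])} : Submodule (ZMod 2) (ZMod 2)[X]) = 3 := by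
      have h0 : (h : (ZMod 2)[X]) ≠ 0 := by
        intro h0
        rw [h0] at hh
        exact hh (Submodule.zero_mem _)
      have h1 := Submodule.finrank_sup_add_finrank_inf_eq (pr g : Submodule (ZMod 2) (ZMod 2)[X])
        (Submodule.span (ZMod 2) {(h : (ZMod 2)[X])})
      have h2 : pr g ⊓ Submodule.span (ZMod 2) {(h : (ZMod 2)[X])} = ⊥ :=
        ((Submodule.disjoint_span_singleton' h0).2 hh).eq_bot
      rw [h2, finrank_pair hg', finrank_span_singleton h0, finrank_bot] at h1
      omega
    rw [← cntLI' 3 hUD hrank, Finset.bipartiteAbove]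
    congr 1
    apply Finset.filter_congr
    intro w _
    rw [sup_le_iff, pr, Submodule.span_le, Submodule.span_le]
    simp [Set.insert_subset_iff]

/-- coefficient vector -/
noncomputable def cf : (ZMod 2)[X] →ₗ[ZMod 2] (Fin 9 → ZMod 2) :=
  LinearMap.pi fun i => lcoeff (ZMod 2) (i : ℕ)

lemma cf_apply (p : (ZMod 2)[X]) (i : Fin 9) : cf p i = p.coeff i := rfl

/-- the kernel of the persymmetric matrix, as a space of polynomials -/
noncomputable def V {n : ℕ} (α : Fin n → Fin 9 → ZMod 2) : Submodule (ZMod 2) (ZMod 2)[X] where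
  carrier := {p | p ∈ D 8 ∧ ∀ j, α j ⬝ᵥ cf p = 0 ∧ α j ⬝ᵥ cf (mX p) = 0}
  zero_mem' := by simp
  add_mem' := by
    rintro p q ⟨h1, h2⟩ ⟨h3, h4⟩
    refine ⟨Submodule.add_mem _ h1 h3, fun j => ?_⟩
    simp [h2 j, h4 j, dotProduct_add]
  smul_mem' := by
    rintro c p ⟨h1, h2⟩
    refine ⟨Submodule.smul_mem _ _ h1, fun j => ?_⟩
    simp [h2 j, dotProduct_smul]

lemma mem_V {n : ℕ} {α : Fin n → Fin 9 → ZMod 2} {p : (ZMod 2)[X]} :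
    p ∈ V α ↔ p ∈ D 8 ∧ ∀ j, α j ⬝ᵥ cf p = 0 ∧ α j ⬝ᵥ cf (mX p) = 0 := Iff.rfl

lemma V_le {n : ℕ} (α : Fin n → Fin 9 → ZMod 2) : V α ≤ D 8 := fun _ h => h.1

lemma row_zero (a : Fin 9 → ZMod 2) (p : D 8) :
    a ⬝ᵥ cf p = ∑ c : Fin 8, a ⟨0 + c, by omega⟩ * degreeLTEquiv (ZMod 2) 8 p c := by
  rw [dotProduct, Fin.sum_univ_castSucc]
  have h : cf (p : (ZMod 2)[X]) (Fin.last 8) = 0 := by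
    rw [cf_apply]
    exact coeff_eq_zero_of_degree_lt (mem_degreeLT.1 p.2)
  rw [h, mul_zero, add_zero]
  apply Finset.sum_congr rfl
  intro c _
  have h1 : (⟨0 + c, by omega⟩ : Fin 9) = c.castSucc := by ext; simp
  rw [h1]
  rfl

lemma row_one (a : Fin 9 → ZMod 2) (p : D 8) :
    a ⬝ᵥ cf (mX p) = ∑ c : Fin 8, a ⟨1 + c, by omega⟩ * degreeLTEquiv (ZMod 2) 8 p c := by
  rw [dotProduct, Fin.sum_univ_succ]
  have h : cf (mX (p : (ZMod 2)[X])) 0 = 0 := by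
    rw [cf_apply, mX_apply]
    simp
  rw [h, mul_zero, zero_add]
  apply Finset.sum_congr rfl
  intro c _
  have h1 : (⟨1 + c, by omega⟩ : Fin 9) = c.succ := by ext; simp [add_comm]
  rw [h1, cf_apply, mX_apply, Fin.val_succ, coeff_X_mul]
  rfl

lemma mem_V_iff {n : ℕ} (α : Fin n → Fin 9 → ZMod 2) (p : D 8) :
    (p : (ZMod 2)[X]) ∈ V α ↔
      (persymMatrix n 8 α).mulVecLin (degreeLTEquiv (ZMod 2) 8 p) = 0 := by
  rw [mem_V, Matrix.mulVecLin_apply]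
  constructor
  · rintro ⟨-, h⟩
    funext r
    have hj : r.val / 2 < n := by have := r.isLt; omega
    obtain ⟨h0, h1⟩ := h ⟨r.val / 2, hj⟩
    rw [row_zero] at h0
    rw [row_one] at h1
    rcases Nat.mod_two_eq_zero_or_one r.val with hr | hr
    · simpa [Matrix.mulVec, dotProduct, persymMatrix, hr] using h0
    · simpa [Matrix.mulVec, dotProduct, persymMatrix, hr] using h1
  · intro h
    refine ⟨p.2, fun j => ⟨?_, ?_⟩⟩
    · have h0 := congrFun h ⟨2 * j.val, by omega⟩
      rw [row_zero]
      simpa [Matrix.mulVec, dotProduct, persymMatrix] using h0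
    · have h0 := congrFun h ⟨2 * j.val + 1, by omega⟩
      rw [row_one]
      have e1 : (2 * j.val + 1) / 2 = j.val := by omega
      have e2 : (2 * j.val + 1) % 2 = 1 := by omega
      simpa [Matrix.mulVec, dotProduct, persymMatrix, e1, e2] using h0

lemma rank_add {n : ℕ} (α : Fin n → Fin 9 → ZMod 2) :
    (persymMatrix n 8 α).rank + finrank (ZMod 2) (V α) = 8 := by
  have h1 := LinearMap.finrank_range_add_finrank_ker (persymMatrix n 8 α).mulVecLin
  have h2 : V α = (((persymMatrix n 8 α).mulVecLin.ker).map
      ((degreeLTEquiv (ZMod 2) 8).symm : (Fin 8 → ZMod 2) →ₗ[ZMod 2] D 8)).map (D 8).subtype := by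
    ext p
    constructor
    · intro hp
      refine ⟨⟨p, V_le α hp⟩, ⟨degreeLTEquiv (ZMod 2) 8 ⟨p, V_le α hp⟩, ?_, ?_⟩, rfl⟩
      · exact (mem_V_iff α ⟨p, V_le α hp⟩).1 hp
      · exact LinearEquiv.symm_apply_apply _ _
    · rintro ⟨q, ⟨v, hv, rfl⟩, rfl⟩
      refine (mem_V_iff α _).2 ?_
      rw [LinearEquiv.coe_coe, LinearEquiv.apply_symm_apply]
      exact hv
  rw [h2, Submodule.finrank_map_subtype_eq, LinearEquiv.finrank_map_eq, Matrix.rank]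
  simpa using h1

lemma card_ann {U : Submodule (ZMod 2) (ZMod 2)[X]} (h : U ≤ D 9) :
    #{a : Fin 9 → ZMod 2 | ∀ p ∈ U, a ⬝ᵥ cf p = 0} = 2 ^ (9 - finrank (ZMod 2) U) := by
  have := fin_of_le h
  set T : Submodule (ZMod 2) (Fin 9 → ZMod 2) := U.map cf with hT
  have hTU : finrank (ZMod 2) T = finrank (ZMod 2) U := by
    have hinj : Function.Injective (cf.domRestrict U) := by
      rw [← LinearMap.ker_eq_bot, LinearMap.ker_eq_bot']
      intro p hp
      apply Subtype.ext
      have h2 := (degreeLTEquiv_eq_zero_iff_eq_zero (h p.2)).1 hp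
      exact h2
    have h3 := LinearMap.finrank_range_of_inj hinj
    rw [← h3]
    have h4 : (cf.domRestrict U).range = T := by
      ext a
      simp [hT]
    rw [h4]
  set A : Submodule (ZMod 2) (Fin 9 → ZMod 2) :=
    (T.dualAnnihilator).comap (dotProductEquiv (ZMod 2) (Fin 9)).toLinearMap with hA
  have hAr : finrank (ZMod 2) A = 9 - finrank (ZMod 2) U := by
    have h5 := Subspace.finrank_add_finrank_dualAnnihilator_eq T
    have h6 : finrank (ZMod 2) A = finrank (ZMod 2) T.dualAnnihilator := by
      rw [hA, Submodule.comap_equiv_eq_map_symm, LinearEquiv.finrank_map_eq]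
    rw [Module.finrank_fin_fun] at h5
    omega
  have h7 := Module.card_eq_pow_finrank (K := ZMod 2) (V := A)
  rw [ZMod.card, hAr] at h7
  rw [← h7, ← Fintype.card_subtype]
  apply Fintype.card_congr
  apply Equiv.subtypeEquivRight
  intro a
  simp [hA, hT, Submodule.mem_dualAnnihilator]

lemma card_alpha (n : ℕ) {d : ℕ} {w : Fin d → D 8} (hw : w ∈ LI d) :
    #{α : Fin n → Fin 9 → ZMod 2 | sp w ≤ V α}
      = (2 ^ n) ^ (9 - (2 * d - finrank (ZMod 2) (S (sp w)))) := by
  have h1 := finrank_sup_S (sp_le w)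
  rw [finrank_sp hw] at h1
  have h2 := card_ann (sup_le_D (sp_le w))
  rw [show 2 * d - finrank (ZMod 2) (S (sp w)) = finrank (ZMod 2)
    (sp w ⊔ (sp w).map mX : Submodule (ZMod 2) (ZMod 2)[X]) by omega, ← pow_mul, mul_comm n, pow_mul,
    ← h2, ← Fintype.card_piFinset_const]
  congr 1
  ext α
  simp only [mem_filter, mem_univ, true_and, Fintype.mem_piFinset]
  constructor
  · intro h j p hp
    obtain ⟨q, hq, r, ⟨t, ht, rfl⟩, rfl⟩ := Submodule.mem_sup.1 hp
    rw [map_add, dotProduct_add, ((h hq).2 j).1, ((h ht).2 j).2, add_zero]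
  · intro h p hp
    refine ⟨sp_le w hp, fun j => ⟨h j p (Submodule.mem_sup_left hp), ?_⟩⟩
    exact h j _ (Submodule.mem_sup_right (Submodule.mem_map_of_mem hp))

/-- inversion coefficients -/
def co (d : ℕ) : ℚ :=
  if d = 0 then 0 else (-1) ^ (d - 1) * 2 ^ ((d - 1).choose 2) * (2 ^ d - 1) / (gl d d : ℚ)

lemma inversion (r : ℕ) (hr : r ≤ 8) :
    ∑ d ∈ range 9, co d * (gl d r : ℚ) = if r = 1 then 1 else 0 := by
  interval_cases r <;>
    norm_num [co, gl, Finset.sum_range_succ, Finset.prod_range_succ, Nat.choose]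

lemma Gamma_eq (n : ℕ) : (Gamma n 8 7 : ℚ) =
    ∑ d ∈ range 9, co d * ∑ s ∈ range d, (N d s : ℚ) * (2 ^ n) ^ (9 - (2 * d - s)) := by
  have h1 : (Gamma n 8 7 : ℚ) = ∑ α : Fin n → Fin 9 → ZMod 2,
      ∑ d ∈ range 9, co d * (gl d (finrank (ZMod 2) (V α)) : ℚ) := by
    rw [Gamma, Nat.card_eq_fintype_card, Fintype.card_subtype, Finset.card_filter]
    push_cast
    apply Finset.sum_congr rfl
    intro α _
    have h := rank_add α
    rw [inversion _ (by omega)]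
    congr 1
    apply propext
    omega
  rw [h1, Finset.sum_comm]
  apply Finset.sum_congr rfl
  intro d _
  rw [← Finset.mul_sum]
  rcases Nat.eq_zero_or_pos d with rfl | hd
  · simp [co]
  congr 1
  have h2 : ∀ α : Fin n → Fin 9 → ZMod 2, (gl d (finrank (ZMod 2) (V α)) : ℚ)
      = ∑ w ∈ LI d, if sp w ≤ V α then 1 else 0 := by
    intro α
    rw [← cntLI d (V_le α), Finset.card_filter]
    push_cast
    rfl
  rw [Finset.sum_congr rfl (fun α _ => h2 α), Finset.sum_comm]
  have h3 : ∀ w ∈ LI d, (∑ α : Fin n → Fin 9 → ZMod 2, if sp w ≤ V α then (1 : ℚ) else 0)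
      = (2 ^ n) ^ (9 - (2 * d - finrank (ZMod 2) (S (sp w)))) := by
    intro w hw
    have h4 := card_alpha n hw
    rw [Finset.card_filter] at h4
    exact_mod_cast h4
  rw [Finset.sum_congr rfl h3, ← Finset.sum_fiberwise_of_maps_to (t := range d)
    (g := fun w => finrank (ZMod 2) (S (sp w)))]
  · apply Finset.sum_congr rfl
    intro s _
    rw [Finset.sum_congr rfl (g := fun _ => ((2 : ℚ) ^ n) ^ (9 - (2 * d - s)))]
    · rw [Finset.sum_const, nsmul_eq_mul, N]
    · intro w hw
      rw [(mem_filter.1 hw).2]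
  · intro w hw
    have h5 := finrank_sp hw
    have h6 := S_lt (sp_le w) (by omega)
    simp only [mem_range]
    omega

lemma Gamma_poly : ∃ B6 B7 B8 B9 : ℚ, ∀ n : ℕ, (Gamma n 8 7 : ℚ) =
    255 * (2 ^ n) ^ 7 - 381 * (2 ^ n) ^ 6 - 31122 * (2 ^ n) ^ 5 + 105648 * (2 ^ n) ^ 4
      + B6 * (2 ^ n) ^ 3 + B7 * (2 ^ n) ^ 2 + B8 * 2 ^ n + B9 := by
  have g2 : gl 2 8 = 64770 := by norm_num [gl, Finset.prod_range_succ]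
  have g11 : gl 1 1 = 1 := by norm_num [gl, Finset.prod_range_succ]
  have g22 : gl 2 2 = 6 := by norm_num [gl, Finset.prod_range_succ]
  have g33 : gl 3 3 = 168 := by norm_num [gl, Finset.prod_range_succ]
  have g44 : gl 4 4 = 20160 := by norm_num [gl, Finset.prod_range_succ]
  have n10 : N 1 0 = 255 := by rw [N_top 0 (by norm_num), g11]; norm_num
  have n21 : N 2 1 = 762 := by rw [N_top 1 (by norm_num), g22]; norm_num
  have n32 : N 3 2 = 10584 := by rw [N_top 2 (by norm_num), g33]; norm_num
  have n43 : N 4 3 = 624960 := by rw [N_top 3 (by norm_num), g44]; norm_num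
  have n20 : N 2 0 = 64008 := by
    have := N_sum 2 (by norm_num)
    rw [g2, Finset.sum_range_succ, Finset.sum_range_one, n21] at this
    linarith
  have n31 : N 3 1 = 1312416 := by
    have := N_three
    rw [g33, n32] at this
    linarith
  have c1 : co 1 = 1 := by norm_num [co, g11]
  have c2 : co 2 = -1 / 2 := by norm_num [co, g22]
  have c3 : co 3 = 1 / 12 := by norm_num [co, g33]
  have c4 : co 4 = -1 / 168 := by norm_num [co, g44, Nat.choose]
  refine ⟨co 3 * N 3 0 + co 4 * N 4 2 + co 5 * N 5 4,
    co 4 * N 4 1 + co 5 * N 5 3 + co 6 * N 6 5,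
    co 4 * N 4 0 + co 5 * N 5 2 + co 6 * N 6 4 + co 7 * N 7 6,
    co 5 * (N 5 0 + N 5 1) + co 6 * (N 6 0 + N 6 1 + N 6 2 + N 6 3)
      + co 7 * (N 7 0 + N 7 1 + N 7 2 + N 7 3 + N 7 4 + N 7 5)
      + co 8 * (N 8 0 + N 8 1 + N 8 2 + N 8 3 + N 8 4 + N 8 5 + N 8 6 + N 8 7), fun n => ?_⟩
  rw [Gamma_eq]
  simp only [Finset.sum_range_succ, Finset.sum_range_zero, n10, n21, n32, n43, n20, n31,
    c1, c2, c3, c4]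
  norm_num
  ring

lemma Gamma_small (n : ℕ) (hn : n ≤ 3) : Gamma n 8 7 = 0 := by
  rw [Gamma, Nat.card_eq_zero]
  left
  constructor
  rintro ⟨α, hα⟩
  have := Matrix.rank_le_height (persymMatrix n 8 α)
  omega

end counting

end Pers

theorem gamma_seven_k_eight (n : ℕ) (hn : 1 ≤ n) :
    (Gamma n 8 7 : ℤ) =
      255 * 2 ^ (7 * n) - 381 * 2 ^ (6 * n) - 31122 * 2 ^ (5 * n) + 105648 * 2 ^ (4 * n)
        + 758880 * 2 ^ (3 * n) - 4617984 * 2 ^ (2 * n) + 7913472 * 2 ^ n - 4128768 := by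
  obtain ⟨B6, B7, B8, B9, h⟩ := Pers.Gamma_poly
  have h0 := h 0
  have h1 := h 1
  have h2 := h 2
  have h3 := h 3
  rw [Pers.Gamma_small _ (by norm_num)] at h0 h1 h2 h3
  norm_num at h0 h1 h2 h3
  have e6 : B6 = 758880 := by linarith
  have e7 : B7 = -4617984 := by linarith
  have e8 : B8 = 7913472 := by linarith
  have e9 : B9 = -4128768 := by linarith
  have hh := h n
  rw [e6, e7, e8, e9] at hh
  have : ((Gamma n 8 7 : ℤ) : ℚ) = ((255 * 2 ^ (7 * n) - 381 * 2 ^ (6 * n) - 31122 * 2 ^ (5 * n)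
      + 105648 * 2 ^ (4 * n) + 758880 * 2 ^ (3 * n) - 4617984 * 2 ^ (2 * n) + 7913472 * 2 ^ n
      - 4128768 : ℤ) : ℚ) := by
    push_cast
    rw [hh]
    ring
  exact_mod_cast this
end

section
/- For k = 9 and every integer n ≥ 1, Γ_7(n,9) = 255·2^{7n} + 42291·2^{6n} − 219618·2^{5n} − 4053808·2^{4n} + 32840160·2^{3n} − 82168576·2^{2n} + 81543168·2^n − 27983872 (an identity of integers). -/
open Finset

namespace Persym

abbrev V9 := Fin 9 → ZMod 2
abbrev V10 := Fin 10 → ZMod 2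

/-- Number of linearly independent `d`-tuples in an `m`-dimensional space over `F_2`. -/
def indep (m d : ℕ) : ℕ := ∏ j : Fin d, (2 ^ m - 2 ^ (j : ℕ))

theorem card_indep {W : Type} [AddCommGroup W] [Module (ZMod 2) W] [Finite W] (d : ℕ) :
    Nat.card {s : Fin d → W // LinearIndependent (ZMod 2) s}
      = indep (Module.finrank (ZMod 2) W) d := by
  have : Fintype W := Fintype.ofFinite W
  by_cases h : d ≤ Module.finrank (ZMod 2) W
  · have := card_linearIndependent (K := ZMod 2) (V := W) h
    rw [this]; simp [indep]
  · push Not at h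
    have h1 : indep (Module.finrank (ZMod 2) W) d = 0 := by
      unfold indep
      rw [Finset.prod_eq_zero_iff]
      exact ⟨⟨_, h⟩, Finset.mem_univ _, by simp⟩
    rw [h1]
    have : IsEmpty {s : Fin d → W // LinearIndependent (ZMod 2) s} := by
      constructor
      rintro ⟨s, hs⟩
      have := hs.fintype_card_le_finrank
      simp at this
      omega
    simp

/-- The linear map pairing a parameter vector with all vectors of a tuple. -/
def pairA {d : ℕ} (u : Fin d → V9) : V10 →ₗ[ZMod 2] (Fin d → ZMod 2) where
  toFun a := fun l => ∑ c : Fin 9, a c.castSucc * u l c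
  map_add' a b := by ext l; simp [add_mul, Finset.sum_add_distrib]
  map_smul' r a := by ext l; simp [Finset.mul_sum, mul_assoc]

/-- The same for the shifted vectors. -/
def pairB {d : ℕ} (u : Fin d → V9) : V10 →ₗ[ZMod 2] (Fin d → ZMod 2) where
  toFun a := fun l => ∑ c : Fin 9, a c.succ * u l c
  map_add' a b := by ext l; simp [add_mul, Finset.sum_add_distrib]
  map_smul' r a := by ext l; simp [Finset.mul_sum, mul_assoc]

/-- Parameter vectors whose two rows annihilate the tuple. -/
def K {d : ℕ} (u : Fin d → V9) : Submodule (ZMod 2) V10 :=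
  LinearMap.ker ((pairA u).prod (pairB u))

theorem mem_K {d : ℕ} (u : Fin d → V9) (a : V10) :
    a ∈ K u ↔ ∀ l, (∑ c : Fin 9, a c.castSucc * u l c = 0) ∧
      (∑ c : Fin 9, a c.succ * u l c = 0) := by
  simp [K, pairA, pairB, funext_iff, forall_and]

theorem mulVec_eq_zero_iff (n : ℕ) (α : Fin n → V10) (v : V9) :
    (persymMatrix n 9 α).mulVec v = 0 ↔
      ∀ j, (∑ c : Fin 9, α j c.castSucc * v c = 0) ∧ (∑ c : Fin 9, α j c.succ * v c = 0) := by
  simp only [funext_iff, Matrix.mulVec, dotProduct, persymMatrix, Matrix.of_apply, Pi.zero_apply]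
  constructor
  · intro h j
    constructor
    · have := h ⟨2 * j.val, by omega⟩
      rw [← this]
      refine Finset.sum_congr rfl fun c _ => ?_
      congr 2
      · congr 1
        ext; simp
      · ext; simp
    · have := h ⟨2 * j.val + 1, by omega⟩
      rw [← this]
      refine Finset.sum_congr rfl fun c _ => ?_
      congr 2
      · congr 1
        ext; simp; omega
      · ext; simp; omega
  · intro h r
    obtain ⟨h1, h2⟩ := h ⟨r.val / 2, by omega⟩
    rcases Nat.mod_two_eq_zero_or_one r.val with hr | hr
    · rw [← h1]
      refine Finset.sum_congr rfl fun c _ => ?_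
      congr 2
      ext; simp [hr]
    · rw [← h2]
      refine Finset.sum_congr rfl fun c _ => ?_
      congr 2
      ext; simp [hr]; omega

theorem finrank_K_ge {d : ℕ} (u : Fin d → V9) :
    10 ≤ Module.finrank (ZMod 2) (K u) + 2 * d := by
  have h := LinearMap.finrank_range_add_finrank_ker ((pairA u).prod (pairB u))
  have h2 := Submodule.finrank_le (LinearMap.range ((pairA u).prod (pairB u)))
  simp at h h2
  unfold K
  omega

theorem finrank_K_le {d : ℕ} (hd : 0 < d) (u : Fin d → V9) (hu : LinearIndependent (ZMod 2) u) :
    Module.finrank (ZMod 2) (K u) + d ≤ 9 := by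
  have hsurj : Function.Surjective (pairA u) := by
    have h1 : Function.Surjective (Matrix.of u).mulVecLin := by
      rw [← LinearMap.range_eq_top]
      apply Submodule.eq_top_of_finrank_eq
      have : (Matrix.of u).rank = Fintype.card (Fin d) := hu.rank_matrix
      simpa [Matrix.rank] using this
    intro y
    obtain ⟨x, hx⟩ := h1 y
    refine ⟨Fin.snoc (α := fun _ => ZMod 2) x 0, ?_⟩
    rw [← hx]
    ext l
    simp [pairA, Matrix.mulVec, dotProduct, mul_comm]
  have hA := LinearMap.finrank_range_add_finrank_ker (pairA u)
  rw [LinearMap.range_eq_top.2 hsurj] at hA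
  simp at hA
  have hlt : K u < LinearMap.ker (pairA u) := by
    refine lt_of_le_of_ne ?_ ?_
    · intro a ha
      simp [K] at ha
      simpa using ha.1
    · intro heq
      have key : ∀ a : V10, (∀ l, ∑ c : Fin 9, a c.castSucc * u l c = 0) →
          ∀ l, ∑ c : Fin 9, a c.succ * u l c = 0 := by
        intro a ha
        have : a ∈ K u := by
          rw [heq]
          simpa [pairA, funext_iff] using ha
        rw [mem_K] at this
        exact fun l => (this l).2
      have step : ∀ j : ℕ, ∀ hj : j < 9, ∀ l, u l ⟨8 - j, by omega⟩ = 0 := by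
        intro j
        induction j with
        | zero =>
          intro _ l
          have := key (Pi.single 9 1) (by
            intro l
            apply Finset.sum_eq_zero
            intro c _
            have : c.castSucc ≠ (9 : Fin 10) := by
              intro h; have := congrArg Fin.val h; simp at this; omega
            simp [this]) l
          rw [Finset.sum_eq_single (8 : Fin 9)] at this
          · simpa [Pi.single_apply] using this
          · intro c _ hc
            have : c.succ ≠ (9 : Fin 10) := by
              intro h; apply hc; have := congrArg Fin.val h; ext; simp at this ⊢; omega
            simp [this]
          · simp
        | succ j ih =>
          intro hj l
          have := key (Pi.single ⟨8 - j, by omega⟩ 1) (by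
            intro l
            rw [Finset.sum_eq_single (⟨8 - j, by omega⟩ : Fin 9)]
            · rw [ih (by omega) l]; simp
            · intro c _ hc
              have : c.castSucc ≠ (⟨8 - j, by omega⟩ : Fin 10) := by
                intro h; apply hc; have := congrArg Fin.val h; ext; simpa using this
              simp [this]
            · simp) l
          rw [Finset.sum_eq_single (⟨8 - (j + 1), by omega⟩ : Fin 9)] at this
          · have h2 : Fin.succ (⟨8 - (j + 1), by omega⟩ : Fin 9)
                = (⟨8 - j, by omega⟩ : Fin 10) := by
              ext; simp; omega
            rw [h2] at this
            simpa using this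
          · intro c _ hc
            have : c.succ ≠ (⟨8 - j, by omega⟩ : Fin 10) := by
              intro h; apply hc; have := congrArg Fin.val h; ext; simp at this ⊢; omega
            simp [this]
          · simp
      have hz : u ⟨0, hd⟩ = 0 := by
        ext c
        have := step (8 - c.val) (by omega) ⟨0, hd⟩
        have hc : (⟨8 - (8 - c.val), by omega⟩ : Fin 9) = c := by ext; simp; omega
        rw [hc] at this
        simpa using this
      exact hu.ne_zero _ hz
  have := Submodule.finrank_lt_finrank_of_lt hlt
  omega

/-- Number of independent tuples with prescribed dimension of the annihilator. -/
noncomputable def cc (d m : ℕ) : ℕ :=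
  Nat.card {u : Fin d → V9 // LinearIndependent (ZMod 2) u ∧ Module.finrank (ZMod 2) (K u) = m}

theorem rank_le (n : ℕ) (α : Fin n → V10) : (persymMatrix n 9 α).rank ≤ 9 := by
  simpa using (persymMatrix n 9 α).rank_le_width

theorem gamma_zero (n i : ℕ) (h : 2 * n < i) : Gamma n 9 i = 0 := by
  unfold Gamma
  have : IsEmpty {α : Fin n → Fin (9 + 1) → ZMod 2 // (persymMatrix n 9 α).rank = i} := by
    constructor
    rintro ⟨α, hα⟩
    have := (persymMatrix n 9 α).rank_le_height
    omega
  simp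

theorem cc_zero_lo (d m : ℕ) (h : m + 2 * d < 10) : cc d m = 0 := by
  unfold cc
  rw [Nat.card_eq_zero]
  left
  constructor
  rintro ⟨u, -, hu⟩
  have := finrank_K_ge u
  omega

theorem cc_zero_hi (d m : ℕ) (hd : 0 < d) (h : 9 < m + d) : cc d m = 0 := by
  unfold cc
  rw [Nat.card_eq_zero]
  left
  constructor
  rintro ⟨u, hi, hu⟩
  have := finrank_K_le hd u hi
  omega

theorem card_left (n d : ℕ) (α : Fin n → V10) :
    Nat.card {u : Fin d → V9 // LinearIndependent (ZMod 2) u ∧ ∀ l, ∀ j,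
      (∑ c : Fin 9, α j c.castSucc * u l c = 0) ∧ (∑ c : Fin 9, α j c.succ * u l c = 0)}
      = indep (9 - (persymMatrix n 9 α).rank) d := by
  have h := LinearMap.finrank_range_add_finrank_ker (persymMatrix n 9 α).mulVecLin
  have h2 : Module.finrank (ZMod 2) (LinearMap.ker (persymMatrix n 9 α).mulVecLin)
      = 9 - (persymMatrix n 9 α).rank := by
    simp at h
    unfold Matrix.rank
    omega
  rw [← h2, ← card_indep]
  refine Nat.card_congr ⟨fun u => ⟨fun l => ⟨u.1 l, ?_⟩, ?_⟩, fun s => ⟨fun l => (s.1 l).1, ?_, ?_⟩,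
    ?_, ?_⟩
  · rw [LinearMap.mem_ker, Matrix.mulVecLin_apply, mulVec_eq_zero_iff]
    exact u.2.2 l
  · apply LinearIndependent.of_comp (Submodule.subtype _)
    exact u.2.1
  · exact s.2.map' (Submodule.subtype _) (Submodule.ker_subtype _)
  · intro l
    have := (s.1 l).2
    rwa [LinearMap.mem_ker, Matrix.mulVecLin_apply, mulVec_eq_zero_iff] at this
  · intro u; rfl
  · intro s; rfl

theorem card_right (n d : ℕ) (u : Fin d → V9) :
    Nat.card {α : Fin n → V10 // ∀ l, ∀ j,
      (∑ c : Fin 9, α j c.castSucc * u l c = 0) ∧ (∑ c : Fin 9, α j c.succ * u l c = 0)}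
      = 2 ^ (n * Module.finrank (ZMod 2) (K u)) := by
  have h1 : Nat.card (K u) = 2 ^ Module.finrank (ZMod 2) (K u) := by
    rw [Module.natCard_eq_pow_finrank (K := ZMod 2), Nat.card_zmod]
  rw [mul_comm, pow_mul, ← h1]
  have h3 : Nat.card (Fin n → K u) = Nat.card (K u) ^ n := by rw [Nat.card_fun, Nat.card_fin]
  rw [← h3]
  refine Nat.card_congr ⟨fun α j => ⟨α.1 j, ?_⟩, fun s => ⟨fun j => (s j).1, ?_⟩, ?_, ?_⟩
  · rw [mem_K]; exact fun l => α.2 l j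
  · intro l j
    exact (mem_K u _).1 (s j).2 l
  · intro u; rfl
  · intro s; rfl

open Classical in
theorem main_count (n d : ℕ) :
    ∑ i ∈ range 10, Gamma n 9 i * indep (9 - i) d
      = ∑ m ∈ range 11, cc d m * 2 ^ (n * m) := by
  let R : (Fin n → V10) → (Fin d → V9) → Prop := fun α u => ∀ l, ∀ j,
      (∑ c : Fin 9, α j c.castSucc * u l c = 0) ∧ (∑ c : Fin 9, α j c.succ * u l c = 0)
  have hL : ∑ i ∈ range 10, Gamma n 9 i * indep (9 - i) d
      = ∑ α : Fin n → V10, indep (9 - (persymMatrix n 9 α).rank) d := by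
    rw [← Finset.sum_fiberwise_of_maps_to (s := univ) (t := range 10)
      (g := fun α : Fin n → V10 => (persymMatrix n 9 α).rank)
      (fun α _ => by have := rank_le n α; simp; omega)]
    refine Finset.sum_congr rfl fun i _ => ?_
    rw [Finset.sum_congr rfl (g := fun _ => indep (9 - i) d)
      (fun α hα => by rw [(Finset.mem_filter.1 hα).2])]
    rw [Finset.sum_const, smul_eq_mul]
    congr 1
    unfold Gamma
    rw [Nat.card_eq_fintype_card, Fintype.card_subtype]
  have hR : ∑ m ∈ range 11, cc d m * 2 ^ (n * m)
      = ∑ u ∈ univ.filter (fun u : Fin d → V9 => LinearIndependent (ZMod 2) u),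
        2 ^ (n * Module.finrank (ZMod 2) (K u)) := by
    rw [← Finset.sum_fiberwise_of_maps_to (t := range 11)
      (g := fun u : Fin d → V9 => Module.finrank (ZMod 2) (K u))
      (fun u _ => by have := Submodule.finrank_le (K u); simp at this ⊢; omega)]
    refine Finset.sum_congr rfl fun m _ => ?_
    rw [Finset.sum_congr rfl (g := fun _ => 2 ^ (n * m))
      (fun α hα => by rw [(Finset.mem_filter.1 hα).2])]
    rw [Finset.sum_const, smul_eq_mul]
    congr 1
    unfold cc
    rw [Nat.card_eq_fintype_card, Fintype.card_subtype, Finset.filter_filter]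
  rw [hL, hR]
  have h1 : ∀ α : Fin n → V10, indep (9 - (persymMatrix n 9 α).rank) d
      = ∑ u ∈ univ.filter (fun u : Fin d → V9 => LinearIndependent (ZMod 2) u),
        if R α u then 1 else 0 := by
    intro α
    rw [← card_left, Nat.card_eq_fintype_card, Fintype.card_subtype, ← Finset.filter_filter,
      Finset.card_filter]
  have h2 : ∀ u : Fin d → V9, 2 ^ (n * Module.finrank (ZMod 2) (K u))
      = ∑ α : Fin n → V10, if R α u then 1 else 0 := by
    intro u
    rw [← card_right, Nat.card_eq_fintype_card, Fintype.card_subtype, Finset.card_filter]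
  simp_rw [h1, h2]
  exact Finset.sum_comm

/-- `Gamma n 9 i` as a rational number. -/
noncomputable def gq (n i : ℕ) : ℚ := (Gamma n 9 i : ℚ)

/-- `cc d m` as a rational number. -/
noncomputable def cq (d m : ℕ) : ℚ := (cc d m : ℚ)

theorem gq_zero (n i : ℕ) (h : 2 * n < i) : gq n i = 0 := by
  simp [gq, gamma_zero n i h]

theorem cq_lo (d m : ℕ) (h : m + 2 * d < 10) : cq d m = 0 := by
  simp [cq, cc_zero_lo d m h]

theorem cq_hi (d m : ℕ) (hd : 0 < d) (h : 9 < m + d) : cq d m = 0 := by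
  simp [cq, cc_zero_hi d m hd h]

theorem main_q (n d : ℕ) :
    ∑ i ∈ range 10, gq n i * (indep (9 - i) d : ℚ)
      = ∑ m ∈ range 11, cq d m * ((2 : ℚ) ^ n) ^ m := by
  have h := congrArg (Nat.cast : ℕ → ℚ) (main_count n d)
  push_cast at h
  simpa only [gq, cq, pow_mul] using h

theorem eq0 (n : ℕ) :
    gq n 0 * 1 + gq n 1 * 1 + gq n 2 * 1 + gq n 3 * 1 + gq n 4 * 1 + gq n 5 * 1 + gq n 6 * 1 + gq n 7 * 1 + gq n 8 * 1 + gq n 9 * 1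
      = cq 0 10 * ((2 : ℚ) ^ n) ^ 10 := by
  have h := main_q n 0
  norm_num [Finset.sum_range_succ, indep, Fin.prod_univ_succ, cq_lo, cq_hi] at h
  linarith

theorem eq1 (n : ℕ) :
    gq n 0 * 511 + gq n 1 * 255 + gq n 2 * 127 + gq n 3 * 63 + gq n 4 * 31 + gq n 5 * 15 + gq n 6 * 7 + gq n 7 * 3 + gq n 8 * 1
      = cq 1 8 * ((2 : ℚ) ^ n) ^ 8 := by
  have h := main_q n 1
  norm_num [Finset.sum_range_succ, indep, Fin.prod_univ_succ, cq_lo, cq_hi] at h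
  linarith

theorem eq2 (n : ℕ) :
    gq n 0 * 260610 + gq n 1 * 64770 + gq n 2 * 16002 + gq n 3 * 3906 + gq n 4 * 930 + gq n 5 * 210 + gq n 6 * 42 + gq n 7 * 6
      = cq 2 6 * ((2 : ℚ) ^ n) ^ 6 + cq 2 7 * ((2 : ℚ) ^ n) ^ 7 := by
  have h := main_q n 2
  norm_num [Finset.sum_range_succ, indep, Fin.prod_univ_succ, cq_lo, cq_hi] at h
  linarith

theorem eq3 (n : ℕ) :
    gq n 0 * 132389880 + gq n 1 * 16322040 + gq n 2 * 1984248 + gq n 3 * 234360 + gq n 4 * 26040 + gq n 5 * 2520 + gq n 6 * 168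
      = cq 3 4 * ((2 : ℚ) ^ n) ^ 4 + cq 3 5 * ((2 : ℚ) ^ n) ^ 5 + cq 3 6 * ((2 : ℚ) ^ n) ^ 6 := by
  have h := main_q n 3
  norm_num [Finset.sum_range_succ, indep, Fin.prod_univ_succ, cq_lo, cq_hi] at h
  linarith

theorem eq4 (n : ℕ) :
    gq n 0 * 66724499520 + gq n 1 * 4047865920 + gq n 2 * 238109760 + gq n 3 * 13124160 + gq n 4 * 624960 + gq n 5 * 20160
      = cq 4 2 * ((2 : ℚ) ^ n) ^ 2 + cq 4 3 * ((2 : ℚ) ^ n) ^ 3 + cq 4 4 * ((2 : ℚ) ^ n) ^ 4 + cq 4 5 * ((2 : ℚ) ^ n) ^ 5 := by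
  have h := main_q n 4
  norm_num [Finset.sum_range_succ, indep, Fin.prod_univ_succ, cq_lo, cq_hi] at h
  linarith

theorem eq5 (n : ℕ) :
    gq n 0 * 33095351761920 + gq n 1 * 971487820800 + gq n 2 * 26668293120 + gq n 3 * 629959680 + gq n 4 * 9999360
      = cq 5 0 * ((2 : ℚ) ^ n) ^ 0 + cq 5 1 * ((2 : ℚ) ^ n) ^ 1 + cq 5 2 * ((2 : ℚ) ^ n) ^ 2 + cq 5 3 * ((2 : ℚ) ^ n) ^ 3 + cq 5 4 * ((2 : ℚ) ^ n) ^ 4 := by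
  have h := main_q n 5
  norm_num [Finset.sum_range_succ, indep, Fin.prod_univ_succ, cq_lo, cq_hi] at h
  linarith

theorem eq6 (n : ℕ) :
    gq n 0 * 15885768845721600 + gq n 1 * 217613271859200 + gq n 2 * 2560156139520 + gq n 3 * 20158709760
      = cq 6 0 * ((2 : ℚ) ^ n) ^ 0 + cq 6 1 * ((2 : ℚ) ^ n) ^ 1 + cq 6 2 * ((2 : ℚ) ^ n) ^ 2 + cq 6 3 * ((2 : ℚ) ^ n) ^ 3 := by
  have h := main_q n 6
  norm_num [Finset.sum_range_succ, indep, Fin.prod_univ_succ, cq_lo, cq_hi] at h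
  linarith

theorem eq7 (n : ℕ) :
    gq n 0 * 7116824442883276800 + gq n 1 * 41781748196966400 + gq n 2 * 163849992929280
      = cq 7 0 * ((2 : ℚ) ^ n) ^ 0 + cq 7 1 * ((2 : ℚ) ^ n) ^ 1 + cq 7 2 * ((2 : ℚ) ^ n) ^ 2 := by
  have h := main_q n 7
  norm_num [Finset.sum_range_succ, indep, Fin.prod_univ_succ, cq_lo, cq_hi] at h
  linarith

set_option maxRecDepth 20000 in
theorem eq8 (n : ℕ) :
    gq n 0 * 2732860586067178291200 + gq n 1 * 5348063769211699200
      = cq 8 0 * ((2 : ℚ) ^ n) ^ 0 + cq 8 1 * ((2 : ℚ) ^ n) ^ 1 := by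
  have h := main_q n 8
  norm_num [Finset.sum_range_succ, indep, Fin.prod_univ_succ, cq_lo, cq_hi] at h
  linarith

set_option maxRecDepth 20000 in
theorem eq9 (n : ℕ) :
    gq n 0 * 699612310033197642547200
      = cq 9 0 * ((2 : ℚ) ^ n) ^ 0 := by
  have h := main_q n 9
  norm_num [Finset.sum_range_succ, indep, Fin.prod_univ_succ, cq_lo, cq_hi] at h
  linarith

theorem gval0 : gq 0 0 = 1 := by
  have : Subsingleton (Fin 0 → Fin (9 + 1) → ZMod 2) := inferInstance
  have h : ∀ α : Fin 0 → Fin (9 + 1) → ZMod 2, (persymMatrix 0 9 α).rank = 0 := by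
    intro α
    have := (persymMatrix 0 9 α).rank_le_height
    omega
  simp [gq, Gamma, h]

theorem cval0 : cq 0 10 = 1 := by
  have h0 := eq0 0
  have a00 := gval0
  norm_num [gq_zero, a00] at h0
  linarith

theorem cval9 : cq 9 0 = 699612310033197642547200 := by
  have h0 := eq9 0
  have a00 := gval0
  norm_num [gq_zero, a00] at h0
  linarith

theorem cval1 : cq 1 8 = 511 := by
  have h0 := eq1 0
  have a00 := gval0
  norm_num [gq_zero, a00] at h0
  linarith

theorem gval1 : gq 1 0 = 1 ∧ gq 1 1 = 3 ∧ gq 1 2 = 1020 := by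
  have h9 := eq9 1
  have b90 := cval9
  rw [b90] at h9
  norm_num [gq_zero] at h9
  have h0 := eq0 1
  have b010 := cval0
  rw [b010] at h0
  norm_num [gq_zero] at h0
  have h1 := eq1 1
  have b18 := cval1
  rw [b18] at h1
  norm_num [gq_zero] at h1
  have g0 : gq 1 0 = 1 := by linarith
  rw [g0] at h0
  rw [g0] at h1
  have g1 : gq 1 1 = 3 := by linarith only [h0, h1]
  have g2 : gq 1 2 = 1020 := by linarith only [h0, h1]
  exact ⟨g0, g1, g2⟩

theorem cval2 : cq 2 6 = 259080 ∧ cq 2 7 = 1530 := by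
  have h0 := eq2 0
  have a00 := gval0
  norm_num [gq_zero, a00] at h0
  have h1 := eq2 1
  obtain ⟨a10, a11, a12⟩ := gval1
  norm_num [gq_zero, a10, a11, a12] at h1
  refine ⟨?_, ?_⟩ <;> linarith

theorem cval8 : cq 8 0 = 2716816394759543193600 ∧ cq 8 1 = 16044191307635097600 := by
  have h0 := eq8 0
  have a00 := gval0
  norm_num [gq_zero, a00] at h0
  have h1 := eq8 1
  obtain ⟨a10, a11, a12⟩ := gval1
  norm_num [gq_zero, a10, a11] at h1
  refine ⟨?_, ?_⟩ <;> linarith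

theorem gval2 : gq 2 0 = 1 ∧ gq 2 1 = 9 ∧ gq 2 2 = 3102 ∧ gq 2 3 = 21336 ∧ gq 2 4 = 1024128 := by
  have h9 := eq9 2
  have b90 := cval9
  rw [b90] at h9
  norm_num [gq_zero] at h9
  have h8 := eq8 2
  obtain ⟨b80, b81⟩ := cval8
  rw [b80, b81] at h8
  norm_num [gq_zero] at h8
  have h0 := eq0 2
  have b010 := cval0
  rw [b010] at h0
  norm_num [gq_zero] at h0
  have h1 := eq1 2
  have b18 := cval1
  rw [b18] at h1
  norm_num [gq_zero] at h1
  have h2 := eq2 2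
  obtain ⟨b26, b27⟩ := cval2
  rw [b26, b27] at h2
  norm_num [gq_zero] at h2
  have g0 : gq 2 0 = 1 := by linarith
  have g1 : gq 2 1 = 9 := by linarith
  rw [g0, g1] at h0
  rw [g0, g1] at h1
  rw [g0, g1] at h2
  have g2 : gq 2 2 = 3102 := by linarith only [h0, h1, h2]
  have g3 : gq 2 3 = 21336 := by linarith only [h0, h1, h2]
  have g4 : gq 2 4 = 1024128 := by linarith only [h0, h1, h2]
  exact ⟨g0, g1, g2, g3, g4⟩

theorem cval3 : cq 3 4 = 126991872 ∧ cq 3 5 = 5376672 ∧ cq 3 6 = 21336 := by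
  have h0 := eq3 0
  have a00 := gval0
  norm_num [gq_zero, a00] at h0
  have h1 := eq3 1
  obtain ⟨a10, a11, a12⟩ := gval1
  norm_num [gq_zero, a10, a11, a12] at h1
  have h2 := eq3 2
  obtain ⟨a20, a21, a22, a23, a24⟩ := gval2
  norm_num [gq_zero, a20, a21, a22, a23, a24] at h2
  refine ⟨?_, ?_, ?_⟩ <;> linarith

theorem cval7 : cq 7 0 = 6826646105405521920 ∧ cq 7 1 = 289031387527249920 ∧ cq 7 2 = 1146949950504960 := by
  have h0 := eq7 0
  have a00 := gval0
  norm_num [gq_zero, a00] at h0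
  have h1 := eq7 1
  obtain ⟨a10, a11, a12⟩ := gval1
  norm_num [gq_zero, a10, a11, a12] at h1
  have h2 := eq7 2
  obtain ⟨a20, a21, a22, a23, a24⟩ := gval2
  norm_num [gq_zero, a20, a21, a22] at h2
  refine ⟨?_, ?_, ?_⟩ <;> linarith

theorem gval3 : gq 3 0 = 1 ∧ gq 3 1 = 21 ∧ gq 3 2 = 7434 ∧ gq 3 3 = 151872 ∧ gq 3 4 = 8650656 ∧ gq 3 5 = 104993280 ∧ gq 3 6 = 959938560 := by
  have h9 := eq9 3
  have b90 := cval9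
  rw [b90] at h9
  norm_num [gq_zero] at h9
  have h8 := eq8 3
  obtain ⟨b80, b81⟩ := cval8
  rw [b80, b81] at h8
  norm_num [gq_zero] at h8
  have h7 := eq7 3
  obtain ⟨b70, b71, b72⟩ := cval7
  rw [b70, b71, b72] at h7
  norm_num [gq_zero] at h7
  have h0 := eq0 3
  have b010 := cval0
  rw [b010] at h0
  norm_num [gq_zero] at h0
  have h1 := eq1 3
  have b18 := cval1
  rw [b18] at h1
  norm_num [gq_zero] at h1
  have h2 := eq2 3
  obtain ⟨b26, b27⟩ := cval2
  rw [b26, b27] at h2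
  norm_num [gq_zero] at h2
  have h3 := eq3 3
  obtain ⟨b34, b35, b36⟩ := cval3
  rw [b34, b35, b36] at h3
  norm_num [gq_zero] at h3
  have g0 : gq 3 0 = 1 := by linarith
  have g1 : gq 3 1 = 21 := by linarith
  have g2 : gq 3 2 = 7434 := by linarith
  rw [g0, g1, g2] at h0
  rw [g0, g1, g2] at h1
  rw [g0, g1, g2] at h2
  rw [g0, g1, g2] at h3
  have g3 : gq 3 3 = 151872 := by linarith only [h0, h1, h2, h3]
  have g4 : gq 3 4 = 8650656 := by linarith only [h0, h1, h2, h3]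
  have g5 : gq 3 5 = 104993280 := by linarith only [h0, h1, h2, h3]
  have g6 : gq 3 6 = 959938560 := by linarith only [h0, h1, h2, h3]
  exact ⟨g0, g1, g2, g3, g4, g5, g6⟩

theorem cval4 : cq 4 2 = 53756559360 ∧ cq 4 3 = 12599193600 ∧ cq 4 4 = 367476480 ∧ cq 4 5 = 1270080 := by
  have h0 := eq4 0
  have a00 := gval0
  norm_num [gq_zero, a00] at h0
  have h1 := eq4 1
  obtain ⟨a10, a11, a12⟩ := gval1
  norm_num [gq_zero, a10, a11, a12] at h1
  have h2 := eq4 2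
  obtain ⟨a20, a21, a22, a23, a24⟩ := gval2
  norm_num [gq_zero, a20, a21, a22, a23, a24] at h2
  have h3 := eq4 3
  obtain ⟨a30, a31, a32, a33, a34, a35, a36⟩ := gval3
  norm_num [gq_zero, a30, a31, a32, a33, a34, a35] at h3
  refine ⟨?_, ?_, ?_, ?_⟩ <;> linarith

theorem cval6 : cq 6 0 = 12798361652428800 ∧ cq 6 1 = 2999616012288000 ∧ cq 6 2 = 87488800358400 ∧ cq 6 3 = 302380646400 := by
  have h0 := eq6 0
  have a00 := gval0
  norm_num [gq_zero, a00] at h0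
  have h1 := eq6 1
  obtain ⟨a10, a11, a12⟩ := gval1
  norm_num [gq_zero, a10, a11, a12] at h1
  have h2 := eq6 2
  obtain ⟨a20, a21, a22, a23, a24⟩ := gval2
  norm_num [gq_zero, a20, a21, a22, a23] at h2
  have h3 := eq6 3
  obtain ⟨a30, a31, a32, a33, a34, a35, a36⟩ := gval3
  norm_num [gq_zero, a30, a31, a32, a33] at h3
  refine ⟨?_, ?_, ?_, ?_⟩ <;> linarith

theorem gval4 : gq 4 0 = 1 ∧ gq 4 1 = 45 ∧ gq 4 2 = 16770 ∧ gq 4 3 = 784560 ∧ gq 4 4 = 58695840 ∧ gq 4 5 = 1962374400 ∧ gq 4 6 = 45397094400 ∧ gq 4 7 = 396774604800 ∧ gq 4 8 = 655318056960 := by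
  have h9 := eq9 4
  have b90 := cval9
  rw [b90] at h9
  norm_num [gq_zero] at h9
  have h8 := eq8 4
  obtain ⟨b80, b81⟩ := cval8
  rw [b80, b81] at h8
  norm_num [gq_zero] at h8
  have h7 := eq7 4
  obtain ⟨b70, b71, b72⟩ := cval7
  rw [b70, b71, b72] at h7
  norm_num [gq_zero] at h7
  have h6 := eq6 4
  obtain ⟨b60, b61, b62, b63⟩ := cval6
  rw [b60, b61, b62, b63] at h6
  norm_num [gq_zero] at h6
  have h0 := eq0 4
  have b010 := cval0
  rw [b010] at h0
  norm_num [gq_zero] at h0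
  have h1 := eq1 4
  have b18 := cval1
  rw [b18] at h1
  norm_num [gq_zero] at h1
  have h2 := eq2 4
  obtain ⟨b26, b27⟩ := cval2
  rw [b26, b27] at h2
  norm_num [gq_zero] at h2
  have h3 := eq3 4
  obtain ⟨b34, b35, b36⟩ := cval3
  rw [b34, b35, b36] at h3
  norm_num [gq_zero] at h3
  have h4 := eq4 4
  obtain ⟨b42, b43, b44, b45⟩ := cval4
  rw [b42, b43, b44, b45] at h4
  norm_num [gq_zero] at h4
  have g0 : gq 4 0 = 1 := by linarith
  have g1 : gq 4 1 = 45 := by linarith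
  have g2 : gq 4 2 = 16770 := by linarith
  have g3 : gq 4 3 = 784560 := by linarith
  rw [g0, g1, g2, g3] at h0
  rw [g0, g1, g2, g3] at h1
  rw [g0, g1, g2, g3] at h2
  rw [g0, g1, g2, g3] at h3
  rw [g0, g1, g2, g3] at h4
  have g4 : gq 4 4 = 58695840 := by linarith only [h0, h1, h2, h3, h4]
  have g5 : gq 4 5 = 1962374400 := by linarith only [h0, h1, h2, h3, h4]
  have g6 : gq 4 6 = 45397094400 := by linarith only [h0, h1, h2, h3, h4]
  have g7 : gq 4 7 = 396774604800 := by linarith only [h0, h1, h2, h3, h4]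
  have g8 : gq 4 8 = 655318056960 := by linarith only [h0, h1, h2, h3, h4]
  exact ⟨g0, g1, g2, g3, g4, g5, g6, g7, g8⟩

theorem cval5 : cq 5 0 = 10485088911360 ∧ cq 5 1 = 19045181030400 ∧ cq 5 2 = 3471777792000 ∧ cq 5 3 = 92994048000 ∧ cq 5 4 = 309980160 := by
  have h0 := eq5 0
  have a00 := gval0
  norm_num [gq_zero, a00] at h0
  have h1 := eq5 1
  obtain ⟨a10, a11, a12⟩ := gval1
  norm_num [gq_zero, a10, a11, a12] at h1
  have h2 := eq5 2
  obtain ⟨a20, a21, a22, a23, a24⟩ := gval2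
  norm_num [gq_zero, a20, a21, a22, a23, a24] at h2
  have h3 := eq5 3
  obtain ⟨a30, a31, a32, a33, a34, a35, a36⟩ := gval3
  norm_num [gq_zero, a30, a31, a32, a33, a34] at h3
  have h4 := eq5 4
  obtain ⟨a40, a41, a42, a43, a44, a45, a46, a47, a48⟩ := gval4
  norm_num [gq_zero, a40, a41, a42, a43, a44] at h4
  refine ⟨?_, ?_, ?_, ?_, ?_⟩ <;> linarith

end Persym

theorem gamma_seven_k_nine (n : ℕ) (hn : 1 ≤ n) :
    (Gamma n 9 7 : ℤ) =
      255 * 2 ^ (7 * n) + 42291 * 2 ^ (6 * n) - 219618 * 2 ^ (5 * n)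
        - 4053808 * 2 ^ (4 * n) + 32840160 * 2 ^ (3 * n) - 82168576 * 2 ^ (2 * n)
        + 81543168 * 2 ^ n - 27983872 := by
  have h9 := Persym.eq9 n
  have b90 := Persym.cval9
  rw [b90] at h9
  have h8 := Persym.eq8 n
  obtain ⟨b80, b81⟩ := Persym.cval8
  rw [b80, b81] at h8
  have h7 := Persym.eq7 n
  obtain ⟨b70, b71, b72⟩ := Persym.cval7
  rw [b70, b71, b72] at h7
  have h6 := Persym.eq6 n
  obtain ⟨b60, b61, b62, b63⟩ := Persym.cval6
  rw [b60, b61, b62, b63] at h6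
  have h5 := Persym.eq5 n
  obtain ⟨b50, b51, b52, b53, b54⟩ := Persym.cval5
  rw [b50, b51, b52, b53, b54] at h5
  have h4 := Persym.eq4 n
  obtain ⟨b42, b43, b44, b45⟩ := Persym.cval4
  rw [b42, b43, b44, b45] at h4
  have h3 := Persym.eq3 n
  obtain ⟨b34, b35, b36⟩ := Persym.cval3
  rw [b34, b35, b36] at h3
  have h2 := Persym.eq2 n
  obtain ⟨b26, b27⟩ := Persym.cval2
  rw [b26, b27] at h2
  have key : (Gamma n 9 7 : ℚ) =
      255 * 2 ^ (7 * n) + 42291 * 2 ^ (6 * n) - 219618 * 2 ^ (5 * n)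
        - 4053808 * 2 ^ (4 * n) + 32840160 * 2 ^ (3 * n) - 82168576 * 2 ^ (2 * n)
        + 81543168 * 2 ^ n - 27983872 := by
    change Persym.gq n 7 = _
    simp only [mul_comm _ n, pow_mul]
    generalize (2 : ℚ) ^ n = T at *
    have g0 : Persym.gq n 0 = (1) * T ^ 0 := by
      linarith
    have g1 : Persym.gq n 1 = (-3) * T ^ 0 + (3) * T ^ 1 := by
      rw [g0] at h8
      linarith
    have g2 : Persym.gq n 2 = (-1006) * T ^ 0 + (999) * T ^ 1 + (7) * T ^ 2 := by
      rw [g0, g1] at h7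
      linarith
    have g3 : Persym.gq n 3 = (6992) * T ^ 0 + (-10458) * T ^ 1 + (3451) * T ^ 2 + (15) * T ^ 3 := by
      rw [g0, g1, g2] at h6
      linarith
    have g4 : Persym.gq n 4 = (272800) * T ^ 0 + (-392304) * T ^ 1 + (111118) * T ^ 2 + (8355) * T ^ 3 + (31) * T ^ 4 := by
      rw [g0, g1, g2, g3] at h5
      linarith
    have g5 : Persym.gq n 5 = (-3834112) * T ^ 0 + (6568032) * T ^ 1 + (-3107440) * T ^ 2 + (356190) * T ^ 3 + (17267) * T ^ 4 + (63) * T ^ 5 := by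
      rw [g0, g1, g2, g3, g4] at h4
      linarith
    have g6 : Persym.gq n 6 = (16859136) * T ^ 0 + (-35215104) * T ^ 1 + (24491488) * T ^ 2 + (-6658800) * T ^ 3 + (492094) * T ^ 4 + (31059) * T ^ 5 + (127) * T ^ 6 := by
      rw [g0, g1, g2, g3, g4, g5] at h3
      linarith
    have g7 : Persym.gq n 7 = (-27983872) * T ^ 0 + (81543168) * T ^ 1 + (-82168576) * T ^ 2 + (32840160) * T ^ 3 + (-4053808) * T ^ 4 + (-219618) * T ^ 5 + (42291) * T ^ 6 + (255) * T ^ 7 := by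
      rw [g0, g1, g2, g3, g4, g5, g6] at h2
      linarith
    rw [g7]
    ring
  exact_mod_cast key
end
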